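/- There exist constants k# and C, depending only on m and n, such that the following holds. Let E ⊂ ℝⁿ be finite, let f : E → [0,∞), and let M₀ > 0. Suppose that for each S ⊆ E with #(S) ≤ k# there exists a family (P^x)_{x∈S} of polynomials of degree at most m−1 such that P^x ∈ Γ_f(x, M₀) for each x ∈ S, and |∂^β(P^x − P^y)(x)| ≤ M₀|x − y|^{m−|β|} for all x, y ∈ S and |β| ≤ m−1. Then there exists F ∈ C^m(ℝⁿ) such that ‖F‖_{C^m(ℝⁿ)} ≤ CM₀, F ≥ 0 everywhere on ℝⁿ, and F = f on E. -/

import Mathlib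

open scoped BigOperators

noncomputable section

abbrev Euc (n : ℕ) : Type := EuclideanSpace ℝ (Fin n)
abbrev MPoly (n : ℕ) : Type := MvPolynomial (Fin n) ℝ

/-- Partial derivative in the `i`-th coordinate direction. -/
noncomputable def pD {n : ℕ} (i : Fin n) (F : Euc n → ℝ) : Euc n → ℝ :=
  fun x => fderiv ℝ F x (EuclideanSpace.single i (1 : ℝ))

/-- The multi-index partial derivative `∂^α F`. -/
noncomputable def mD {n : ℕ} (α : Fin n → ℕ) (F : Euc n → ℝ) : Euc n → ℝ :=
  (((List.finRange n).flatMap fun i => List.replicate (α i) i)).foldr pD F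

/-- Partial derivative within a set. -/
noncomputable def pDW {n : ℕ} (s : Set (Euc n)) (i : Fin n) (F : Euc n → ℝ) : Euc n → ℝ :=
  fun x => fderivWithin ℝ F s x (EuclideanSpace.single i (1 : ℝ))

/-- Multi-index partial derivative within a set. -/
noncomputable def mDW {n : ℕ} (s : Set (Euc n)) (α : Fin n → ℕ) (F : Euc n → ℝ) : Euc n → ℝ :=
  (((List.finRange n).flatMap fun i => List.replicate (α i) i)).foldr (pDW s) F

/-- The order `|α|` of a multi-index. -/
def deg {n : ℕ} (α : Fin n → ℕ) : ℕ := ∑ i, α i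

/-- Evaluation of an `n`-variable polynomial at a point of `ℝⁿ`. -/
noncomputable def peval {n : ℕ} (P : MPoly n) (x : Euc n) : ℝ :=
  MvPolynomial.eval (fun i => x i) P

/-- `F ∈ C^m(ℝⁿ)` with `‖F‖_{C^m(ℝⁿ)} ≤ M`. -/
def CmNormLe (m n : ℕ) (F : Euc n → ℝ) (M : ℝ) : Prop :=
  ContDiff ℝ (m : ℕ∞) F ∧ ∀ α : Fin n → ℕ, deg α ≤ m → ∀ x : Euc n, |mD α F x| ≤ M

/-- `F ∈ C^{m-1,1}(ℝⁿ)` with `‖F‖_{C^{m-1,1}(ℝⁿ)} ≤ M`. -/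
def CmLipNormLe (m n : ℕ) (F : Euc n → ℝ) (M : ℝ) : Prop :=
  ContDiff ℝ ((m - 1 : ℕ) : ℕ∞) F ∧
  (∀ α : Fin n → ℕ, deg α ≤ m - 1 → ∀ x : Euc n, |mD α F x| ≤ M) ∧
  (∀ α : Fin n → ℕ, deg α = m - 1 → ∀ i : Fin n, ∀ x : Euc n, ∀ t : ℝ,
    |mD α F (x + t • EuclideanSpace.single i (1 : ℝ)) - mD α F x| ≤ M * |t|)

/-- `J_x(F) = P`, i.e. `P` is the `(m-1)`-st order Taylor polynomial of `F` at `x`. -/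
def IsJetAt (m n : ℕ) (F : Euc n → ℝ) (x : Euc n) (P : MPoly n) : Prop :=
  P.totalDegree ≤ m - 1 ∧
  ∀ α : Fin n → ℕ, deg α ≤ m - 1 → mD α (peval P) x = mD α F x

/-- `J_x^+(F) = P`, i.e. `P` is the `m`-th order Taylor polynomial of `F` at `x`. -/
def IsJetPlusAt (m n : ℕ) (F : Euc n → ℝ) (x : Euc n) (P : MPoly n) : Prop :=
  P.totalDegree ≤ m ∧
  ∀ α : Fin n → ℕ, deg α ≤ m → mD α (peval P) x = mD α F x

/-- Truncation of a polynomial: keep the monomials of total degree `≤ d`. -/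
noncomputable def truncLE {n : ℕ} (d : ℕ) (P : MPoly n) : MPoly n :=
  ∑ s ∈ P.support.filter (fun s => (s.sum fun _ e => e) ≤ d),
    MvPolynomial.monomial s (P.coeff s)

/-- Substitution `y ↦ y + v` in a polynomial. -/
noncomputable def polyShift {n : ℕ} (v : Fin n → ℝ) (P : MPoly n) : MPoly n :=
  MvPolynomial.aeval (fun i => (MvPolynomial.X i + MvPolynomial.C (v i) : MPoly n)) P

/-- The `(m-1)`-st order Taylor polynomial of a polynomial `P` at `x`. -/
noncomputable def jetTrunc (m n : ℕ) (x : Euc n) (P : MPoly n) : MPoly n :=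
  polyShift (fun i => -(x i)) (truncLE (m - 1) (polyShift (fun i => x i) P))

/-- Multiplication of `(m-1)`-jets at `x`: `P ⊙_x Q = J_x(PQ)`. -/
noncomputable def jmul (m n : ℕ) (x : Euc n) (P Q : MPoly n) : MPoly n :=
  jetTrunc m n x (P * Q)

/-- `Γ*(x,M)`. -/
def GammaStar (m n : ℕ) (x : Euc n) (M : ℝ) : Set (MPoly n) :=
  {P | ∃ F : Euc n → ℝ, CmNormLe m n F M ∧ (∀ y, 0 ≤ F y) ∧ IsJetAt m n F x P}

/-- `Γ_f(x,M)`. -/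
def GammaF (m n : ℕ) (f : Euc n → ℝ) (x : Euc n) (M : ℝ) : Set (MPoly n) :=
  {P ∈ GammaStar m n x M | peval P x = f x}

/-- `Γ'*(x,M)` (the `C^{m-1,1}` version). -/
def GammaStar' (m n : ℕ) (x : Euc n) (M : ℝ) : Set (MPoly n) :=
  {P | ∃ F : Euc n → ℝ, CmLipNormLe m n F M ∧ (∀ y, 0 ≤ F y) ∧ IsJetAt m n F x P}

/-- `Γ'_f(x,M)`. -/
def GammaF' (m n : ℕ) (f : Euc n → ℝ) (x : Euc n) (M : ℝ) : Set (MPoly n) :=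
  {P ∈ GammaStar' m n x M | peval P x = f x}

/-- `Γ₀⁺`. -/
def Gamma0plus (m n : ℕ) : Set (MPoly n) :=
  {P | P.totalDegree ≤ m ∧
    (∀ β : Fin n → ℕ, deg β ≤ m → |mD β (peval P) 0| ≤ 1) ∧
    (∀ x : Euc n, 0 ≤ peval P x + ‖x‖ ^ m) ∧
    (∀ ε : ℝ, 0 < ε → ∃ δ : ℝ, 0 < δ ∧ ∀ x : Euc n, ‖x‖ ≤ δ → 0 ≤ peval P x + ε * ‖x‖ ^ m)}

/-- `Γ̃₀'`. -/
def GammaTilde0' (m n : ℕ) : Set (MPoly n) :=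
  {P | P.totalDegree ≤ m - 1 ∧
    (∀ β : Fin n → ℕ, deg β ≤ m - 1 → |mD β (peval P) 0| ≤ 1) ∧
    ∀ x : Euc n, 0 ≤ peval P x + ‖x‖ ^ m}

/-- The closed axis-parallel cube with center `c` and sidelength `δ`. -/
def cube {n : ℕ} (c : Euc n) (δ : ℝ) : Set (Euc n) :=
  {y | ∀ i, |y i - c i| ≤ δ / 2}

/-- `F ∈ C^{m-1,1}(Q)` with `‖F‖_{C^{m-1,1}(Q)} ≤ M`, for the cube `Q` of center `c`,
sidelength `δ`. -/
def CmLipOnCubeLe (m n : ℕ) (c : Euc n) (δ : ℝ) (F : Euc n → ℝ) (M : ℝ) : Prop :=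
  ContDiffOn ℝ ((m - 1 : ℕ) : ℕ∞) F (cube c δ) ∧
  (∀ α : Fin n → ℕ, deg α ≤ m - 1 → ∀ x ∈ cube c δ, |mDW (cube c δ) α F x| ≤ M) ∧
  (∀ α : Fin n → ℕ, deg α = m - 1 → ∀ i : Fin n, ∀ x ∈ cube c δ, ∀ t : ℝ,
    x + t • EuclideanSpace.single i (1 : ℝ) ∈ cube c δ →
    |mDW (cube c δ) α F (x + t • EuclideanSpace.single i (1 : ℝ)) - mDW (cube c δ) α F x|
      ≤ M * |t|)

namespace FP

variable {n : ℕ}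

/-- basis vector -/
abbrev ev (i : Fin n) : Euc n := EuclideanSpace.single i (1 : ℝ)

/-- sorted list of a multiindex -/
def ml (α : Fin n → ℕ) : List (Fin n) := (List.finRange n).flatMap fun i => List.replicate (α i) i

lemma ml_length (α : Fin n → ℕ) : (ml α).length = deg α := by
  simp [ml, deg, List.length_flatMap, ← List.ofFn_eq_map, List.sum_ofFn]

lemma ml_count (α : Fin n → ℕ) (i : Fin n) : (ml α).count i = α i := by
  have : (List.map (fun j => List.count i (List.replicate (α j) j)) (List.finRange n)).sum
      = ∑ j, List.count i (List.replicate (α j) j) := by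
    rw [← List.ofFn_eq_map, List.sum_ofFn]
  simp only [ml, List.count_flatMap, Function.comp_def]
  rw [this]
  simp only [List.count_replicate]
  simp

lemma mD_def (α : Fin n → ℕ) (F : Euc n → ℝ) : mD α F = (ml α).foldr pD F := rfl

lemma foldr_pD_eq {F : Euc n → ℝ} {N : ℕ} (hF : ContDiff ℝ N F) (l : List (Fin n))
    (hl : l.length ≤ N) (x : Euc n) :
    l.foldr pD F x = iteratedFDeriv ℝ l.length F x (fun j => ev (l.get j)) := by
  induction l generalizing x with
  | nil => simp
  | cons a l ih =>
    simp only [List.foldr_cons, List.length_cons] at *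
    have hl' : l.length ≤ N := by omega
    have h1 : l.foldr pD F = fun y => iteratedFDeriv ℝ l.length F y (fun j => ev (l.get j)) := by
      funext y; exact ih hl' y
    rw [h1, pD, iteratedFDeriv_succ_apply_left]
    have hd : DifferentiableAt ℝ (iteratedFDeriv ℝ l.length F) x := by
      have := hF.differentiable_iteratedFDeriv (m := l.length) (by exact_mod_cast hl)
      exact this x
    have := fderiv_continuousMultilinear_apply_const hd (fun j => ev (l.get j))
    simp only [ this]
    rfl

lemma abs_mD_le {F : Euc n → ℝ} {N : ℕ} (hF : ContDiff ℝ N F) (β : Fin n → ℕ)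
    (hl : deg β ≤ N) (x : Euc n) : |mD β F x| ≤ ‖iteratedFDeriv ℝ (deg β) F x‖ := by
  rw [mD_def, foldr_pD_eq hF _ (by rw [ml_length]; exact hl), ← ml_length β]
  exact (ContinuousMultilinearMap.le_opNorm (iteratedFDeriv ℝ (ml β).length F x)
    (fun j => ev ((ml β).get j))).trans (by simp)

lemma multi_bound {k : ℕ} (T : ContinuousMultilinearMap ℝ (fun _ : Fin k => Euc n) ℝ) (K : ℝ)
    (hK : ∀ i : Fin k → Fin n, |T (fun j => ev (i j))| ≤ K) (hK0 : 0 ≤ K) :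
    ‖T‖ ≤ (n : ℝ) ^ k * K := by
  refine ContinuousMultilinearMap.opNorm_le_bound (by positivity) fun v => ?_
  have hv : v = fun j => ∑ i, (v j i) • ev i := by
    funext j
    ext a
    simp [Finset.sum_apply, Pi.single_apply]
  have : T v = ∑ r : Fin k → Fin n, (∏ j, v j (r j)) • T (fun j => ev (r j)) := by
    conv_lhs => rw [hv]
    rw [ContinuousMultilinearMap.map_sum]
    refine Finset.sum_congr rfl fun r _ => ?_
    exact T.map_smul_univ (fun j => v j (r j)) (fun j => ev (r j))
  rw [this]
  refine (norm_sum_le _ _).trans ?_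
  have : ∀ r ∈ (Finset.univ : Finset (Fin k → Fin n)),
      ‖(∏ j, v j (r j)) • T (fun j => ev (r j))‖ ≤ K * ∏ j, ‖v j‖ := by
    intro r _
    rw [norm_smul, mul_comm]
    refine mul_le_mul (hK r) ?_ (norm_nonneg _) hK0
    rw [norm_prod]
    exact Finset.prod_le_prod (fun _ _ => norm_nonneg _) fun j _ => PiLp.norm_apply_le _ _
  refine (Finset.sum_le_card_nsmul _ _ _ this).trans ?_
  simp [mul_assoc]

lemma pD_contDiff {F : Euc n → ℝ} {N : ℕ} (hF : ContDiff ℝ (N + 1 : ℕ) F) (a : Fin n) :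
    ContDiff ℝ N (pD a F) := by
  unfold pD
  exact (hF.fderiv_right (m := N) (by norm_cast)).clm_apply contDiff_const

lemma pD_comm {F : Euc n → ℝ} (hF : ContDiff ℝ 2 F) (a b : Fin n) :
    pD a (pD b F) = pD b (pD a F) := by
  have key : ∀ (a b : Fin n) (x : Euc n), pD a (pD b F) x = fderiv ℝ (fderiv ℝ F) x (ev a) (ev b) := by
    intro a b x
    unfold pD
    have hd : DifferentiableAt ℝ (fderiv ℝ F) x :=
      ((hF.fderiv_right (m := 1) (by norm_num)).differentiable (by norm_num)) x
    rw [fderiv_clm_apply hd (differentiableAt_const _)]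
    simp
  funext x
  rw [key, key]
  have := (hF.contDiffAt (x := x)).isSymmSndFDerivAt (by simp)
  exact this _ _

lemma foldr_contDiff (l : List (Fin n)) : ∀ {F : Euc n → ℝ} {N : ℕ}, ContDiff ℝ (N + l.length : ℕ) F →
    ContDiff ℝ N (l.foldr pD F) := by
  induction l with
  | nil => intro F N h; simpa using h
  | cons a l ih =>
    intro F N h
    simp only [List.foldr_cons]
    apply pD_contDiff
    apply ih
    convert h using 2
    simp; ring

lemma foldr_perm {l l' : List (Fin n)} (h : l.Perm l') {F : Euc n → ℝ} {N : ℕ} (hF : ContDiff ℝ N F)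
    (hl : l.length ≤ N) : l.foldr pD F = l'.foldr pD F := by
  induction h with
  | nil => rfl
  | cons a _ ih =>
    simp only [List.length_cons] at hl
    simp only [List.foldr_cons]; rw [ih (by omega)]
  | swap a b l =>
    simp only [List.length_cons] at hl
    simp only [List.foldr_cons]
    apply pD_comm
    exact foldr_contDiff l (N := 2) (hF.of_le (by norm_cast; omega))
  | trans h1 h2 ih1 ih2 => rw [ih1 hl, ih2 (by rw [← h1.length_eq]; exact hl)]

lemma foldr_eq_mD (l : List (Fin n)) {F : Euc n → ℝ} {N : ℕ} (hF : ContDiff ℝ N F)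
    (hl : l.length ≤ N) : l.foldr pD F = mD (fun a => l.count a) F := by
  rw [mD_def]
  refine foldr_perm ?_ hF hl
  rw [List.perm_iff_count]; intro a; rw [ml_count]

lemma deg_count (l : List (Fin n)) : deg (fun a => l.count a) = l.length := by
  have := Multiset.sum_count_eq_card (s := Finset.univ) (m := (l : Multiset (Fin n))) (by simp)
  simpa [deg] using this

lemma norm_iter_le {F : Euc n → ℝ} {N : ℕ} (hF : ContDiff ℝ N F) {k : ℕ}
    (hl : k ≤ N) (x : Euc n) {K : ℝ} (hK0 : 0 ≤ K)
    (h : ∀ β : Fin n → ℕ, deg β = k → |mD β F x| ≤ K) :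
    ‖iteratedFDeriv ℝ k F x‖ ≤ (n : ℝ) ^ k * K := by
  refine multi_bound _ K (fun i => ?_) hK0
  obtain ⟨l, hl2, hi⟩ : ∃ (l : List (Fin n)) (h : l.length = k), ∀ j : Fin k, i j = l.get (j.cast h.symm) :=
    ⟨List.ofFn i, by simp, by simp⟩
  subst hl2
  have e := foldr_pD_eq hF l hl x
  have : i = fun j => l.get j := by funext j; simpa using hi j
  rw [this, ← e, foldr_eq_mD l hF hl]
  exact h _ (deg_count l)

end FP

namespace FP
open scoped ContDiff Classical
set_option linter.all false

variable {n : ℕ}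

/-- normalised monomial centred at `x` -/
def Em (γ : Fin n → ℕ) (x : Euc n) : Euc n → ℝ := fun z => ∏ i, (z i - x i) ^ γ i / (γ i).factorial

lemma Em_contDiff (γ : Fin n → ℕ) (x : Euc n) {N : ℕ∞} : ContDiff ℝ N (Em γ x) := by
  unfold Em
  refine contDiff_prod fun i _ => ?_
  refine ContDiff.div_const ?_ _
  refine ContDiff.pow ?_ _
  refine ContDiff.sub ?_ contDiff_const
  exact (EuclideanSpace.proj i : Euc n →L[ℝ] ℝ).contDiff

lemma pD_Em (γ : Fin n → ℕ) (x : Euc n) (i : Fin n) :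
    pD i (Em γ x) = if γ i = 0 then 0 else Em (Function.update γ i (γ i - 1)) x := by
  funext z
  have hd : DifferentiableAt ℝ (Em γ x) z := ((Em_contDiff γ x (N := 1)).differentiable (by norm_num)) z
  unfold pD
  rw [← hd.lineDeriv_eq_fderiv, lineDeriv]
  have h1 : (fun t : ℝ => Em γ x (z + t • ev i)) = fun t =>
      (∏ j ∈ Finset.univ.erase i, (z j - x j) ^ γ j / (γ j).factorial) *
        (((z i - x i) + t) ^ γ i / (γ i).factorial) := by
    funext t
    unfold Em
    rw [← Finset.mul_prod_erase Finset.univ _ (Finset.mem_univ i), mul_comm]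
    congr 1
    · refine Finset.prod_congr rfl fun j hj => ?_
      have : j ≠ i := Finset.ne_of_mem_erase hj
      simp [this]
    · congr 2
      simp; ring
  rw [h1]
  have h2 : HasDerivAt (fun t : ℝ => (∏ j ∈ Finset.univ.erase i, (z j - x j) ^ γ j / (γ j).factorial) *
        (((z i - x i) + t) ^ γ i / (γ i).factorial))
      ((∏ j ∈ Finset.univ.erase i, (z j - x j) ^ γ j / (γ j).factorial) *
        ((γ i * ((z i - x i) + 0) ^ (γ i - 1) * 1) / (γ i).factorial)) 0 := by
    refine HasDerivAt.const_mul _ (HasDerivAt.div_const ?_ _)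
    exact HasDerivAt.pow ((hasDerivAt_id (0:ℝ)).const_add _) _
  rw [h2.deriv]
  split_ifs with h
  · simp [h]
  · unfold Em
    rw [← Finset.mul_prod_erase Finset.univ _ (Finset.mem_univ i), mul_comm]
    congr 1
    · simp only [Function.update_self, add_zero, mul_one]
      obtain ⟨k, hk⟩ : ∃ k, γ i = k + 1 := ⟨γ i - 1, by omega⟩
      rw [hk, Nat.factorial_succ]
      have : (k.factorial : ℝ) ≠ 0 := by positivity
      push_cast
      field_simp
    · refine Finset.prod_congr rfl fun j hj => ?_
      have : j ≠ i := Finset.ne_of_mem_erase hj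
      simp [this]

lemma pD_zero (i : Fin n) : pD i (0 : Euc n → ℝ) = 0 := by
  funext z; simp [pD]

lemma foldr_Em (l : List (Fin n)) (γ : Fin n → ℕ) (x : Euc n) :
    l.foldr pD (Em γ x) = if (∀ i, l.count i ≤ γ i) then Em (fun i => γ i - l.count i) x else 0 := by
  induction l with
  | nil => simp
  | cons a l ih =>
    rw [List.foldr_cons, ih]
    by_cases h : ∀ i, l.count i ≤ γ i
    · rw [if_pos h, pD_Em]
      by_cases h2 : γ a - l.count a = 0
      · rw [if_pos h2, if_neg]
        intro h3; have := h3 a; rw [List.count_cons_self] at this; omega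
      · rw [if_neg h2, if_pos]
        · congr 1; funext i
          by_cases hi : i = a
          · subst hi; simp; omega
          · rw [Function.update_of_ne hi, List.count_cons_of_ne (Ne.symm hi)]
        · intro i
          by_cases hi : i = a
          · subst hi; rw [List.count_cons_self]; omega
          · rw [List.count_cons_of_ne (Ne.symm hi)]; exact h i
    · rw [if_neg h, pD_zero, if_neg]
      intro h3; apply h; intro i; exact (List.count_le_count_cons).trans (h3 i)

lemma mD_Em (β γ : Fin n → ℕ) (x : Euc n) :
    mD β (Em γ x) = if β ≤ γ then Em (γ - β) x else 0 := by
  rw [mD_def, foldr_Em]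
  simp only [ml_count, Pi.le_def]
  rfl

lemma Em_self (γ : Fin n → ℕ) (x : Euc n) : Em γ x x = if γ = 0 then 1 else 0 := by
  unfold Em
  split_ifs with h
  · subst h; simp
  · have : ∃ i, γ i ≠ 0 := by
      by_contra h'; push Not at h'; exact h (funext h')
    obtain ⟨i, hi⟩ := this
    apply Finset.prod_eq_zero (Finset.mem_univ i)
    simp [hi]

lemma mD_Em_self (β γ : Fin n → ℕ) (x : Euc n) : mD β (Em γ x) x = if β = γ then 1 else 0 := by
  rw [mD_Em]
  by_cases h : β ≤ γ
  · rw [if_pos h, Em_self]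
    congr 1
    rw [eq_iff_iff]
    constructor
    · intro h2; funext i; have := congrFun h2 i; have h3 : β i ≤ γ i := h i; simp at this; omega
    · rintro rfl; simp
  · rw [if_neg h, if_neg]
    · rfl
    · rintro rfl; exact h le_rfl

lemma deg_mono {β γ : Fin n → ℕ} (h : β ≤ γ) : deg β ≤ deg γ := Finset.sum_le_sum fun i _ => h i

lemma deg_add (β γ : Fin n → ℕ) : deg (β + γ) = deg β + deg γ := by simp [deg, Finset.sum_add_distrib]

/-- polynomials of degree `< m` -/
def Pm (m n : ℕ) : Submodule ℝ (Euc n → ℝ) where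
  carrier := {P | ContDiff ℝ ∞ P ∧ ∀ x, iteratedFDeriv ℝ m P x = 0}
  add_mem' := by
    rintro P Q ⟨h1, h2⟩ ⟨h3, h4⟩
    refine ⟨h1.add h3, fun x => ?_⟩
    rw [iteratedFDeriv_add_apply (h1.contDiffAt.of_le (by exact_mod_cast le_top)) (h3.contDiffAt.of_le (by exact_mod_cast le_top)), h2, h4, add_zero]
  zero_mem' := ⟨contDiff_const, fun x => by simp [iteratedFDeriv_zero_fun]⟩
  smul_mem' := by
    rintro c P ⟨h1, h2⟩
    refine ⟨contDiff_const.smul h1, fun x => ?_⟩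
    rw [iteratedFDeriv_const_smul_apply (h1.contDiffAt.of_le (by exact_mod_cast le_top)), h2, smul_zero]

variable {m : ℕ}

lemma Pm_cd (P : Pm m n) {N : ℕ} : ContDiff ℝ N (P : Euc n → ℝ) := P.2.1.of_le (by exact_mod_cast le_top)

lemma mD_add {F G : Euc n → ℝ} {N : ℕ} (hF : ContDiff ℝ N F) (hG : ContDiff ℝ N G) {β : Fin n → ℕ}
    (h : deg β ≤ N) (x : Euc n) : mD β (F + G) x = mD β F x + mD β G x := by
  have hl : (ml β).length ≤ N := by rw [ml_length]; exact h
  rw [mD_def, mD_def, mD_def, foldr_pD_eq hF _ hl, foldr_pD_eq hG _ hl, foldr_pD_eq (show ContDiff ℝ N (F + G) from hF.add hG) _ hl,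
    iteratedFDeriv_add_apply (hF.contDiffAt.of_le (by exact_mod_cast hl)) (hG.contDiffAt.of_le (by exact_mod_cast hl))]
  rfl

lemma mD_smul {F : Euc n → ℝ} {N : ℕ} (hF : ContDiff ℝ N F) (c : ℝ) {β : Fin n → ℕ}
    (h : deg β ≤ N) (x : Euc n) : mD β (c • F) x = c * mD β F x := by
  have hl : (ml β).length ≤ N := by rw [ml_length]; exact h
  rw [mD_def, mD_def, foldr_pD_eq hF _ hl, foldr_pD_eq (show ContDiff ℝ N (c • F) from contDiff_const.smul hF) _ hl]
  have := iteratedFDeriv_const_smul_apply (a := c) (hF.contDiffAt.of_le (n := N) (m := (ml β).length) (x := x) (by exact_mod_cast hl))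
  rw [this]
  rfl

/-- coefficient functional -/
def cf (x : Euc n) (β : Fin n → ℕ) : Pm m n →ₗ[ℝ] ℝ where
  toFun P := mD β P x
  map_add' P Q := mD_add (Pm_cd P (N := deg β)) (Pm_cd Q) le_rfl x
  map_smul' c P := mD_smul (Pm_cd P (N := deg β)) c le_rfl x

lemma cf_def (x : Euc n) (β : Fin n → ℕ) (P : Pm m n) : cf x β P = mD β P x := rfl

/-- multiindices of order `< m` -/
def mis (m n : ℕ) : Finset (Fin n → ℕ) :=
  (Fintype.piFinset fun _ => Finset.range m).filter fun β => deg β < m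

lemma mem_mis {β : Fin n → ℕ} : β ∈ mis m n ↔ deg β < m := by
  unfold mis
  simp only [Finset.mem_filter, Fintype.mem_piFinset, Finset.mem_range, and_iff_right_iff_imp]
  intro h i
  exact lt_of_le_of_lt (Finset.single_le_sum (f := β) (fun _ _ => Nat.zero_le _) (Finset.mem_univ i)) h

lemma iter_zero_of {F : Euc n → ℝ} {N : ℕ} (hF : ContDiff ℝ N F) {k : ℕ}
    (hl : k ≤ N) (x : Euc n) (h : ∀ β : Fin n → ℕ, deg β = k → mD β F x = 0) :
    iteratedFDeriv ℝ k F x = 0 := by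
  have := norm_iter_le hF hl x (K := 0) le_rfl (fun β hβ => by rw [h β hβ]; simp)
  simpa using this

/-- basis polynomial -/
def eb (γ : Fin n → ℕ) (x : Euc n) : Pm m n :=
  if h : deg γ < m then ⟨Em γ x, Em_contDiff γ x, fun z => iter_zero_of (Em_contDiff γ x (N := m)) le_rfl z
    (fun β hβ => by
      rw [mD_Em, if_neg]
      · rfl
      · intro h2; have := deg_mono h2; omega)⟩ else 0

lemma eb_coe {γ : Fin n → ℕ} (h : deg γ < m) (x : Euc n) : ((eb γ x : Pm m n) : Euc n → ℝ) = Em γ x := by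
  rw [eb, dif_pos h]

lemma cf_eb {γ : Fin n → ℕ} (h : deg γ < m) (x y : Euc n) (β : Fin n → ℕ) :
    cf y β (eb γ x : Pm m n) = if β ≤ γ then Em (γ - β) x y else 0 := by
  rw [cf_def, eb_coe h, mD_Em]
  split_ifs <;> rfl

lemma cf_eb_self {γ : Fin n → ℕ} (h : deg γ < m) (x : Euc n) (β : Fin n → ℕ) :
    cf x β (eb γ x : Pm m n) = if β = γ then 1 else 0 := by
  rw [cf_def, eb_coe h, mD_Em_self]

lemma Pm_zero (P : Pm m n) (x : Euc n) (h : ∀ β ∈ mis m n, cf x β P = 0) : P = 0 := by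
  have key : ∀ j, j ≤ m → ∀ z, iteratedFDeriv ℝ (m - j) (P : Euc n → ℝ) z = 0 := by
    intro j
    induction j with
    | zero => intro _ z; exact P.2.2 z
    | succ j ih =>
      intro hj z
      have h0 : iteratedFDeriv ℝ (m - (j + 1)) (P : Euc n → ℝ) x = 0 :=
        iter_zero_of (Pm_cd P) le_rfl x (fun β hβ => h β (mem_mis.2 (by omega)))
      have hd : Differentiable ℝ (iteratedFDeriv ℝ (m - (j + 1)) (P : Euc n → ℝ)) :=
        (Pm_cd P (N := m - (j+1) + 1)).differentiable_iteratedFDeriv (by norm_cast; omega)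
      rw [← h0]
      refine is_const_of_fderiv_eq_zero (𝕜 := ℝ) hd (fun w => ?_) z x
      have h3 := ih (by omega) w
      rw [show m - j = m - (j+1) + 1 by omega] at h3
      have := norm_fderiv_iteratedFDeriv (𝕜 := ℝ) (f := (P : Euc n → ℝ)) (x := w) (n := m - (j+1))
      rw [h3, norm_zero] at this
      exact norm_eq_zero.1 this
  ext z
  have := key m le_rfl z
  rw [Nat.sub_self] at this
  have h2 := congrArg (fun T => T 0) this
  simpa using h2

lemma Pm_ext (x : Euc n) {P Q : Pm m n} (h : ∀ β ∈ mis m n, cf x β P = cf x β Q) : P = Q := by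
  rw [← sub_eq_zero]
  refine Pm_zero _ x fun β hβ => ?_
  rw [map_sub, h β hβ, sub_self]

/-- polynomial with prescribed coefficients at `x` -/
def mk (x : Euc n) (a : (Fin n → ℕ) → ℝ) : Pm m n := ∑ γ ∈ mis m n, a γ • eb γ x

lemma cf_mk (x : Euc n) (a : (Fin n → ℕ) → ℝ) {β : Fin n → ℕ} (h : β ∈ mis m n) :
    cf x β (mk x a : Pm m n) = a β := by
  unfold mk
  rw [map_sum]
  rw [Finset.sum_eq_single β]
  · rw [map_smul, cf_eb_self (mem_mis.1 h)]; simp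
  · intro γ hγ hne; rw [map_smul, cf_eb_self (mem_mis.1 hγ), if_neg (Ne.symm hne)]; simp
  · intro h'; exact absurd h h'

lemma taylor (x : Euc n) (P : Pm m n) : P = mk x (fun γ => cf x γ P) :=
  Pm_ext x fun β hβ => by rw [cf_mk x _ hβ]

lemma cf_taylor (x y : Euc n) (P : Pm m n) (β : Fin n → ℕ) :
    cf y β P = ∑ γ ∈ mis m n, cf x γ P * (if β ≤ γ then Em (γ - β) x y else 0) := by
  conv_lhs => rw [taylor x P]
  unfold mk
  rw [map_sum]
  refine Finset.sum_congr rfl fun γ hγ => ?_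
  rw [map_smul, cf_eb (mem_mis.1 hγ)]; simp

lemma Em_bound (γ : Fin n → ℕ) (x y : Euc n) : |Em γ x y| ≤ ‖y - x‖ ^ deg γ := by
  unfold Em deg
  rw [Finset.abs_prod, ← Finset.prod_pow_eq_pow_sum]
  refine Finset.prod_le_prod (fun _ _ => abs_nonneg _) fun i _ => ?_
  rw [abs_div, abs_pow]
  refine (div_le_self (by positivity) ?_).trans ?_
  · rw [Nat.abs_cast]; exact_mod_cast Nat.one_le_iff_ne_zero.2 (Nat.factorial_ne_zero _)
  · exact pow_le_pow_left₀ (abs_nonneg _) (by have := PiLp.norm_apply_le (y - x) i; simpa using this) _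

instance : FiniteDimensional ℝ (Pm m n) := by
  let f : Pm m n →ₗ[ℝ] (↥(mis m n) → ℝ) := LinearMap.pi fun β => cf 0 β.1
  refine FiniteDimensional.of_injective f ?_
  intro P Q h
  exact Pm_ext 0 fun β hβ => congrFun h ⟨β, hβ⟩

end FP

namespace FP
open scoped ContDiff Classical Topology
set_option linter.all false

variable {m n : ℕ}

lemma cd_smul {F : Euc n → ℝ} {N : ℕ} (hF : ContDiff ℝ N F) (c : ℝ) : ContDiff ℝ N (c • F) :=
  contDiff_const.smul hF

lemma cd_sub {F G : Euc n → ℝ} {N : ℕ} (hF : ContDiff ℝ N F) (hG : ContDiff ℝ N G) : ContDiff ℝ N (F - G) :=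
  hF.sub hG

lemma cd_mul {F G : Euc n → ℝ} {N : ℕ} (hF : ContDiff ℝ N F) (hG : ContDiff ℝ N G) : ContDiff ℝ N (F * G) :=
  hF.mul hG

lemma cd_add {F G : Euc n → ℝ} {N : ℕ} (hF : ContDiff ℝ N F) (hG : ContDiff ℝ N G) : ContDiff ℝ N (F + G) :=
  hF.add hG

lemma mD_sub {F G : Euc n → ℝ} {N : ℕ} (hF : ContDiff ℝ N F) (hG : ContDiff ℝ N G) {β : Fin n → ℕ}
    (h : deg β ≤ N) (x : Euc n) : mD β (F - G) x = mD β F x - mD β G x := by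
  have : F - G = F + (-1 : ℝ) • G := by funext z; simp [sub_eq_add_neg]
  rw [this, mD_add hF (cd_smul hG _) h, mD_smul hG _ h]; ring

/-- scaled bound -/
def nb (x : Euc n) (s : ℝ) (P : Pm m n) (C : ℝ) : Prop :=
  ∀ β ∈ mis m n, |cf x β P| ≤ C * s ^ (m - deg β)

/-- number of multiindices, plus one -/
def Dn (m n : ℕ) : ℝ := (mis m n).card + 1

lemma Dn_one : 1 ≤ Dn m n := by unfold Dn; have : (0:ℝ) ≤ (mis m n).card := by positivity
                                linarith

lemma nb.mono {x : Euc n} {s : ℝ} {P : Pm m n} {C C' : ℝ} (h : nb x s P C) (hs : 0 ≤ s) (hC : C ≤ C') :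
    nb x s P C' := fun β hβ => (h β hβ).trans (by gcongr)

lemma nb.scale {x : Euc n} {s s' : ℝ} {P : Pm m n} {C : ℝ} (h : nb x s P C) (hs : 0 ≤ s) (hss : s ≤ s')
    (hC : 0 ≤ C) : nb x s' P C := fun β hβ => (h β hβ).trans (by gcongr)

lemma nb.add {x : Euc n} {s : ℝ} {P Q : Pm m n} {C C' : ℝ} (h : nb x s P C) (h' : nb x s Q C') :
    nb x s (P + Q) (C + C') := fun β hβ => by
  rw [map_add, add_mul]; exact (abs_add_le _ _).trans (add_le_add (h β hβ) (h' β hβ))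

lemma nb.smul {x : Euc n} {s : ℝ} {P : Pm m n} {C : ℝ} (h : nb x s P C) (c : ℝ) :
    nb x s (c • P) (|c| * C) := fun β hβ => by
  rw [map_smul, smul_eq_mul, abs_mul, mul_assoc]; exact mul_le_mul_of_nonneg_left (h β hβ) (abs_nonneg _)

lemma nb.neg {x : Euc n} {s : ℝ} {P : Pm m n} {C : ℝ} (h : nb x s P C) :
    nb x s (-P) C := fun β hβ => by rw [map_neg, abs_neg]; exact h β hβ

lemma nb.sub {x : Euc n} {s : ℝ} {P Q : Pm m n} {C C' : ℝ} (h : nb x s P C) (h' : nb x s Q C') :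
    nb x s (P - Q) (C + C') := by rw [sub_eq_add_neg]; exact h.add h'.neg

lemma nb_comm {x : Euc n} {s : ℝ} {P Q : Pm m n} {C : ℝ} (h : nb x s (P - Q) C) : nb x s (Q - P) C := by
  rw [← neg_sub]; exact h.neg

lemma nb.tri {x : Euc n} {s : ℝ} {P Q R : Pm m n} {C C' : ℝ} (h : nb x s (P - Q) C) (h' : nb x s (Q - R) C') :
    nb x s (P - R) (C + C') := by
  have := h.add h'; rwa [sub_add_sub_cancel] at this

lemma nb_zero {x : Euc n} {s : ℝ} {C : ℝ} (hs : 0 ≤ s) (hC : 0 ≤ C) : nb x s (0 : Pm m n) C := fun β _ => by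
  rw [map_zero, abs_zero]; positivity

/-- going down in scale by a factor `K ≥ 1` -/
lemma nb.down {x : Euc n} {s s' : ℝ} {P : Pm m n} {C K : ℝ} (h : nb x s P C) (hK : 1 ≤ K) (hs : 0 ≤ s)
    (hs' : 0 ≤ s') (hss : s ≤ K * s') (hC : 0 ≤ C) : nb x s' P (K ^ m * C) := fun β hβ => by
  refine (h β hβ).trans ?_
  calc C * s ^ (m - deg β) ≤ C * (K * s') ^ (m - deg β) := by gcongr
    _ = C * (K ^ (m - deg β) * s' ^ (m - deg β)) := by rw [mul_pow]
    _ ≤ C * (K ^ m * s' ^ (m - deg β)) := by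
        gcongr
        omega
    _ = _ := by ring

/-- going up in scale gains -/
lemma nb.up {x : Euc n} {s s' : ℝ} {P : Pm m n} {C ε : ℝ} (h : nb x s P C) (hε : ε ≤ 1) (hε0 : 0 ≤ ε) (hs : 0 ≤ s)
    (hs' : 0 ≤ s') (hss : s ≤ ε * s') (hC : 0 ≤ C) : nb x s' P (ε * C) := fun β hβ => by
  refine (h β hβ).trans ?_
  have h1 := mem_mis.1 hβ
  calc C * s ^ (m - deg β) ≤ C * (ε * s') ^ (m - deg β) := by gcongr
    _ = C * (ε ^ (m - deg β) * s' ^ (m - deg β)) := by rw [mul_pow]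
    _ ≤ C * (ε * s' ^ (m - deg β)) := by
        gcongr
        exact pow_le_of_le_one hε0 hε (by omega)
    _ = _ := by ring

lemma Em_term {x y : Euc n} {δ t : ℝ} (ht0 : 0 ≤ t) (ht : t ≤ 1) (hδ : 0 ≤ δ) (hxy : ‖x - y‖ ≤ t * δ) {β γ : Fin n → ℕ}
    (h : β ≤ γ) (hne : β ≠ γ) : |Em (γ - β) x y| ≤ t * δ ^ (deg γ - deg β) := by
  have hd : deg γ = deg β + deg (γ - β) := by
    rw [← deg_add, add_tsub_cancel_of_le h]
  have hpos : deg (γ - β) ≠ 0 := by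
    intro h0
    apply hne
    funext i
    have h1 : (γ - β) i ≤ deg (γ - β) :=
      Finset.single_le_sum (f := (γ - β)) (fun _ _ => Nat.zero_le _) (Finset.mem_univ i)
    have h2 : β i ≤ γ i := h i
    simp at h1; omega
  have he : deg γ - deg β = deg (γ - β) := by omega
  rw [he]
  refine (Em_bound _ _ _).trans ?_
  rw [norm_sub_rev]
  calc ‖x - y‖ ^ deg (γ - β) ≤ (t * δ) ^ deg (γ - β) := by gcongr
    _ = t ^ deg (γ - β) * δ ^ deg (γ - β) := mul_pow _ _ _
    _ ≤ _ := by gcongr; exact pow_le_of_le_one ht0 ht hpos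

lemma cf_diff {x y : Euc n} {δ t C : ℝ} {P : Pm m n} (h : nb x δ P C) (ht0 : 0 ≤ t) (ht : t ≤ 1) (hδ : 0 ≤ δ)
    (hxy : ‖x - y‖ ≤ t * δ) (hC : 0 ≤ C) {β : Fin n → ℕ} (hβ : β ∈ mis m n) :
    |cf y β P - cf x β P| ≤ (Dn m n - 1) * C * t * δ ^ (m - deg β) := by
  have hβ' := mem_mis.1 hβ
  have e1 : cf x β P = ∑ γ ∈ mis m n, cf x γ P * (if β = γ then 1 else 0) := by
    simp [hβ]
  rw [cf_taylor x y P β, e1, ← Finset.sum_sub_distrib]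
  refine (Finset.abs_sum_le_sum_abs _ _).trans ?_
  have : ∀ γ ∈ mis m n, |cf x γ P * (if β ≤ γ then Em (γ - β) x y else 0) - cf x γ P * (if β = γ then 1 else 0)|
      ≤ C * t * δ ^ (m - deg β) := by
    intro γ hγ
    have hγ' := mem_mis.1 hγ
    rw [← mul_sub]
    by_cases hbg : β = γ
    · subst hbg; simp [Em]; positivity
    · rw [if_neg hbg, sub_zero]
      by_cases hle : β ≤ γ
      · rw [if_pos hle, abs_mul]
        have hdg := deg_mono hle
        calc |cf x γ P| * |Em (γ - β) x y| ≤ (C * δ ^ (m - deg γ)) * (t * δ ^ (deg γ - deg β)) :=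
              mul_le_mul (h γ hγ) (Em_term ht0 ht hδ hxy hle hbg) (abs_nonneg _) (by positivity)
          _ = C * t * δ ^ ((m - deg γ) + (deg γ - deg β)) := by rw [pow_add]; ring
          _ = _ := by congr 2; omega
      · rw [if_neg hle]; simp; positivity
  refine (Finset.sum_le_card_nsmul _ _ _ this).trans ?_
  unfold Dn
  rw [nsmul_eq_mul]; apply le_of_eq; ring

lemma nb.shift {x y : Euc n} {δ C : ℝ} {P : Pm m n} (h : nb x δ P C) 
    (hxy : ‖x - y‖ ≤ δ) (hC : 0 ≤ C) : nb y δ P (Dn m n * C) := fun β hβ => by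
  have hδ : 0 ≤ δ := (norm_nonneg _).trans hxy
  have h1 := cf_diff h (t := 1) (by norm_num) le_rfl hδ (by simpa using hxy) hC hβ
  have h2 := h β hβ
  have h3 : |cf y β P| ≤ |cf y β P - cf x β P| + |cf x β P| := by
    have := abs_add_le (cf y β P - cf x β P) (cf x β P); simpa using this
  have : Dn m n * C * δ ^ (m - deg β) = (Dn m n - 1) * C * 1 * δ ^ (m - deg β) + C * δ ^ (m - deg β) := by ring
  rw [this]; linarith

/-- closed upward inside `mis` -/
def Mono (A : Finset (Fin n → ℕ)) (m : ℕ) : Prop := ∀ α ∈ A, ∀ γ ∈ mis m n, α ≤ γ → γ ∈ A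

/-- all coefficients in `A` vanish (everywhere) -/
def VA (A : Finset (Fin n → ℕ)) (P : Pm m n) : Prop := ∀ y, ∀ α ∈ A, cf y α P = 0

lemma VA_of {A : Finset (Fin n → ℕ)} (hA : Mono A m) {x : Euc n} {P : Pm m n} (h : ∀ α ∈ A, cf x α P = 0) : VA A P := by
  intro y α hα
  rw [cf_taylor x y]
  refine Finset.sum_eq_zero fun γ hγ => ?_
  by_cases hle : α ≤ γ
  · rw [h γ (hA α hα γ hγ hle), zero_mul]
  · rw [if_neg hle, mul_zero]

/-- jet of a function -/
def J (x : Euc n) (F : Euc n → ℝ) : Pm m n := mk x (fun β => mD β F x)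

lemma cf_J (x : Euc n) (F : Euc n → ℝ) {β : Fin n → ℕ} (h : β ∈ mis m n) :
    cf x β (J x F : Pm m n) = mD β F x := cf_mk x _ h

lemma J_add (x : Euc n) {F G : Euc n → ℝ} (hF : ContDiff ℝ m F) (hG : ContDiff ℝ m G) :
    (J x (F + G) : Pm m n) = J x F + J x G := Pm_ext x fun β hβ => by
  rw [map_add, cf_J _ _ hβ, cf_J _ _ hβ, cf_J _ _ hβ, mD_add hF hG (mem_mis.1 hβ).le]

lemma J_smul (x : Euc n) {F : Euc n → ℝ} (hF : ContDiff ℝ m F) (c : ℝ) :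
    (J x (c • F) : Pm m n) = c • J x F := Pm_ext x fun β hβ => by
  rw [map_smul, cf_J _ _ hβ, cf_J _ _ hβ, mD_smul hF c (mem_mis.1 hβ).le]; rfl

lemma J_sub (x : Euc n) {F G : Euc n → ℝ} (hF : ContDiff ℝ m F) (hG : ContDiff ℝ m G) :
    (J x (F - G) : Pm m n) = J x F - J x G := Pm_ext x fun β hβ => by
  rw [map_sub, cf_J _ _ hβ, cf_J _ _ hβ, cf_J _ _ hβ, mD_sub hF hG (mem_mis.1 hβ).le]

lemma J_Pm (x : Euc n) (P : Pm m n) : (J x (P : Euc n → ℝ) : Pm m n) = P := (taylor x P).symm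

lemma mD_congr {F G : Euc n → ℝ} {x : Euc n} (h : F =ᶠ[𝓝 x] G) (β : Fin n → ℕ) : mD β F x = mD β G x := by
  rw [mD_def, mD_def]
  suffices ∀ l : List (Fin n), l.foldr pD F =ᶠ[𝓝 x] l.foldr pD G from (this _).eq_of_nhds
  intro l
  induction l with
  | nil => exact h
  | cons a l ih =>
    simp only [List.foldr_cons]
    filter_upwards [ih.fderiv (𝕜 := ℝ)] with z hz
    simp [pD, hz]

lemma J_congr {F G : Euc n → ℝ} {x : Euc n} (h : F =ᶠ[𝓝 x] G) : (J x F : Pm m n) = J x G :=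
  Pm_ext x fun β hβ => by rw [cf_J _ _ hβ, cf_J _ _ hβ, mD_congr h]

/-- dimension constant for norms -/
def cn (m n : ℕ) : ℝ := ((n : ℝ) + 1) ^ m

lemma cn_one : 1 ≤ cn m n := by unfold cn; apply one_le_pow₀; have : (0:ℝ) ≤ n := by positivity
                                linarith

lemma iter_sub_apply {F G : Euc n → ℝ} {N : ℕ} (hF : ContDiff ℝ N F) (hG : ContDiff ℝ N G) {k : ℕ} (hk : k ≤ N) (x : Euc n) :
    iteratedFDeriv ℝ k (F - G) x = iteratedFDeriv ℝ k F x - iteratedFDeriv ℝ k G x :=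
  iteratedFDeriv_sub_apply (hF.contDiffAt.of_le (by exact_mod_cast hk)) (hG.contDiffAt.of_le (by exact_mod_cast hk))

lemma nb.norm {x : Euc n} {s C : ℝ} {P : Pm m n} (h : nb x s P C) (hs : 0 ≤ s) (hC : 0 ≤ C) {k : ℕ} (hk : k ≤ m) :
    ‖iteratedFDeriv ℝ k (P : Euc n → ℝ) x‖ * s ^ k ≤ cn m n * C * s ^ m := by
  rcases hk.lt_or_eq with hk' | rfl
  · have h1 := norm_iter_le (Pm_cd P (N := m)) hk x (K := C * s ^ (m - k)) (by positivity)
      (fun β hβ => by subst hβ; exact h β (mem_mis.2 hk'))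
    have h2 : (n:ℝ) ^ k ≤ cn m n := by
      unfold cn
      calc (n:ℝ) ^ k ≤ ((n:ℝ) + 1) ^ k := by gcongr; linarith
        _ ≤ _ := by gcongr; linarith [show (0:ℝ) ≤ n by positivity]
    calc _ ≤ ((n:ℝ) ^ k * (C * s ^ (m - k))) * s ^ k := by gcongr
      _ = (n:ℝ) ^ k * C * (s ^ (m - k) * s ^ k) := by ring
      _ = (n:ℝ) ^ k * C * s ^ m := by rw [← pow_add]; congr 2; omega
      _ ≤ _ := by gcongr
  · rw [P.2.2 x, norm_zero, zero_mul]
    have := cn_one (m := k) (n := n); positivity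

lemma nb_of_norm {x : Euc n} {s C : ℝ} {F : Euc n → ℝ} (hs : 0 < s) (hF : ContDiff ℝ m F)
    (h : ∀ k < m, ‖iteratedFDeriv ℝ k F x‖ * s ^ k ≤ C * s ^ m) :
    nb x s (J x F : Pm m n) C := fun β hβ => by
  have hb := mem_mis.1 hβ
  rw [cf_J _ _ hβ]
  refine (abs_mD_le hF β hb.le x).trans ?_
  have h1 := h _ hb
  have h2 : s ^ m = s ^ (m - deg β) * s ^ deg β := by rw [← pow_add]; congr 1; omega
  rw [h2, ← mul_assoc] at h1
  exact le_of_mul_le_mul_right h1 (by positivity)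

/-- product bound -/
lemma prod_bound {F G : Euc n → ℝ} {N : ℕ} (hF : ContDiff ℝ N F) (hG : ContDiff ℝ N G) {x : Euc n} {s a b : ℝ} (hs : 0 ≤ s)
    (ha : ∀ k ≤ N, ‖iteratedFDeriv ℝ k F x‖ * s ^ k ≤ a) (hb : ∀ k ≤ N, ‖iteratedFDeriv ℝ k G x‖ * s ^ k ≤ b)
    {k : ℕ} (hk : k ≤ N) : ‖iteratedFDeriv ℝ k (F * G) x‖ * s ^ k ≤ 2 ^ N * (a * b) := by
  have ha0 : 0 ≤ a := le_trans (by positivity) (ha 0 (Nat.zero_le _))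
  have hb0 : 0 ≤ b := le_trans (by positivity) (hb 0 (Nat.zero_le _))
  have h1 := norm_iteratedFDeriv_mul_le hF hG x (n := k) (by exact_mod_cast hk)
  calc _ ≤ (∑ i ∈ Finset.range (k + 1), (k.choose i : ℝ) * ‖iteratedFDeriv ℝ i F x‖ * ‖iteratedFDeriv ℝ (k - i) G x‖) * s ^ k := by
        gcongr; exact h1
    _ = ∑ i ∈ Finset.range (k + 1), (k.choose i : ℝ) * ((‖iteratedFDeriv ℝ i F x‖ * s ^ i) * (‖iteratedFDeriv ℝ (k - i) G x‖ * s ^ (k - i))) := by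
        rw [Finset.sum_mul]
        refine Finset.sum_congr rfl fun i hi => ?_
        have : i ≤ k := by have := Finset.mem_range.1 hi; omega
        have : s ^ k = s ^ i * s ^ (k - i) := by rw [← pow_add]; congr 1; omega
        rw [this]; ring
    _ ≤ ∑ i ∈ Finset.range (k + 1), (k.choose i : ℝ) * (a * b) := by
        refine Finset.sum_le_sum fun i hi => ?_
        have : i ≤ k := by have := Finset.mem_range.1 hi; omega
        gcongr
        · exact ha i (by omega)
        · exact hb (k - i) (by omega)
    _ = 2 ^ k * (a * b) := by
        rw [← Finset.sum_mul]; congr 1; exact_mod_cast Nat.sum_range_choose k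
    _ ≤ _ := by gcongr; norm_num

/-- Taylor remainder -/
lemma taylor_rem {H : Euc n → ℝ} (hH : ContDiff ℝ m H) {y : Euc n} {ρ K : ℝ} (hK : 0 ≤ K)
    (h0 : ∀ k < m, iteratedFDeriv ℝ k H y = 0) (hm : ∀ z ∈ Metric.closedBall y ρ, ‖iteratedFDeriv ℝ m H z‖ ≤ K) :
    ∀ j, j ≤ m → ∀ z ∈ Metric.closedBall y ρ, ‖iteratedFDeriv ℝ (m - j) H z‖ ≤ K * ‖z - y‖ ^ j := by
  intro j
  induction j with
  | zero => intro _ z hz; simpa using hm z hz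
  | succ j ih =>
    intro hj z hz
    have hd : Differentiable ℝ (iteratedFDeriv ℝ (m - (j + 1)) H) :=
      hH.differentiable_iteratedFDeriv (by norm_cast; omega)
    have hsub : Metric.closedBall y ‖z - y‖ ⊆ Metric.closedBall y ρ :=
      Metric.closedBall_subset_closedBall (by rw [← dist_eq_norm]; exact hz)
    have h1 := (convex_closedBall y ‖z - y‖).norm_image_sub_le_of_norm_fderiv_le (𝕜 := ℝ)
      (f := iteratedFDeriv ℝ (m - (j + 1)) H) (C := K * ‖z - y‖ ^ j) (x := y) (y := z)
      (fun w _ => hd w) (fun w hw => ?_) (Metric.mem_closedBall_self (norm_nonneg _))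
      (by simp [dist_eq_norm])
    · rw [h0 _ (by omega), sub_zero] at h1
      rw [pow_succ, ← mul_assoc]; exact h1
    · rw [norm_fderiv_iteratedFDeriv, show m - (j + 1) + 1 = m - j by omega]
      refine (ih (by omega) w (hsub hw)).trans ?_
      have : ‖w - y‖ ≤ ‖z - y‖ := by rw [← dist_eq_norm]; exact hw
      gcongr

lemma iter_J (x : Euc n) {F : Euc n → ℝ} (hF : ContDiff ℝ m F) {k : ℕ} (hk : k < m) :
    iteratedFDeriv ℝ k ((J x F : Pm m n) : Euc n → ℝ) x = iteratedFDeriv ℝ k F x := by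
  rw [← sub_eq_zero, ← iter_sub_apply (Pm_cd _ (N := m)) hF hk.le]
  refine iter_zero_of (cd_sub (Pm_cd _) hF) hk.le x fun β hβ => ?_
  have hb : β ∈ mis m n := mem_mis.2 (by omega)
  rw [mD_sub (Pm_cd _ (N := m)) hF (by omega), ← cf_def, cf_J _ _ hb, sub_self]

/-- jets of one function at two points -/
lemma J_two {G : Euc n → ℝ} (hG : ContDiff ℝ m G) {x y : Euc n} {K : ℝ} (hK : 0 ≤ K)
    (h : ∀ z ∈ Metric.closedBall y ‖x - y‖, ‖iteratedFDeriv ℝ m G z‖ ≤ K) :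
    nb x ‖x - y‖ (J x G - J y G : Pm m n) K := fun β hβ => by
  have hb := mem_mis.1 hβ
  have hP := Pm_cd (J y G : Pm m n) (N := m)
  have hH : ContDiff ℝ m (G - ((J y G : Pm m n) : Euc n → ℝ)) := hG.sub hP
  have h1 := taylor_rem hH (y := y) (ρ := ‖x - y‖) hK
    (fun k hk => by rw [iter_sub_apply hG hP hk.le, iter_J y hG hk, sub_self])
    (fun z hz => by rw [iter_sub_apply hG hP le_rfl, (J y G : Pm m n).2.2, sub_zero]; exact h z hz)
    (m - deg β) (by omega) x (by simp [dist_eq_norm])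
  rw [show m - (m - deg β) = deg β by omega] at h1
  refine le_trans (le_of_eq ?_) ((abs_mD_le hH β hb.le x).trans h1)
  congr 1
  rw [map_sub, cf_J _ _ hβ, mD_sub hG hP hb.le, cf_def]

end FP

namespace FP
open scoped ContDiff Classical Topology
set_option linter.all false

variable {m n : ℕ}

/-- admissible cutoff at scale `δ` -/
def Adm (m : ℕ) (θ : Euc n → ℝ) (x : Euc n) (δ : ℝ) : Prop :=
  ContDiff ℝ m θ ∧ ∀ z ∈ Metric.ball x δ, 0 ≤ θ z ∧ θ z ≤ 1 ∧ ∀ k ≤ m, ‖iteratedFDeriv ℝ k θ z‖ * δ ^ k ≤ 1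

lemma Adm.sub {θ : Euc n → ℝ} {x y : Euc n} {δ δ' : ℝ} (h : Adm m θ x δ) (hδ' : 0 ≤ δ') (hle : δ' ≤ δ)
    (hs : ‖x - y‖ + δ' ≤ δ) : Adm m θ y δ' := by
  refine ⟨h.1, fun z hz => ?_⟩
  have hz' : z ∈ Metric.ball x δ := by
    rw [Metric.mem_ball] at *
    have := dist_triangle z y x
    rw [dist_comm y x, dist_eq_norm x y] at this
    linarith
  obtain ⟨h1, h2, h3⟩ := h.2 z hz'
  exact ⟨h1, h2, fun k hk => le_trans (by gcongr) (h3 k hk)⟩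

/-- binary blend -/
def bl (x : Euc n) (θ : Euc n → ℝ) (P Q : Pm m n) : Pm m n := Q + J x (θ * ((P - Q : Pm m n) : Euc n → ℝ))

def K5 (m n : ℕ) : ℝ := 2 ^ m * cn m n

lemma K5_one : 1 ≤ K5 m n := by
  unfold K5
  exact one_le_mul_of_one_le_of_one_le (one_le_pow₀ (by norm_num)) cn_one

lemma nb_Jmul {θ : Euc n → ℝ} {x z : Euc n} {δ s C : ℝ} (h : Adm m θ x δ) (hz : z ∈ Metric.ball x δ) {A : Pm m n} (hs : 0 < s) (hsδ : s ≤ δ)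
    (hC : 0 ≤ C) (hA : nb z s A C) : nb z s (J z (θ * (A : Euc n → ℝ)) : Pm m n) (K5 m n * C) := by
  refine nb_of_norm hs (cd_mul h.1 (Pm_cd A)) fun k hk => ?_
  have := prod_bound h.1 (Pm_cd A (N := m)) (x := z) (s := s) (a := 1) (b := cn m n * C * s ^ m) hs.le
    (fun k hk => le_trans (by gcongr) ((h.2 z hz).2.2 k hk)) (fun k hk => hA.norm hs.le hC hk) hk.le
  refine this.trans (le_of_eq ?_)
  unfold K5; ring

def K6 (m n : ℕ) : ℝ := 2 * (K5 m n * Dn m n * Dn m n)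

lemma A6 {θ : Euc n → ℝ} {x y : Euc n} {δ C : ℝ} (h : Adm m θ x δ) (hδ : 0 < δ) {A A' : Pm m n} (hxy : x ≠ y) (hρ : ‖x - y‖ ≤ δ / 4)
    (hC : 0 ≤ C) (hA : nb x δ A C) (hAA : nb x ‖x - y‖ (A - A') C) :
    nb x ‖x - y‖ (J x (θ * (A : Euc n → ℝ)) - J y (θ * (A' : Euc n → ℝ)) : Pm m n) (K6 m n * C) := by
  have hρ0 : 0 < ‖x - y‖ := norm_pos_iff.2 (sub_ne_zero.2 hxy)
  have hK5 := K5_one (m := m) (n := n)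
  have hD := Dn_one (m := m) (n := n)
  have h1 : nb x ‖x - y‖ (J x (θ * (A : Euc n → ℝ)) - J y (θ * (A : Euc n → ℝ)) : Pm m n) (K5 m n * Dn m n * C) := by
    refine J_two (cd_mul h.1 (Pm_cd A)) (by positivity) fun z hz => ?_
    have hzx : ‖x - z‖ < δ := by
      rw [Metric.mem_closedBall, dist_eq_norm] at hz
      have := norm_sub_le_norm_sub_add_norm_sub x y z
      rw [norm_sub_rev y z] at this
      linarith
    have hzb : z ∈ Metric.ball x δ := by rw [Metric.mem_ball, dist_eq_norm, norm_sub_rev]; exact hzx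
    have hA' := hA.shift hzx.le hC
    have := prod_bound h.1 (Pm_cd A (N := m)) (x := z) (s := δ) (a := 1) (b := cn m n * (Dn m n * C) * δ ^ m) hδ.le
      (fun k hk => (h.2 z hzb).2.2 k hk) (fun k hk => hA'.norm hδ.le (by positivity) hk) (le_refl m)
    have h2 : 2 ^ m * (1 * (cn m n * (Dn m n * C) * δ ^ m)) = (K5 m n * Dn m n * C) * δ ^ m := by unfold K5; ring
    rw [h2] at this
    exact le_of_mul_le_mul_right this (by positivity)
  have hyb : y ∈ Metric.ball x δ := by rw [Metric.mem_ball, dist_eq_norm, norm_sub_rev]; linarith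
  have h2 := nb_Jmul h hyb hρ0 (by linarith) (by positivity) (hAA.shift le_rfl hC)
  have h3 := h2.shift (y := x) (le_of_eq (norm_sub_rev _ _)) (by positivity)
  have e : (J y (θ * ((A - A' : Pm m n) : Euc n → ℝ)) : Pm m n) = J y (θ * (A : Euc n → ℝ)) - J y (θ * (A' : Euc n → ℝ)) := by
    rw [← J_sub y (cd_mul h.1 (Pm_cd A)) (cd_mul h.1 (Pm_cd A'))]
    congr 1; funext z; simp [mul_sub]
  rw [e] at h3
  refine (h1.tri h3).mono hρ0.le ?_
  have : K5 m n * Dn m n * C ≤ K5 m n * Dn m n * C * Dn m n := le_mul_of_one_le_right (by positivity) hD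
  unfold K6
  nlinarith

lemma A6bl {θ : Euc n → ℝ} {x y : Euc n} {δ C : ℝ} (h : Adm m θ x δ) (hδ : 0 < δ) {P Q P' Q' : Pm m n} (hxy : x ≠ y) (hρ : ‖x - y‖ ≤ δ / 4)
    (hC : 0 ≤ C) (hPQ : nb x δ (P - Q) C) (hP : nb x ‖x - y‖ (P - P') C) (hQ : nb x ‖x - y‖ (Q - Q') C) :
    nb x ‖x - y‖ (bl x θ P Q - bl y θ P' Q') ((2 * K6 m n + 1) * C) := by
  have h1 : nb x ‖x - y‖ ((P - Q) - (P' - Q')) (C + C) := by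
    have := hP.sub hQ
    convert this using 1; abel
  have hK : 0 ≤ K6 m n := by unfold K6; have := K5_one (m := m) (n := n); have := Dn_one (m := m) (n := n); positivity
  have h2 := A6 h hδ hxy hρ (by positivity) (hPQ.mono hδ.le (by linarith : C ≤ C + C)) h1
  have h3 := hQ.add h2
  have e : bl x θ P Q - bl y θ P' Q' = (Q - Q') + (J x (θ * ((P - Q : Pm m n) : Euc n → ℝ)) - J y (θ * ((P' - Q' : Pm m n) : Euc n → ℝ))) := by
    unfold bl; abel
  rw [e]
  exact h3.mono (norm_nonneg _) (by nlinarith)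

lemma nb_bl {θ : Euc n → ℝ} {x : Euc n} {δ C : ℝ} (h : Adm m θ x δ) (hδ : 0 < δ) {P Q : Pm m n}
    (hC : 0 ≤ C) (hPQ : nb x δ (P - Q) C) : nb x δ (bl x θ P Q - Q) (K5 m n * C) := by
  have := nb_Jmul h (Metric.mem_ball_self hδ) hδ le_rfl hC hPQ
  unfold bl
  rwa [add_sub_cancel_left]

lemma bl_congr {θ θ' : Euc n → ℝ} {x : Euc n} (h : θ =ᶠ[𝓝 x] θ') (P Q : Pm m n) : bl x θ P Q = bl x θ' P Q := by
  unfold bl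
  rw [J_congr (h.mul (Filter.EventuallyEq.refl _ _))]

lemma bl_one {θ : Euc n → ℝ} {x : Euc n} (h : θ =ᶠ[𝓝 x] 1) (P Q : Pm m n) : bl x θ P Q = P := by
  rw [bl_congr h]; unfold bl; rw [one_mul, J_Pm]; abel

lemma bl_zero {θ : Euc n → ℝ} {x : Euc n} (h : θ =ᶠ[𝓝 x] 0) (P Q : Pm m n) : bl x θ P Q = Q := by
  rw [bl_congr h]; unfold bl
  have : (J x (0 * ((P - Q : Pm m n) : Euc n → ℝ)) : Pm m n) = 0 := by
    rw [zero_mul]; exact (J_Pm x (0 : Pm m n))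
  rw [this, add_zero]

/-- coordinate function -/
def xc (i : Fin n) (x : Euc n) : Euc n → ℝ := fun z => z i - x i

lemma xc_cd (i : Fin n) (x : Euc n) {N : ℕ} : ContDiff ℝ N (xc i x) := by
  unfold xc
  exact ((EuclideanSpace.proj i : Euc n →L[ℝ] ℝ).contDiff).sub contDiff_const

/-- multiplication by a coordinate, on jets -/
def mulX (x : Euc n) (i : Fin n) : Pm m n →ₗ[ℝ] Pm m n where
  toFun V := J x (xc i x * (V : Euc n → ℝ))
  map_add' V W := by
    rw [← J_add x (cd_mul (xc_cd i x) (Pm_cd V)) (cd_mul (xc_cd i x) (Pm_cd W))]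
    congr 1; funext z; simp [mul_add]
  map_smul' c V := by
    rw [RingHom.id_apply, ← J_smul x (cd_mul (xc_cd i x) (Pm_cd V))]
    congr 1; funext z; simp; ring

lemma xc_Em (x : Euc n) (i : Fin n) (γ : Fin n → ℕ) :
    xc i x * Em γ x = ((γ i : ℝ) + 1) • Em (γ + Pi.single i 1) x := by
  funext z
  simp only [Pi.mul_apply, Pi.smul_apply, smul_eq_mul, Em, xc]
  rw [← Finset.mul_prod_erase Finset.univ _ (Finset.mem_univ i),
    ← Finset.mul_prod_erase Finset.univ _ (Finset.mem_univ i)]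
  have : ∏ j ∈ Finset.univ.erase i, (z j - x j) ^ (γ + Pi.single i 1 : Fin n → ℕ) j / ((γ + Pi.single i 1 : Fin n → ℕ) j).factorial
      = ∏ j ∈ Finset.univ.erase i, (z j - x j) ^ γ j / (γ j).factorial := by
    refine Finset.prod_congr rfl fun j hj => ?_
    have : j ≠ i := Finset.ne_of_mem_erase hj
    simp [this]
  rw [this]
  simp only [Pi.add_apply, Pi.single_eq_same, Nat.factorial_succ]
  have : ((γ i).factorial : ℝ) ≠ 0 := by positivity
  push_cast
  field_simp
  ring

lemma cf_mulX (x : Euc n) (i : Fin n) (V : Pm m n) {κ : Fin n → ℕ} (hκ : κ ∈ mis m n) :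
    cf x κ (mulX x i V) = if κ i = 0 then 0 else κ i * cf x (κ - Pi.single i 1) V := by
  have key : ∀ γ ∈ mis m n, cf x κ (mulX x i (eb γ x : Pm m n)) = ((γ i : ℝ) + 1) * (if κ = γ + Pi.single i 1 then 1 else 0) := by
    intro γ hγ
    have e : mulX x i (eb γ x : Pm m n) = J x (((γ i : ℝ) + 1) • Em (γ + Pi.single i 1) x) := by
      show J x _ = _
      rw [eb_coe (mem_mis.1 hγ), xc_Em]
    rw [e, cf_J _ _ hκ, mD_smul (Em_contDiff _ _ (N := m)) _ (mem_mis.1 hκ).le, mD_Em_self]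
  conv_lhs => rw [taylor x V]
  unfold mk
  rw [map_sum, map_sum]
  simp only [map_smul, smul_eq_mul]
  have e2 : ∀ γ ∈ mis m n, cf x γ V * cf x κ (mulX x i (eb γ x : Pm m n)) =
      if κ = γ + Pi.single i 1 then cf x γ V * ((γ i : ℝ) + 1) else 0 := by
    intro γ hγ; rw [key γ hγ]; split_ifs <;> ring
  rw [Finset.sum_congr rfl e2]
  split_ifs with h
  · refine Finset.sum_eq_zero fun γ _ => ?_
    rw [if_neg]; intro h2; rw [h2] at h; simp at h
  · have h1 : κ = (κ - Pi.single i 1) + Pi.single i 1 := by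
      funext j
      by_cases hj : j = i
      · subst hj; simp; omega
      · simp [hj]
    rw [Finset.sum_eq_single (κ - Pi.single i 1)]
    · rw [if_pos h1]
      have : (((κ - Pi.single i 1 : Fin n → ℕ) i : ℕ) : ℝ) + 1 = κ i := by
        simp; rw [Nat.cast_sub (by omega)]; simp
      rw [this]; ring
    · intro γ _ hne
      rw [if_neg]; intro h2; apply hne; rw [h2]; simp
    · intro h2; exfalso; apply h2; rw [mem_mis]
      have := deg_mono (show κ - Pi.single i 1 ≤ κ from tsub_le_self)
      have := mem_mis.1 hκ; omega

/-- linear cutoff -/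
def lt2 (i : Fin n) (x : Euc n) (s : ℝ) : Euc n → ℝ := fun z => 1 / 2 + (1 / (2 * s)) * xc i x z

lemma lt2_bl (i : Fin n) (x : Euc n) (s : ℝ) (P U : Pm m n) :
    bl x (lt2 i x s) (P + U) (P - U) = P + (1 / s) • mulX x i U := by
  unfold bl
  have e : lt2 i x s * ((P + U - (P - U) : Pm m n) : Euc n → ℝ) = (U : Euc n → ℝ) + (1 / s) • (xc i x * (U : Euc n → ℝ)) := by
    funext z; simp [lt2]; ring
  rw [e, J_add x (Pm_cd U) (cd_smul (cd_mul (xc_cd i x) (Pm_cd U)) _), J_Pm, J_smul x (cd_mul (xc_cd i x) (Pm_cd U))]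
  show _ = P + (1/s) • J x (xc i x * (U : Euc n → ℝ))
  abel

lemma lt2_adm (i : Fin n) (x : Euc n) {s : ℝ} (hs : 0 < s) : Adm m (lt2 i x s) x s := by
  have hcd : ∀ N : ℕ, ContDiff ℝ N (lt2 i x s) := fun N => contDiff_const.add (contDiff_const.mul (xc_cd i x))
  refine ⟨hcd m, fun z hz => ?_⟩
  have hxc : |xc i x z| < s := by
    have := PiLp.norm_apply_le (z - x) i
    rw [Metric.mem_ball, dist_eq_norm] at hz
    have h2 : ‖(z - x) i‖ = |xc i x z| := by simp [xc]
    linarith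
  have h1 : |1 / (2 * s) * xc i x z| ≤ 1 / 2 := by
    rw [abs_mul, abs_of_pos (by positivity), div_mul_eq_mul_div, div_le_div_iff₀ (by positivity) (by positivity)]
    linarith
  have h2 := abs_le.1 h1
  have h0 : 0 ≤ lt2 i x s z := by unfold lt2; linarith
  have h01 : lt2 i x s z ≤ 1 := by unfold lt2; linarith
  refine ⟨h0, h01, fun k hk => ?_⟩
  -- derivative
  let L : Euc n →L[ℝ] ℝ := (1 / (2 * s)) • (EuclideanSpace.proj i : Euc n →L[ℝ] ℝ)
  have hL : ‖L‖ ≤ 1 / (2 * s) := by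
    refine ContinuousLinearMap.opNorm_le_bound _ (by positivity) fun v => ?_
    have := PiLp.norm_apply_le v i
    have e : L v = 1 / (2 * s) * v i := rfl
    rw [e, norm_mul, Real.norm_of_nonneg (by positivity : 0 ≤ 1 / (2 * s))]
    gcongr
  have hfd : fderiv ℝ (lt2 i x s) = fun _ => L := by
    funext w
    have e : lt2 i x s = fun w => (1 / 2 - 1 / (2 * s) * x i) + L w := by
      funext w
      have e : L w = 1 / (2 * s) * w i := rfl
      simp only [lt2, xc, e]; ring
    rw [e]
    simp [fderiv_const_add]
  match k with
  | 0 => simp only [norm_iteratedFDeriv_zero, pow_zero, mul_one]; rw [Real.norm_of_nonneg h0]; exact h01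
  | 1 =>
    have : ‖iteratedFDeriv ℝ 1 (lt2 i x s) z‖ = ‖L‖ := by
      rw [norm_iteratedFDeriv_one, hfd]
    rw [this, pow_one]
    calc ‖L‖ * s ≤ 1 / (2 * s) * s := by gcongr
      _ ≤ 1 := by rw [one_div, mul_inv, mul_assoc, inv_mul_cancel₀ hs.ne']; norm_num
  | k + 2 =>
    have : ‖iteratedFDeriv ℝ (k + 2) (lt2 i x s) z‖ = 0 := by
      rw [← norm_iteratedFDeriv_fderiv, hfd, iteratedFDeriv_const_of_ne (by omega)]; simp
    rw [this]; simp

end FP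

namespace FP
open scoped ContDiff Classical Topology
set_option linter.all false

variable {m n : ℕ}

/-- shape fields with a blending property -/
structure SF (Γ : Euc n → ℝ → Set (Pm m n)) (Cw : ℝ) : Prop where
  one : 1 ≤ Cw
  conv : ∀ x M, Convex ℝ (Γ x M)
  mono : ∀ x M M', M ≤ M' → Γ x M ⊆ Γ x M'
  bound : ∀ x M, 1 ≤ M → ∀ P ∈ Γ x M, nb x 1 P (Cw * M)
  blend : ∀ x M δ θ P Q, 1 ≤ M → 0 < δ → δ ≤ 1 → P ∈ Γ x M → Q ∈ Γ x M → nb x δ (P - Q) M → Adm m θ x δ →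
    bl x θ P Q ∈ Γ x (Cw * M)

/-- refinement -/
def Ref (E : Set (Euc n)) (Γ : Euc n → ℝ → Set (Pm m n)) : Euc n → ℝ → Set (Pm m n) := fun x M =>
  {P | P ∈ Γ x M ∧ ∀ y ∈ E, x ≠ y → ∃ P' ∈ Γ y M, nb x ‖x - y‖ (P - P') M}

lemma K6_one : 1 ≤ K6 m n := by
  unfold K6
  have h1 := K5_one (m := m) (n := n); have h2 := Dn_one (m := m) (n := n)
  have : 1 ≤ K5 m n * Dn m n * Dn m n :=
    one_le_mul_of_one_le_of_one_le (one_le_mul_of_one_le_of_one_le h1 h2) h2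
  linarith

lemma SF_Ref (Cw : ℝ) : ∃ Cw', Cw ≤ Cw' ∧ ∀ (E : Set (Euc n)) (Γ : Euc n → ℝ → Set (Pm m n)), SF Γ Cw → SF (Ref E Γ) Cw' := by
  by_cases hCw : 1 ≤ Cw
  swap
  · exact ⟨Cw, le_rfl, fun E Γ h => absurd h.one hCw⟩
  have h1 := K5_one (m := m) (n := n); have h2 := Dn_one (m := m) (n := n); have h3 := K6_one (m := m) (n := n)
  set M2 : ℝ := 2 ^ m * (Dn m n * 3) with hM2
  have hM21 : 1 ≤ M2 := by
    have : (1:ℝ) ≤ 2 ^ m := one_le_pow₀ (by norm_num)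
    exact one_le_mul_of_one_le_of_one_le this (by linarith)
  set Cw' : ℝ := Cw * M2 + (2 * K6 m n + 1) + (4 ^ m * K5 m n + 1) with hCw'
  have h4 : 0 ≤ (4:ℝ) ^ m * K5 m n := by positivity
  have hle : Cw ≤ Cw * M2 := le_mul_of_one_le_right (by linarith) hM21
  have hle' : Cw ≤ Cw' := by linarith
  refine ⟨Cw', hle', fun E Γ h => ⟨by linarith, ?_, ?_, ?_, ?_⟩⟩
  · intro x M P hP Q hQ a b ha hb hab
    refine ⟨h.conv x M hP.1 hQ.1 ha hb hab, fun y hy hxy => ?_⟩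
    obtain ⟨P', hP', hp⟩ := hP.2 y hy hxy
    obtain ⟨Q', hQ', hq⟩ := hQ.2 y hy hxy
    refine ⟨a • P' + b • Q', h.conv y M hP' hQ' ha hb hab, ?_⟩
    have h5 := (hp.smul a).add (hq.smul b)
    have e : a • P + b • Q - (a • P' + b • Q') = a • (P - P') + b • (Q - Q') := by
      rw [smul_sub, smul_sub]; abel
    rw [e]
    refine h5.mono (norm_nonneg _) (le_of_eq ?_)
    rw [abs_of_nonneg ha, abs_of_nonneg hb, ← add_mul, hab, one_mul]
  · intro x M M' hM P hP
    refine ⟨h.mono x M M' hM hP.1, fun y hy hxy => ?_⟩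
    obtain ⟨P', hP', hp⟩ := hP.2 y hy hxy
    exact ⟨P', h.mono y M M' hM hP', hp.mono (norm_nonneg _) hM⟩
  · intro x M hM P hP
    exact (h.bound x M hM P hP.1).mono (by norm_num) (by gcongr)
  · intro x M δ θ P Q hM hδ hδ1 hP hQ hPQ hθ
    refine ⟨h.mono _ _ _ (by gcongr) (h.blend x M δ θ P Q hM hδ hδ1 hP.1 hQ.1 hPQ hθ), fun y hy hxy => ?_⟩
    obtain ⟨P', hP', hp⟩ := hP.2 y hy hxy
    obtain ⟨Q', hQ', hq⟩ := hQ.2 y hy hxy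
    have hρ0 : 0 < ‖x - y‖ := norm_pos_iff.2 (sub_ne_zero.2 hxy)
    by_cases hρ : ‖x - y‖ ≤ δ / 4
    · refine ⟨bl y θ P' Q', ?_, ?_⟩
      · have hA : Adm m θ y (δ / 2) := hθ.sub (by positivity) (by linarith) (by linarith)
        have e1 : nb x δ (P' - Q') (M + M + M) := by
          have e2 := (nb_comm hp).scale hρ0.le (by linarith : ‖x - y‖ ≤ δ) (by linarith)
          have e3 := hq.scale hρ0.le (by linarith : ‖x - y‖ ≤ δ) (by linarith)
          exact (e2.tri hPQ).tri e3
        have e4 := (e1.shift (by linarith) (by linarith)).down (K := 2) (s' := δ / 2) (by norm_num) hδ.le (by positivity) (by linarith) (by positivity)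
        have e5 : 2 ^ m * (Dn m n * (M + M + M)) = M2 * M := by rw [hM2]; ring
        rw [e5] at e4
        have hMM : M ≤ M2 * M := le_mul_of_one_le_left (by linarith) hM21
        have := h.blend y (M2 * M) (δ / 2) θ P' Q' (by linarith) (by positivity) (by linarith)
          (h.mono _ _ _ hMM hP') (h.mono _ _ _ hMM hQ') e4 hA
        refine h.mono _ _ _ ?_ this
        rw [← mul_assoc]; gcongr; linarith
      · refine (A6bl hθ hδ hxy hρ (by linarith) hPQ hp hq).mono hρ0.le ?_
        gcongr
        have : 0 ≤ Cw * M2 := by positivity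
        linarith
    · refine ⟨Q', h.mono _ _ _ (le_mul_of_one_le_left (by linarith) (by linarith)) hQ', ?_⟩
      have e1 := (nb_bl hθ hδ (by linarith) hPQ).down (K := 4) (s' := ‖x - y‖) (by norm_num) hδ.le (by positivity) (by linarith) (by positivity)
      refine (e1.tri hq).mono hρ0.le ?_
      have : 4 ^ m * (K5 m n * M) + M = (4 ^ m * K5 m n + 1) * M := by ring
      rw [this]; gcongr
      have : 0 ≤ Cw * M2 := by positivity
      linarith

/-- iterated refinement -/
def RefN (E : Set (Euc n)) (Γ : Euc n → ℝ → Set (Pm m n)) : ℕ → Euc n → ℝ → Set (Pm m n)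
  | 0 => Γ
  | l + 1 => Ref E (RefN E Γ l)

/-- chain of refinements -/
structure Ch (E : Set (Euc n)) (Γ : ℕ → Euc n → ℝ → Set (Pm m n)) (L : ℕ) (Cw : ℝ) : Prop where
  sf : ∀ l ≤ L, SF (Γ l) Cw
  sub : ∀ l x M, Γ (l + 1) x M ⊆ Γ l x M
  tr : ∀ l x M P, P ∈ Γ (l + 1) x M → ∀ y ∈ E, x ≠ y → ∃ P' ∈ Γ l y M, nb x ‖x - y‖ (P - P') M

lemma SF.up {Γ : Euc n → ℝ → Set (Pm m n)} {Cw Cw' : ℝ} (h : SF Γ Cw) (hle : Cw ≤ Cw') : SF Γ Cw' := by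
  refine ⟨h.one.trans hle, h.conv, h.mono, ?_, ?_⟩
  · intro x M hM P hP; exact (h.bound x M hM P hP).mono (by norm_num) (by gcongr)
  · intro x M δ θ P Q hM hδ hδ1 hP hQ hPQ hθ
    exact h.mono _ _ _ (by gcongr) (h.blend x M δ θ P Q hM hδ hδ1 hP hQ hPQ hθ)

lemma exists_chain (L : ℕ) (Cw : ℝ) : ∃ Cw', ∀ (E : Set (Euc n)) (Γ : Euc n → ℝ → Set (Pm m n)), SF Γ Cw →
    Ch E (RefN E Γ) L Cw' := by
  have : ∃ Cw', ∀ (E : Set (Euc n)) (Γ : Euc n → ℝ → Set (Pm m n)), SF Γ Cw → ∀ l ≤ L, SF (RefN E Γ l) Cw' := by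
    induction L with
    | zero => exact ⟨Cw, fun E Γ h l hl => by obtain rfl : l = 0 := by omega
                                              exact h⟩
    | succ L ih =>
      obtain ⟨C1, h1⟩ := ih
      obtain ⟨C2, h2, h3⟩ := SF_Ref (m := m) (n := n) C1
      refine ⟨C2, fun E Γ h l hl => ?_⟩
      rcases Nat.lt_or_ge l (L + 1) with hl' | hl'
      · exact (h1 E Γ h l (by omega)).up h2
      · obtain rfl : l = L + 1 := by omega
        exact h3 E _ (h1 E Γ h L le_rfl)
  obtain ⟨Cw', h⟩ := this
  exact ⟨Cw', fun E Γ hΓ => ⟨h E Γ hΓ, fun l x M P hP => hP.1, fun l x M P hP => hP.2⟩⟩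

lemma Ch.sub_le {E : Set (Euc n)} {Γ : ℕ → Euc n → ℝ → Set (Pm m n)} {L : ℕ} {Cw : ℝ} (h : Ch E Γ L Cw) {l l' : ℕ} (hl : l ≤ l') (x : Euc n) (M : ℝ) :
    Γ l' x M ⊆ Γ l x M := by
  induction l', hl using Nat.le_induction with
  | base => exact subset_rfl
  | succ k _ ih => exact (h.sub k x M).trans ih

/-- compatible family -/
def Fam (Γ0 : Euc n → Set (Pm m n)) (S : Finset (Euc n)) (p : Euc n → Pm m n) : Prop :=
  (∀ x ∈ S, p x ∈ Γ0 x) ∧ ∀ x ∈ S, ∀ y ∈ S, x ≠ y → nb x ‖x - y‖ (p x - p y) 1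

lemma Fam.sub {Γ0 : Euc n → Set (Pm m n)} {S T : Finset (Euc n)} {p : Euc n → Pm m n} (h : Fam Γ0 T p) (hST : S ⊆ T) : Fam Γ0 S p :=
  ⟨fun x hx => h.1 x (hST hx), fun x hx y hy => h.2 x (hST hx) y (hST hy)⟩

lemma Fam.conv {Γ0 : Euc n → Set (Pm m n)} (hc : ∀ x, Convex ℝ (Γ0 x)) {S : Finset (Euc n)} {p q : Euc n → Pm m n} (h : Fam Γ0 S p) (h' : Fam Γ0 S q)
    {a b : ℝ} (ha : 0 ≤ a) (hb : 0 ≤ b) (hab : a + b = 1) : Fam Γ0 S (fun x => a • p x + b • q x) := by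
  refine ⟨fun x hx => hc x (h.1 x hx) (h'.1 x hx) ha hb hab, fun x hx y hy hxy => ?_⟩
  have h5 := ((h.2 x hx y hy hxy).smul a).add ((h'.2 x hx y hy hxy).smul b)
  have e : a • p x + b • q x - (a • p y + b • q y) = a • (p x - p y) + b • (q x - q y) := by
    rw [smul_sub, smul_sub]; abel
  rw [e]
  refine h5.mono (norm_nonneg _) (le_of_eq ?_)
  rw [abs_of_nonneg ha, abs_of_nonneg hb, ← add_mul, hab, one_mul]

def kk (D : ℕ) : ℕ → ℕ
  | 0 => 0
  | l + 1 => (D + 1) * kk D l + 1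

/-- `P` is extendable -/
def Nl (Γ0 : Euc n → Set (Pm m n)) (E : Finset (Euc n)) (k : ℕ) (x : Euc n) : Set (Pm m n) :=
  {P | ∀ S ⊆ E, S.card ≤ k → ∃ p, Fam Γ0 (insert x S) p ∧ p x = P}

lemma Nl_nonempty {Γ0 : Euc n → Set (Pm m n)} (hc : ∀ x, Convex ℝ (Γ0 x)) (E : Finset (Euc n)) (k : ℕ) {x : Euc n} 
    (T : Finset (Euc n)) (hT : T ⊆ E) (hT2 : T.card ≤ 1) (Q : Euc n → Pm m n) (hxT : x ∉ T)
    (h : ∀ S ⊆ E, S.card ≤ (Module.finrank ℝ (Pm m n) + 1) * k → ∃ p, Fam Γ0 (insert x (T ∪ S)) p ∧ ∀ z ∈ T, p z = Q z) :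
    ∃ P, ∀ S ⊆ E, S.card ≤ k → ∃ p, Fam Γ0 (insert x (T ∪ S)) p ∧ (∀ z ∈ T, p z = Q z) ∧ p x = P := by
  let F : Finset (Euc n) → Set (Pm m n) := fun S => {P | ∃ p, Fam Γ0 (insert x (T ∪ S)) p ∧ (∀ z ∈ T, p z = Q z) ∧ p x = P}
  have := Convex.helly_theorem' (𝕜 := ℝ) (F := F) (s := E.powerset.filter (fun S => S.card ≤ k)) ?_ ?_
  · obtain ⟨P, hP⟩ := this
    refine ⟨P, fun S hS hk => ?_⟩
    simp only [Set.mem_iInter] at hP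
    exact hP S (by simp [hS, hk])
  · intro S _
    rintro _ ⟨p, hp, hpQ, rfl⟩ _ ⟨q, hq, hqQ, rfl⟩ a b ha hb hab
    refine ⟨_, hp.conv hc hq ha hb hab, fun z hz => ?_, rfl⟩
    simp only [hpQ z hz, hqQ z hz]
    rw [← add_smul, hab, one_smul]
  · intro I hI hcard
    have hU : (I.biUnion id).card ≤ (Module.finrank ℝ (Pm m n) + 1) * k := by
      refine (Finset.card_biUnion_le_card_mul I id k fun S hS => ?_).trans (Nat.mul_le_mul_right _ hcard)
      have := hI hS; simp at this; exact this.2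
    obtain ⟨p, hp, hpQ⟩ := h (I.biUnion id) (by
      intro z hz; simp at hz; obtain ⟨S, hS, hz⟩ := hz
      have := hI hS; simp at this; exact this.1 hz) hU
    refine ⟨p x, ?_⟩
    simp only [Set.mem_iInter]
    intro S hS
    refine ⟨p, hp.sub ?_, hpQ, rfl⟩
    have : S ⊆ I.biUnion id := Finset.subset_biUnion_of_mem id hS
    exact Finset.insert_subset_insert _ (Finset.union_subset_union_right this)

lemma Nl_sub (Γ : Euc n → ℝ → Set (Pm m n)) (hc : ∀ x, Convex ℝ (Γ x 1)) (E : Finset (Euc n)) (l : ℕ) : ∀ x ∈ E,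
    Nl (fun x => Γ x 1) E (kk (Module.finrank ℝ (Pm m n)) l) x ⊆ RefN (E : Set (Euc n)) Γ l x 1 := by
  induction l with
  | zero =>
    intro x hx P hP
    obtain ⟨p, hp, rfl⟩ := hP ∅ (by simp) (by simp)
    exact hp.1 x (by simp)
  | succ l ih =>
    intro x hx P hP
    refine ⟨ih x hx fun S hS hk => hP S hS (hk.trans ?_), fun y hy hxy => ?_⟩
    · simp only [kk]; nlinarith
    · obtain ⟨P', hP'⟩ := Nl_nonempty hc E (kk (Module.finrank ℝ (Pm m n)) l) (x := y) {x} (by simpa using hx) (by simp) (fun _ => P)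
        (by simpa using hxy.symm) (fun S hS hk => by
          obtain ⟨p, hp, hp2⟩ := hP (insert y S) (Finset.insert_subset hy hS)
            ((Finset.card_insert_le _ _).trans (by simp only [kk]; omega))
          refine ⟨p, hp.sub ?_, by simpa using hp2⟩
          intro z hz; simp at hz ⊢; tauto)
      refine ⟨P', ih y hy fun S hS hk => ?_, ?_⟩
      · obtain ⟨p, hp, _, hp2⟩ := hP' S hS hk
        refine ⟨p, hp.sub ?_, hp2⟩
        intro z hz; simp at hz ⊢; tauto
      · obtain ⟨p, hp, hp2, hp3⟩ := hP' ∅ (by simp) (by simp)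
        have := hp.2 x (by simp) y (by simp) hxy
        rw [hp3, hp2 x (by simp)] at this
        exact this

lemma RefN_nonempty (Γ : Euc n → ℝ → Set (Pm m n)) (hc : ∀ x, Convex ℝ (Γ x 1)) (E : Finset (Euc n)) (l : ℕ)
    (h : ∀ S ⊆ E, S.card ≤ kk (Module.finrank ℝ (Pm m n)) (l + 1) → ∃ p, Fam (fun x => Γ x 1) S p) :
    ∀ x ∈ E, (RefN (E : Set (Euc n)) Γ l x 1).Nonempty := by
  intro x hx
  obtain ⟨P, hP⟩ := Nl_nonempty hc E (kk (Module.finrank ℝ (Pm m n)) l) (x := x) ∅ (by simp) (by simp) (fun _ => 0)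
        (by simp) (fun S hS hk => by
          obtain ⟨p, hp⟩ := h (insert x S) (Finset.insert_subset hx hS)
            ((Finset.card_insert_le _ _).trans (by simp only [kk]; omega))
          exact ⟨p, by simpa using hp, by simp⟩)
  refine ⟨P, Nl_sub Γ hc E l x hx fun S hS hk => ?_⟩
  obtain ⟨p, hp, _, hp2⟩ := hP S hS hk
  exact ⟨p, by simpa using hp, hp2⟩

end FP

namespace FP
open scoped ContDiff Classical Topology
set_option linter.all false

variable {m n : ℕ}

/-- graded lexicographic key -/
def key (α : Fin n → ℕ) : ℕ ×ₗ Lex (Fin n → ℕ) := toLex (deg α, toLex α)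

lemma key_inj {α β : Fin n → ℕ} (h : key α = key β) : α = β := by
  have := congrArg (fun z => (ofLex z).2) h
  exact toLex.injective this

lemma deg_le_of_key {α β : Fin n → ℕ} (h : key α ≤ key β) : deg α ≤ deg β := by
  unfold key at h
  rw [Prod.Lex.toLex_le_toLex] at h
  rcases h with h | h
  · exact h.le
  · exact h.1.le

lemma key_add_lt {α β γ : Fin n → ℕ} (h : key (α + γ) < key (β + γ)) : key α < key β := by
  unfold key at h ⊢
  rw [Prod.Lex.toLex_lt_toLex] at h ⊢
  simp only [deg_add] at h
  rcases h with h | h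
  · left; simpa using h
  · right
    refine ⟨by simpa using h.1, ?_⟩
    have h2 := h.2
    simp only [toLex_add] at h2
    exact lt_of_add_lt_add_right h2

lemma key_lt_add {α γ : Fin n → ℕ} (hγ : 0 < deg γ) : key α < key (α + γ) := by
  unfold key
  rw [Prod.Lex.toLex_lt_toLex]
  left; simp only [deg_add]; omega

/-- rank from the top -/
def rk (m : ℕ) (α : Fin n → ℕ) : ℕ := ((mis m n).filter fun γ => key α < key γ).card

lemma rk_lt {α β : Fin n → ℕ} (hα : α ∈ mis m n) (h : key β < key α) : rk m α < rk m β := by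
  unfold rk
  apply Finset.card_lt_card
  rw [Finset.ssubset_iff_of_subset]
  · exact ⟨α, by simp [hα, h], by simp⟩
  · intro γ hγ; simp only [Finset.mem_filter] at hγ ⊢; exact ⟨hγ.1, h.trans hγ.2⟩

/-- weight of a label -/
def wt (m : ℕ) (A : Finset (Fin n → ℕ)) : ℕ := ∑ α ∈ A, 2 ^ rk m α

lemma wt_le {A : Finset (Fin n → ℕ)} (hA : A ⊆ mis m n) : wt m A ≤ wt m (mis m n) :=
  Finset.sum_le_sum_of_subset hA

/-- new label -/
def nl (A : Finset (Fin n → ℕ)) (β : Fin n → ℕ) : Finset (Fin n → ℕ) := insert β (A.filter fun α => key α < key β)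

lemma mem_nl {A : Finset (Fin n → ℕ)} {β α : Fin n → ℕ} : α ∈ nl A β ↔ α = β ∨ (α ∈ A ∧ key α < key β) := by
  unfold nl; simp

lemma nl_sub {A : Finset (Fin n → ℕ)} (hA : A ⊆ mis m n) {β : Fin n → ℕ} (hβ : β ∈ mis m n) : nl A β ⊆ mis m n := by
  intro α h; rw [mem_nl] at h
  rcases h with rfl | h
  · exact hβ
  · exact hA h.1

lemma wt_nl {A : Finset (Fin n → ℕ)} (hA : A ⊆ mis m n) {β : Fin n → ℕ} (hβA : β ∉ A) : wt m A < wt m (nl A β) := by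
  unfold wt nl
  rw [Finset.sum_insert (by simp), ← Finset.sum_filter_add_sum_filter_not A (fun α => key α < key β), add_comm]
  gcongr
  set B := A.filter (fun α => ¬ key α < key β) with hB
  have hB' : ∀ α ∈ B, α ∈ mis m n ∧ key β < key α := by
    intro α hα
    rw [hB, Finset.mem_filter] at hα
    refine ⟨hA hα.1, lt_of_le_of_ne (not_lt.1 hα.2) fun h => ?_⟩
    rw [key_inj h] at hβA; exact hβA hα.1
  have hinj : Set.InjOn (rk m) (B : Set (Fin n → ℕ)) := by
    intro α hα γ hγ h
    by_contra hne
    rcases lt_trichotomy (key α) (key γ) with h1 | h1 | h1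
    · have := rk_lt (hB' γ hγ).1 h1; omega
    · exact hne (key_inj h1)
    · have := rk_lt (hB' α hα).1 h1; omega
  rw [← Finset.sum_image (f := fun k => 2 ^ k) hinj]
  apply Nat.geomSum_lt le_rfl
  intro k hk
  rw [Finset.mem_image] at hk
  obtain ⟨α, hα, rfl⟩ := hk
  exact rk_lt (hB' α hα).1 (hB' α hα).2

/-- normalized coefficient -/
def nc (x : Euc n) (s : ℝ) (β : Fin n → ℕ) : Pm m n →ₗ[ℝ] ℝ := (s ^ (m - deg β))⁻¹ • cf x β

lemma nc_def (x : Euc n) (s : ℝ) (β : Fin n → ℕ) (P : Pm m n) : nc x s β P = (s ^ (m - deg β))⁻¹ * cf x β P := rfl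

lemma cf_nc {x : Euc n} {s : ℝ} (hs : 0 < s) (β : Fin n → ℕ) (P : Pm m n) : cf x β P = s ^ (m - deg β) * nc x s β P := by
  rw [nc_def, ← mul_assoc, mul_inv_cancel₀ (by positivity), one_mul]

lemma abs_nc_le {x : Euc n} {s C : ℝ} (hs : 0 < s) {β : Fin n → ℕ} {P : Pm m n} :
    |nc x s β P| ≤ C ↔ |cf x β P| ≤ C * s ^ (m - deg β) := by
  have h : 0 < s ^ (m - deg β) := by positivity
  rw [nc_def, abs_mul, abs_of_pos (inv_pos.2 h), inv_mul_le_iff₀ h, mul_comm]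

lemma nb_iff {x : Euc n} {s C : ℝ} (hs : 0 < s) {P : Pm m n} : nb x s P C ↔ ∀ β ∈ mis m n, |nc x s β P| ≤ C := by
  unfold nb
  simp only [abs_nc_le hs]

/-- directions -/
def Dr (G : Set (Pm m n)) (P : Pm m n) (c : ℝ) (U : Pm m n) : Prop := 0 < c ∧ P + c⁻¹ • U ∈ G ∧ P - c⁻¹ • U ∈ G

lemma Dr.mem {G : Set (Pm m n)} (hG : Convex ℝ G) {P U : Pm m n} {c : ℝ} (h : Dr G P c U) : P ∈ G := by
  have := hG h.2.1 h.2.2 (a := 1/2) (b := 1/2) (by norm_num) (by norm_num) (by norm_num)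
  convert this using 1
  module

lemma Dr.sub {G G' : Set (Pm m n)} (hG : G ⊆ G') {P U : Pm m n} {c : ℝ} (h : Dr G P c U) : Dr G' P c U :=
  ⟨h.1, hG h.2.1, hG h.2.2⟩

lemma Dr.smul {G : Set (Pm m n)} (hG : Convex ℝ G) {P U : Pm m n} {c d a : ℝ} (h : Dr G P c U) (hd : 0 < d) (ha : |a| * c ≤ d) :
    Dr G P d (a • U) := by
  have hc := h.1
  have ht : |a * c / d| ≤ 1 := by
    rw [abs_div, abs_mul, abs_of_pos hc, abs_of_pos hd]; exact (div_le_one hd).2 ha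
  obtain ⟨h1, h2⟩ := abs_le.1 ht
  have e : d⁻¹ • a • U = (a * c / d) • c⁻¹ • U := by
    rw [smul_smul, smul_smul]; congr 1; field_simp
  refine ⟨hd, ?_, ?_⟩
  · have := hG h.2.1 h.2.2 (a := (1 + a * c / d)/2) (b := (1 - a * c / d)/2) (by linarith) (by linarith) (by ring)
    rw [e]; convert this using 1; module
  · have := hG h.2.1 h.2.2 (a := (1 - a * c / d)/2) (b := (1 + a * c / d)/2) (by linarith) (by linarith) (by ring)
    rw [e]; convert this using 1; module

lemma Dr.mono {G : Set (Pm m n)} (hG : Convex ℝ G) {P U : Pm m n} {c d : ℝ} (h : Dr G P c U) (hcd : c ≤ d) : Dr G P d U := by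
  have := h.smul hG (a := 1) (d := d) (h.1.trans_le hcd) (by simpa using hcd)
  simpa using this

lemma Dr.add {G : Set (Pm m n)} (hG : Convex ℝ G) {P U V : Pm m n} {c d : ℝ} (h : Dr G P c U) (h' : Dr G P d V) : Dr G P (c + d) (U + V) := by
  have hc := h.1
  have hd := h'.1
  have e : (c + d)⁻¹ • (U + V) = (c / (c + d)) • c⁻¹ • U + (d / (c + d)) • d⁻¹ • V := by
    rw [smul_smul, smul_smul, smul_add]; congr 2 <;> field_simp
  have hs : c / (c + d) + d / (c + d) = 1 := by field_simp
  have hs' : d / (c + d) = 1 - c / (c + d) := by linarith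
  refine ⟨by linarith, ?_, ?_⟩
  · have := hG h.2.1 h'.2.1 (a := c / (c + d)) (b := d / (c + d)) (by positivity) (by positivity) hs
    rw [e]; convert this using 1; rw [hs']; module
  · have := hG h.2.2 h'.2.2 (a := c / (c + d)) (b := d / (c + d)) (by positivity) (by positivity) hs
    rw [e]; convert this using 1; rw [hs']; module

lemma Dr_zero {G : Set (Pm m n)} {P : Pm m n} {c : ℝ} (hc : 0 < c) (h : P ∈ G) : Dr G P c 0 := by
  refine ⟨hc, ?_, ?_⟩ <;> simpa using h

lemma Dr.sum {G : Set (Pm m n)} (hG : Convex ℝ G) {P : Pm m n} (hP : P ∈ G) {ι : Type*} (I : Finset ι) (c : ι → ℝ) (U : ι → Pm m n) (K e d : ℝ)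
    (h : ∀ i ∈ I, Dr G P K (U i)) (he : ∀ i ∈ I, |c i| * K ≤ e) (hd : 0 < d) : Dr G P (I.card * e + d) (∑ i ∈ I, c i • U i) := by
  induction I using Finset.induction_on with
  | empty => simpa using Dr_zero hd hP
  | insert i I hi ih =>
    rw [Finset.sum_insert hi, Finset.card_insert_of_notMem hi]
    have h1 := ih (fun j hj => h j (by simp [hj])) (fun j hj => he j (by simp [hj]))
    have hK := h i (by simp)
    have hei := he i (by simp)
    have he0 : 0 ≤ e := le_trans (mul_nonneg (abs_nonneg _) hK.1.le) hei
    rcases he0.eq_or_lt with h0 | h0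
    · have hci : c i = 0 := by
        rw [← h0] at hei
        have : |c i| ≤ 0 := by
          by_contra hh
          have := mul_pos (not_le.1 hh) hK.1
          linarith
        simpa using this
      rw [hci, zero_smul, zero_add]
      refine h1.mono hG ?_
      push_cast; nlinarith
    · have h2 := hK.smul hG (a := c i) (d := e) h0 hei
      have := h2.add hG h1
      refine this.mono hG (le_of_eq ?_)
      push_cast; ring

/-- change of the base point -/
lemma Dr.move {G : Set (Pm m n)} (hG : Convex ℝ G) {P Q U : Pm m n} {c t : ℝ} (h : Dr G P c U) (hQ : Q ∈ G) (ht : 0 ≤ t) (ht' : t ≤ 1 / 2) :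
    Dr G (P + t • (Q - P)) (2 * c) U := by
  have hc := h.1
  have h2 : Dr G P (2 * (1 - t) * c) U := h.mono hG (by nlinarith)
  have e : (2 * c)⁻¹ • U = (1 - t) • (2 * (1 - t) * c)⁻¹ • U := by
    have : 1 - t ≠ 0 := by linarith
    rw [smul_smul]; congr 1; field_simp
  refine ⟨by positivity, ?_, ?_⟩
  · have := hG hQ h2.2.1 (a := t) (b := 1 - t) ht (by linarith) (by ring)
    rw [e]; convert this using 1; module
  · have := hG hQ h2.2.2 (a := t) (b := 1 - t) ht (by linarith) (by ring)
    rw [e]; convert this using 1; module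

/-- weak basis -/
def WB (Γ : Euc n → ℝ → Set (Pm m n)) (x : Euc n) (P : Pm m n) (A : Finset (Fin n → ℕ)) (s C : ℝ) : Prop :=
  P ∈ Γ x C ∧ ∃ V : (Fin n → ℕ) → Pm m n, ∀ α ∈ A, Dr (Γ x C) P C (V α) ∧
    (∀ β ∈ A, nc x s β (V α) = if β = α then 1 else 0) ∧ ∀ β ∈ mis m n, key α ≤ key β → |nc x s β (V α)| ≤ C

/-- strong basis -/
def SB (Γ : Euc n → ℝ → Set (Pm m n)) (x : Euc n) (P : Pm m n) (A : Finset (Fin n → ℕ)) (s C : ℝ) : Prop :=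
  P ∈ Γ x C ∧ ∃ V : (Fin n → ℕ) → Pm m n, ∀ α ∈ A, Dr (Γ x C) P C (V α) ∧
    (∀ β ∈ A, nc x s β (V α) = if β = α then 1 else 0) ∧ ∀ β ∈ mis m n, |nc x s β (V α)| ≤ C

section
variable {Γ Γ' : Euc n → ℝ → Set (Pm m n)} {x : Euc n} {P Q : Pm m n} {A : Finset (Fin n → ℕ)} {s s' C C' Cw : ℝ}

lemma SB.wb (h : SB Γ x P A s C) : WB Γ x P A s C := by
  obtain ⟨h1, V, h2⟩ := h
  exact ⟨h1, V, fun α hα => ⟨(h2 α hα).1, (h2 α hα).2.1, fun β hβ _ => (h2 α hα).2.2 β hβ⟩⟩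

lemma WB.up (hΓ : SF Γ Cw) (h : WB Γ x P A s C) (hC : C ≤ C') : WB Γ x P A s C' := by
  obtain ⟨h1, V, h2⟩ := h
  exact ⟨hΓ.mono _ _ _ hC h1, V, fun α hα => ⟨((h2 α hα).1.sub (hΓ.mono _ _ _ hC)).mono (hΓ.conv _ _) hC, (h2 α hα).2.1, fun β hβ hk => ((h2 α hα).2.2 β hβ hk).trans hC⟩⟩

lemma SB.up (hΓ : SF Γ Cw) (h : SB Γ x P A s C) (hC : C ≤ C') : SB Γ x P A s C' := by
  obtain ⟨h1, V, h2⟩ := h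
  exact ⟨hΓ.mono _ _ _ hC h1, V, fun α hα => ⟨((h2 α hα).1.sub (hΓ.mono _ _ _ hC)).mono (hΓ.conv _ _) hC, (h2 α hα).2.1, fun β hβ => ((h2 α hα).2.2 β hβ).trans hC⟩⟩

lemma WB.sub (hΓ : ∀ x M, Γ x M ⊆ Γ' x M) (h : WB Γ x P A s C) : WB Γ' x P A s C := by
  obtain ⟨h1, V, h2⟩ := h
  exact ⟨hΓ _ _ h1, V, fun α hα => ⟨(h2 α hα).1.sub (hΓ _ _), (h2 α hα).2⟩⟩

lemma SB.sub (hΓ : ∀ x M, Γ x M ⊆ Γ' x M) (h : SB Γ x P A s C) : SB Γ' x P A s C := by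
  obtain ⟨h1, V, h2⟩ := h
  exact ⟨hΓ _ _ h1, V, fun α hα => ⟨(h2 α hα).1.sub (hΓ _ _), (h2 α hα).2⟩⟩

lemma WB.move (hΓ : SF Γ Cw) (h : WB Γ x P A s C) (hC : 0 < C) {t : ℝ} (hQ : Q ∈ Γ x C) (ht : 0 ≤ t) (ht' : t ≤ 1 / 2) :
    WB Γ x (P + t • (Q - P)) A s (2 * C) := by
  obtain ⟨h1, V, h2⟩ := h
  have hle : C ≤ 2 * C := by linarith
  refine ⟨hΓ.mono _ _ _ hle ?_, V, fun α hα => ⟨((h2 α hα).1.move (hΓ.conv _ _) hQ ht ht').sub (hΓ.mono _ _ _ hle), (h2 α hα).2.1, fun β hβ hk => ((h2 α hα).2.2 β hβ hk).trans hle⟩⟩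
  have := hΓ.conv x C hQ h1 (a := t) (b := 1 - t) ht (by linarith) (by ring)
  convert this using 1; module

lemma SB.move (hΓ : SF Γ Cw) (h : SB Γ x P A s C) (hC : 0 < C) {t : ℝ} (hQ : Q ∈ Γ x C) (ht : 0 ≤ t) (ht' : t ≤ 1 / 2) :
    SB Γ x (P + t • (Q - P)) A s (2 * C) := by
  obtain ⟨h1, V, h2⟩ := h
  have hle : C ≤ 2 * C := by linarith
  refine ⟨hΓ.mono _ _ _ hle ?_, V, fun α hα => ⟨((h2 α hα).1.move (hΓ.conv _ _) hQ ht ht').sub (hΓ.mono _ _ _ hle), (h2 α hα).2.1, fun β hβ => ((h2 α hα).2.2 β hβ).trans hle⟩⟩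
  have := hΓ.conv x C hQ h1 (a := t) (b := 1 - t) ht (by linarith) (by ring)
  convert this using 1; module

lemma WB.scale (hΓ : SF Γ Cw) (h : WB Γ x P A s C) (hA : A ⊆ mis m n) (hs' : 0 < s') (hss : s' ≤ s) : WB Γ x P A s' C := by
  obtain ⟨h1, V, h2⟩ := h
  have hs : 0 < s := hs'.trans_le hss
  have hq : 0 < s' / s := by positivity
  have hq1 : s' / s ≤ 1 := (div_le_one hs).2 hss
  have key2 : ∀ β (U : Pm m n), nc x s' β U = ((s' / s) ^ (m - deg β))⁻¹ * nc x s β U := by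
    intro β U; rw [nc_def, nc_def, div_pow]; field_simp
  refine ⟨h1, fun α => (s' / s) ^ (m - deg α) • V α, fun α hα => ⟨?_, ?_, ?_⟩⟩
  · refine (h2 α hα).1.smul (hΓ.conv _ _) (h2 α hα).1.1 ?_
    rw [abs_of_pos (by positivity)]
    exact mul_le_of_le_one_left (h2 α hα).1.1.le (pow_le_one₀ hq.le hq1)
  · intro β hβ
    rw [map_smul, key2, (h2 α hα).2.1 β hβ]
    split_ifs with hb
    · subst hb; simp; field_simp
    · simp
  · intro β hβ hk
    rw [map_smul, key2, smul_eq_mul, ← mul_assoc, abs_mul]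
    have h3 := (h2 α hα).2.2 β hβ hk
    have hd := deg_le_of_key hk
    have e : m - deg α = (m - deg β) + (deg β - deg α) := by
      have := mem_mis.1 hβ; omega
    have e2 : (s' / s) ^ (m - deg α) * ((s' / s) ^ (m - deg β))⁻¹ = (s' / s) ^ (deg β - deg α) := by
      rw [e, pow_add]; field_simp
    rw [e2, abs_of_pos (by positivity)]
    exact (mul_le_of_le_one_left (abs_nonneg _) (pow_le_one₀ hq.le hq1)).trans h3

/-- adding a label -/
lemma WB.al (hΓ : SF Γ Cw) (h : WB Γ x P A s C) (hC : 1 ≤ C) (hA : A ⊆ mis m n) {β : Fin n → ℕ} (hβ : β ∈ mis m n) {W : Pm m n}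
    (hW : Dr (Γ x C) P C W) (hW1 : nc x s β W = 1) (hWb : ∀ γ ∈ mis m n, |nc x s γ W| ≤ C)
    (hW0 : ∀ α ∈ A, key α < key β → nc x s α W = 0) : WB Γ x P (nl A β) s (C + C * C) := by
  obtain ⟨h1, V, h2⟩ := h
  have hle : C ≤ C + C * C := by nlinarith
  refine ⟨hΓ.mono _ _ _ hle h1, fun α => if α = β then W else V α + (-nc x s β (V α)) • W, fun α hα => ?_⟩
  rw [mem_nl] at hα
  by_cases hab : α = β
  · subst hab
    simp only [if_true]
    refine ⟨(hW.sub (hΓ.mono _ _ _ hle)).mono (hΓ.conv _ _) hle, fun γ hγ => ?_, fun γ hγ _ => (hWb γ hγ).trans hle⟩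
    rw [mem_nl] at hγ
    rcases hγ with rfl | hγ
    · simp [hW1]
    · rw [hW0 γ hγ.1 hγ.2, if_neg]; rintro rfl; exact lt_irrefl _ hγ.2
  · simp only [if_neg hab]
    obtain ⟨hαA, hk⟩ := hα.resolve_left hab
    obtain ⟨h3, h4, h5⟩ := h2 α hαA
    have h6 := h5 β hβ hk.le
    refine ⟨?_, fun γ hγ => ?_, fun γ hγ hk' => ?_⟩
    · refine Dr.sub (hΓ.mono _ _ _ hle) ?_
      refine h3.add (hΓ.conv _ _) (hW.smul (hΓ.conv _ _) (by positivity) ?_)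
      rw [abs_neg]; gcongr
    · rw [mem_nl] at hγ
      rcases hγ with rfl | hγ
      · simp [hW1, Ne.symm hab]
      · simp only [map_add, map_smul, smul_eq_mul, hW0 γ hγ.1 hγ.2, h4 γ hγ.1]; simp
    · simp only [map_add, map_smul, smul_eq_mul]
      refine (abs_add_le _ _).trans (add_le_add (h5 γ hγ hk') ?_)
      rw [abs_mul, abs_neg]
      exact mul_le_mul h6 (hWb γ hγ) (abs_nonneg _) (by linarith)
end

end FP

namespace FP
open scoped ContDiff Classical Topology
set_option linter.all false

variable {m n : ℕ}

lemma deg_single (i : Fin n) : deg (Pi.single i 1 : Fin n → ℕ) = 1 := by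
  unfold deg; simp [Finset.sum_pi_single']

lemma not_Mono {A : Finset (Fin n → ℕ)} (h : ¬ Mono A m) : ∃ α ∈ A, ∃ i, α + Pi.single i 1 ∈ mis m n ∧ α + Pi.single i 1 ∉ A := by
  by_contra hcon
  push Not at hcon
  apply h
  have key : ∀ k : ℕ, ∀ α ∈ A, ∀ γ ∈ mis m n, α ≤ γ → deg γ = deg α + k → γ ∈ A := by
    intro k
    induction k with
    | zero =>
      intro α hα γ hγ hle hd
      have : α = γ := by
        funext i
        by_contra hne
        have : deg α < deg γ := Finset.sum_lt_sum (fun i _ => hle i) ⟨i, Finset.mem_univ _, lt_of_le_of_ne (hle i) hne⟩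
        omega
      exact this ▸ hα
    | succ k ih =>
      intro α hα γ hγ hle hd
      obtain ⟨i, hi⟩ : ∃ i, α i < γ i := by
        by_contra hc; push Not at hc
        have : deg γ ≤ deg α := Finset.sum_le_sum (fun i _ => hc i)
        omega
      have hle' : α + Pi.single i 1 ≤ γ := by
        intro j
        by_cases hj : j = i
        · subst hj; simp; omega
        · simp [hj]; exact hle j
      have hm : α + Pi.single i 1 ∈ mis m n := mem_mis.2 (lt_of_le_of_lt (deg_mono hle') (mem_mis.1 hγ))
      refine ih _ (hcon α hα i hm) γ hγ hle' ?_
      rw [deg_add, deg_single]; omega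
  intro α hα γ hγ hle
  exact key (deg γ - deg α) α hα γ hγ hle (by have := deg_mono hle; omega)

lemma nc_mulX (x : Euc n) {s : ℝ} (hs : 0 < s) (i : Fin n) (V : Pm m n) {κ : Fin n → ℕ} (hκ : κ ∈ mis m n) :
    nc x s κ ((1 / s) • mulX x i V) = if κ i = 0 then 0 else κ i * nc x s (κ - Pi.single i 1) V := by
  rw [map_smul, nc_def, cf_mulX x i V hκ]
  split_ifs with h
  · simp
  · rw [nc_def]
    have hk : κ = (κ - Pi.single i 1) + Pi.single i 1 := by
      funext j
      by_cases hj : j = i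
      · subst hj; simp; omega
      · simp [hj]
    have hd : deg κ = deg (κ - Pi.single i 1) + 1 := by
      conv_lhs => rw [hk, deg_add, deg_single]
    have e : m - deg (κ - Pi.single i 1) = (m - deg κ) + 1 := by
      have := mem_mis.1 hκ; omega
    rw [e, pow_succ, smul_eq_mul]; field_simp

lemma le_deg (κ : Fin n → ℕ) (i : Fin n) : κ i ≤ deg κ := Finset.single_le_sum (f := κ) (fun _ _ => Nat.zero_le _) (Finset.mem_univ i)

lemma card_le_Dn {A : Finset (Fin n → ℕ)} (hA : A ⊆ mis m n) : (A.card : ℝ) ≤ Dn m n := by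
  unfold Dn
  have : (A.card : ℝ) ≤ (mis m n).card := by exact_mod_cast Finset.card_le_card hA
  linarith

lemma Rstep (Cw C : ℝ) (hC : 1 ≤ C) : ∃ C', C ≤ C' ∧ ∀ (Γ : Euc n → ℝ → Set (Pm m n)) x P A s, SF Γ Cw → A ⊆ mis m n → 0 < s → s ≤ 1 →
    WB Γ x P A s C → (Mono A m ∧ SB Γ x P A s C) ∨ ∃ A' ⊆ mis m n, wt m A < wt m A' ∧ WB Γ x P A' s C' := by
  have hD := Dn_one (m := m) (n := n)
  set D := Dn m n with hDdef
  set η : ℝ := 1 / (2 * D * (m + 1) * C) with hη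
  have hmp : (0:ℝ) < m + 1 := by positivity
  have hη0 : 0 < η := by positivity
  have hη1 : η ≤ 1 := by
    rw [hη, div_le_one (by positivity)]
    have : (1:ℝ) ≤ m + 1 := by linarith [(Nat.cast_nonneg m : (0:ℝ) ≤ m)]
    have h2 : 1 ≤ D * (m + 1) := one_le_mul_of_one_le_of_one_le hD this
    have h3 : 1 ≤ D * (m + 1) * C := one_le_mul_of_one_le_of_one_le h2 hC
    nlinarith
  set C1 : ℝ := 2 * |Cw| * C + 2 * ((m + 1) * C + 1) + C / η with hC1
  have hCη : C ≤ C / η := by rw [le_div_iff₀ hη0]; nlinarith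
  have hpos1 : 0 ≤ 2 * |Cw| * C := by positivity
  have hpos2 : 0 ≤ 2 * ((m + 1) * C + 1) := by positivity
  have hC1C : C ≤ C1 := by linarith
  have hC11 : 1 ≤ C1 := by linarith
  refine ⟨C1 + C1 * C1, by nlinarith, fun Γ x P A s hΓ hA hs hs1 hWB => ?_⟩
  have hWB' := hWB
  obtain ⟨hP, V, hV⟩ := hWB
  by_cases htype : ∃ α ∈ A, ∃ β ∈ mis m n, key β < key α ∧ η < |nc x s β (V α)|
  · -- type 1
    right
    obtain ⟨α, hα, β0, hβ0, hk0, hb0⟩ := htype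
    obtain ⟨hDr, hV1, hV2⟩ := hV α hα
    obtain ⟨β, hβ, hmax⟩ := Finset.exists_max_image ((mis m n).filter fun γ => key γ < key α) (fun γ => |nc x s γ (V α)|) ⟨β0, by simp [hβ0, hk0]⟩
    simp only [Finset.mem_filter] at hβ hmax
    have hb := hmax β0 ⟨hβ0, hk0⟩
    have hbη : η < |nc x s β (V α)| := lt_of_lt_of_le hb0 hb
    have hbpos : 0 < |nc x s β (V α)| := hη0.trans hbη
    have hb0' : nc x s β (V α) ≠ 0 := abs_pos.1 hbpos
    have hinv : |(nc x s β (V α))⁻¹| ≤ 1 / η := by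
      rw [abs_inv, inv_eq_one_div]; exact one_div_le_one_div_of_le hη0 hbη.le
    have hβA : β ∉ A := fun hmem => by
      have := hV1 β hmem
      rw [if_neg (by rintro rfl; exact lt_irrefl _ hβ.2)] at this
      exact hb0' this
    refine ⟨nl A β, nl_sub hA hβ.1, wt_nl hA hβA, ?_⟩
    refine (hWB'.up hΓ hC1C).al hΓ hC11 hA hβ.1 (W := (nc x s β (V α))⁻¹ • V α) ?_ ?_ ?_ ?_
    · refine (hDr.sub (hΓ.mono _ _ _ hC1C)).smul (hΓ.conv _ _) (by linarith) ?_
      calc |(nc x s β (V α))⁻¹| * C ≤ 1 / η * C := by gcongr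
        _ = C / η := by ring
        _ ≤ C1 := by linarith
    · rw [map_smul, smul_eq_mul, inv_mul_cancel₀ hb0']
    · intro γ hγ
      rw [map_smul, smul_eq_mul, abs_mul]
      rcases lt_or_ge (key γ) (key α) with h | h
      · have := hmax γ ⟨hγ, h⟩
        refine le_trans ?_ hC11
        rw [abs_inv, inv_mul_le_iff₀ hbpos, mul_one]; exact this
      · calc |(nc x s β (V α))⁻¹| * |nc x s γ (V α)| ≤ 1 / η * C := by
              gcongr; exact hV2 γ hγ h
          _ = C / η := by ring
          _ ≤ C1 := by linarith
    · intro α' hα' hk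
      rw [map_smul, hV1 α' hα', if_neg, smul_zero]
      rintro rfl; exact lt_asymm hk hβ.2
  · push Not at htype
    have hstrong : ∀ α ∈ A, ∀ β ∈ mis m n, |nc x s β (V α)| ≤ C := by
      intro α hα β hβ
      rcases lt_or_ge (key β) (key α) with h | h
      · exact (htype α hα β hβ h).trans (by linarith)
      · exact (hV α hα).2.2 β hβ h
    by_cases hmono : Mono A m
    · left
      exact ⟨hmono, hP, V, fun α hα => ⟨(hV α hα).1, (hV α hα).2.1, hstrong α hα⟩⟩
    right
    obtain ⟨α, hα, i, hβ, hβA⟩ := not_Mono hmono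
    obtain ⟨hDr, hV1, hV2⟩ := hV α hα
    set β := α + Pi.single i 1 with hβdef
    set U : Pm m n := (1 / s) • mulX x i (V α) with hU
    have hle2 : C ≤ Cw * (2 * C) := by nlinarith [hΓ.one]
    -- the direction
    have hDU : Dr (Γ x (Cw * (2 * C))) P C U := by
      have hC0 : (0:ℝ) < C := by linarith
      have main : ∀ e : Pm m n, P + e ∈ Γ x C → P - e ∈ Γ x C → nb x s e 1 → P + (1 / s) • mulX x i e ∈ Γ x (Cw * (2 * C)) := by
        intro e h1 h2 h3
        rw [← lt2_bl]
        refine hΓ.blend x (2 * C) s _ _ _ (by linarith) hs hs1 (hΓ.mono _ _ _ (by linarith) h1) (hΓ.mono _ _ _ (by linarith) h2) ?_ (lt2_adm i x hs)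
        have e' : P + e - (P - e) = e + e := by abel
        rw [e']
        exact (h3.add h3).mono hs.le (by linarith)
      have hn : nb x s (C⁻¹ • V α) 1 := by
        rw [nb_iff hs]
        intro γ hγ
        rw [map_smul, smul_eq_mul, abs_mul, abs_of_pos (inv_pos.2 hC0), inv_mul_le_iff₀ hC0, mul_one]
        exact hstrong α hα γ hγ
      refine ⟨hC0, ?_, ?_⟩
      · have := main _ hDr.2.1 hDr.2.2 hn
        rw [map_smul, smul_comm] at this; exact this
      · have := main (-(C⁻¹ • V α)) (by rw [← sub_eq_add_neg]; exact hDr.2.2) (by rw [sub_neg_eq_add]; exact hDr.2.1) hn.neg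
        rw [map_neg, map_smul, smul_neg, smul_comm, ← sub_eq_add_neg] at this; exact this
    have hbi : (1:ℝ) ≤ β i := by
      have : 1 ≤ β i := by rw [hβdef]; simp
      exact_mod_cast this
    have hncU : ∀ κ ∈ mis m n, nc x s κ U = if κ i = 0 then 0 else κ i * nc x s (κ - Pi.single i 1) (V α) := fun κ hκ => nc_mulX x hs i (V α) hκ
    have hmisub : ∀ κ ∈ mis m n, κ - Pi.single i 1 ∈ mis m n := fun κ hκ => mem_mis.2 (lt_of_le_of_lt (deg_mono (by intro j; simp)) (mem_mis.1 hκ))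
    have hκm : ∀ κ ∈ mis m n, (κ i : ℝ) ≤ m + 1 := fun κ hκ => by
      have h1 := le_deg κ i; have h2 := mem_mis.1 hκ
      have : κ i ≤ m + 1 := by omega
      exact_mod_cast this
    set W0 : Pm m n := (β i : ℝ)⁻¹ • U with hW0
    have hbinv : |(β i : ℝ)⁻¹| ≤ 1 := by
      rw [abs_of_pos (by positivity)]; exact inv_le_one_of_one_le₀ hbi
    have hW0DR : Dr (Γ x (Cw * (2 * C))) P C W0 := hDU.smul (hΓ.conv _ _) (by linarith) (mul_le_of_le_one_left (by linarith) hbinv)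
    have hW0β : nc x s β W0 = 1 := by
      rw [hW0, map_smul, hncU β hβ, if_neg (by rw [hβdef]; simp), smul_eq_mul, ← mul_assoc, inv_mul_cancel₀ (by linarith), one_mul]
      have : β - Pi.single i 1 = α := by rw [hβdef]; simp
      rw [this, hV1 α hα, if_pos rfl]
    have hW0b : ∀ κ ∈ mis m n, |nc x s κ W0| ≤ (m + 1) * C := by
      intro κ hκ
      rw [hW0, map_smul, smul_eq_mul, abs_mul]
      refine (mul_le_of_le_one_left (abs_nonneg _) hbinv).trans ?_
      rw [hncU κ hκ]
      split_ifs with h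
      · simp; positivity
      · rw [abs_mul, Nat.abs_cast]
        exact mul_le_mul (hκm κ hκ) (hstrong α hα _ (hmisub κ hκ)) (abs_nonneg _) hmp.le
    have hW0s : ∀ κ ∈ mis m n, key κ < key β → |nc x s κ W0| ≤ (m + 1) * η := by
      intro κ hκ hk
      rw [hW0, map_smul, smul_eq_mul, abs_mul]
      refine (mul_le_of_le_one_left (abs_nonneg _) hbinv).trans ?_
      rw [hncU κ hκ]
      split_ifs with h
      · simp; positivity
      · rw [abs_mul, Nat.abs_cast]
        refine mul_le_mul (hκm κ hκ) (htype α hα _ (hmisub κ hκ) ?_) (abs_nonneg _) hmp.le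
        have e : κ = (κ - Pi.single i 1) + Pi.single i 1 := by
          funext j
          by_cases hj : j = i
          · subst hj; simp; omega
          · simp [hj]
        rw [e, hβdef] at hk
        exact key_add_lt hk
    set B := A.filter (fun α' => key α' < key β) with hB
    have hBA : ∀ α' ∈ B, α' ∈ A ∧ key α' < key β := fun α' h => by rw [hB, Finset.mem_filter] at h; exact h
    have hBm : B ⊆ mis m n := (Finset.filter_subset _ _).trans hA
    set W1 : Pm m n := W0 + ∑ α' ∈ B, (-nc x s α' W0) • V α' with hW1
    have hncW1 : ∀ γ, nc x s γ W1 = nc x s γ W0 + ∑ α' ∈ B, (-nc x s α' W0) * nc x s γ (V α') := by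
      intro γ; rw [hW1, map_add, map_sum]; simp only [map_smul, smul_eq_mul]
    have hsmall : ∀ γ ∈ mis m n, |∑ α' ∈ B, (-nc x s α' W0) * nc x s γ (V α')| ≤ 1 / 2 := by
      intro γ hγ
      refine (Finset.abs_sum_le_sum_abs _ _).trans ?_
      have : ∀ α' ∈ B, |(-nc x s α' W0) * nc x s γ (V α')| ≤ (m + 1) * η * C := by
        intro α' hα'
        rw [abs_mul, abs_neg]
        exact mul_le_mul (hW0s α' (hBm hα') (hBA α' hα').2) (hstrong α' (hBA α' hα').1 γ hγ) (abs_nonneg _) (by positivity)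
      refine (Finset.sum_le_card_nsmul _ _ _ this).trans ?_
      rw [nsmul_eq_mul]
      calc (B.card : ℝ) * ((m + 1) * η * C) ≤ D * ((m + 1) * η * C) := by gcongr; exact card_le_Dn hBm
        _ = 1 / 2 := by rw [hη]; field_simp
    have hW1β : 1 / 2 ≤ nc x s β W1 := by
      rw [hncW1, hW0β]
      have := (abs_le.1 (hsmall β hβ)).1
      linarith
    have hW1b : ∀ κ ∈ mis m n, |nc x s κ W1| ≤ (m + 1) * C + 1 := by
      intro κ hκ
      rw [hncW1]
      refine (abs_add_le _ _).trans ?_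
      have := hsmall κ hκ; have := hW0b κ hκ; linarith
    have hW1z : ∀ α' ∈ B, nc x s α' W1 = 0 := by
      intro α' hα'
      rw [hncW1]
      have : ∀ γ ∈ B, (-nc x s γ W0) * nc x s α' (V γ) = if γ = α' then -nc x s α' W0 else 0 := by
        intro γ hγ
        rw [(hV γ (hBA γ hγ).1).2.1 α' (hBA α' hα').1]
        by_cases h : γ = α'
        · subst h; simp
        · rw [if_neg (Ne.symm h), if_neg h, mul_zero]
      rw [Finset.sum_congr rfl this, Finset.sum_ite_eq' B α', if_pos hα', add_neg_cancel]
    have hW1D : Dr (Γ x (Cw * (2 * C))) P (C + 1) W1 := by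
      have h1 := Dr.sum (hΓ.conv x (Cw * (2 * C))) (hΓ.mono _ _ _ hle2 hP) B (fun α' => -nc x s α' W0) V C ((m + 1) * η * C) (1 / 2)
        (fun α' hα' => (hV α' (hBA α' hα').1).1.sub (hΓ.mono _ _ _ hle2))
        (fun α' hα' => by rw [abs_neg]; gcongr; exact hW0s α' (hBm hα') (hBA α' hα').2) (by norm_num)
      refine (hW0DR.add (hΓ.conv _ _) h1).mono (hΓ.conv _ _) ?_
      have : (B.card : ℝ) * ((m + 1) * η * C) ≤ 1 / 2 :=
        calc (B.card : ℝ) * ((m + 1) * η * C) ≤ D * ((m + 1) * η * C) := by gcongr; exact card_le_Dn hBm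
          _ = 1 / 2 := by rw [hη]; field_simp
      linarith
    have hinv : |(nc x s β W1)⁻¹| ≤ 2 := by
      rw [abs_inv, inv_eq_one_div, abs_of_pos (by linarith), div_le_iff₀ (by linarith)]; linarith
    have hle3 : Cw * (2 * C) ≤ C1 := by
      have : Cw * (2 * C) ≤ |Cw| * (2 * C) := by gcongr; exact le_abs_self _
      have h0 : 0 ≤ C / η := by positivity
      linarith
    have h0 : 0 ≤ C / η := by positivity
    refine ⟨nl A β, nl_sub hA hβ, wt_nl hA hβA, ?_⟩
    refine (hWB'.up hΓ hC1C).al hΓ hC11 hA hβ (W := (nc x s β W1)⁻¹ • W1) ?_ ?_ ?_ ?_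
    · refine (hW1D.sub (hΓ.mono _ _ _ hle3)).smul (hΓ.conv _ _) (by linarith) ?_
      have hm1 : C ≤ (m + 1) * C := le_mul_of_one_le_left (by linarith) (by linarith [(Nat.cast_nonneg m : (0:ℝ) ≤ m)])
      calc |(nc x s β W1)⁻¹| * (C + 1) ≤ 2 * (C + 1) := by gcongr
        _ ≤ C1 := by linarith
    · rw [map_smul, smul_eq_mul, inv_mul_cancel₀ (by linarith)]
    · intro γ hγ
      rw [map_smul, smul_eq_mul, abs_mul]
      calc |(nc x s β W1)⁻¹| * |nc x s γ W1| ≤ 2 * ((m + 1) * C + 1) := by gcongr; exact hW1b γ hγ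
        _ ≤ C1 := by linarith
    · intro α' hα' hk
      rw [map_smul, hW1z α' (by rw [hB, Finset.mem_filter]; exact ⟨hα', hk⟩), smul_zero]

lemma Riter (Cw : ℝ) : ∀ C, 1 ≤ C → ∃ C', C ≤ C' ∧ ∀ (Γ : Euc n → ℝ → Set (Pm m n)) x P A s, SF Γ Cw → A ⊆ mis m n → 0 < s → s ≤ 1 →
    WB Γ x P A s C → ∃ A' ⊆ mis m n, wt m A ≤ wt m A' ∧ Mono A' m ∧ SB Γ x P A' s C' := by
  suffices H : ∀ k : ℕ, ∀ C, 1 ≤ C → ∃ C', C ≤ C' ∧ ∀ (Γ : Euc n → ℝ → Set (Pm m n)) x P A s, SF Γ Cw → A ⊆ mis m n → 0 < s → s ≤ 1 →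
    wt m (mis m n) ≤ wt m A + k →
    WB Γ x P A s C → ∃ A' ⊆ mis m n, wt m A ≤ wt m A' ∧ Mono A' m ∧ SB Γ x P A' s C' by
    intro C hC
    obtain ⟨C', h1, h2⟩ := H (wt m (mis m n)) C hC
    exact ⟨C', h1, fun Γ x P A s a b c d e => h2 Γ x P A s a b c d (by omega) e⟩
  intro k
  induction k with
  | zero =>
    intro C hC
    obtain ⟨C', h1, h2⟩ := Rstep (m := m) (n := n) Cw C hC
    refine ⟨C, le_rfl, fun Γ x P A s a b c d e f => ?_⟩
    rcases h2 Γ x P A s a b c d f with h | ⟨A', hA', hw, _⟩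
    · exact ⟨A, b, le_rfl, h.1, h.2⟩
    · have := wt_le hA'; omega
  | succ k ih =>
    intro C hC
    obtain ⟨C1, h1, h2⟩ := Rstep (m := m) (n := n) Cw C hC
    obtain ⟨C2, h3, h4⟩ := ih C1 (hC.trans h1)
    refine ⟨C2, h1.trans h3, fun Γ x P A s a b c d e f => ?_⟩
    rcases h2 Γ x P A s a b c d f with h | ⟨A', hA', hw, h⟩
    · exact ⟨A, b, le_rfl, h.1, h.2.up a (h1.trans h3)⟩
    · obtain ⟨A'', g1, g2, g3⟩ := h4 Γ x P A' s a hA' c d (by omega) h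
      exact ⟨A'', g1, by omega, g3⟩

end FP

namespace FP
open scoped ContDiff Classical Topology
set_option linter.all false

variable {m n : ℕ}

lemma lin_sys {ι : Type*} [DecidableEq ι] (I : Finset ι) (a : ι → ι → ℝ)
    (h : ∀ β ∈ I, ∀ α ∈ I, |a β α - (if β = α then 1 else 0)| * (2 * (I.card + 1)) ≤ 1) (t : ι → ℝ) (T : ℝ) (ht : ∀ β ∈ I, |t β| ≤ T) :
    ∃ u : ι → ℝ, (∀ β ∈ I, ∑ α ∈ I, u α * a β α = t β) ∧ ∀ α ∈ I, |u α| ≤ 2 * T := by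
  have hpos : (0:ℝ) < 2 * (I.card + 1) := by positivity
  have h' : ∀ β ∈ I, ∀ α ∈ I, |a β α - (if β = α then 1 else 0)| ≤ 1 / (2 * (I.card + 1)) := fun β hβ α hα => by
    rw [le_div_iff₀ hpos]; exact h β hβ α hα
  have hq : (I.card : ℝ) * (1 / (2 * (I.card + 1))) + 1 / (2 * (I.card + 1)) = 1 / 2 := by field_simp
  have hq0 : 0 < 1 / (2 * ((I.card : ℝ) + 1)) := by positivity
  set q : ℝ := 1 / (2 * ((I.card : ℝ) + 1)) with hqdef
  let M : Matrix I I ℝ := fun β α => a β α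
  have hdet : M.det ≠ 0 := by
    apply det_ne_zero_of_sum_row_lt_diag
    intro k
    have h1 : ∑ j ∈ Finset.univ.erase k, ‖M k j‖ ≤ I.card * q := by
      have : ∀ j ∈ Finset.univ.erase k, ‖M k j‖ ≤ q := by
        intro j hj
        have hne : (k : ι) ≠ j := fun h => (Finset.ne_of_mem_erase hj) (Subtype.ext h.symm)
        have := h' k k.2 j j.2
        rw [if_neg hne, sub_zero] at this
        exact this
      refine (Finset.sum_le_card_nsmul _ _ _ this).trans ?_
      rw [nsmul_eq_mul]; gcongr
      refine (Finset.card_le_univ _).trans (by simp)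
    have h2 : 1 - q ≤ ‖M k k‖ := by
      have := h' k k.2 k k.2
      rw [if_pos rfl] at this
      have h3 := (abs_le.1 this).1
      have h4 : M k k ≤ ‖M k k‖ := le_abs_self _
      have h5 : M k k = a k k := rfl
      linarith
    have h0 : (0:ℝ) ≤ I.card * q := by positivity
    linarith
  have hunit : IsUnit M.det := isUnit_iff_ne_zero.2 hdet
  let u0 : I → ℝ := M⁻¹.mulVec (fun β => t β)
  have hu0 : M.mulVec u0 = fun β : I => t β := by
    simp only [u0]
    rw [Matrix.mulVec_mulVec, Matrix.mul_nonsing_inv M hunit, Matrix.one_mulVec]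
  let u : ι → ℝ := fun α => if hα : α ∈ I then u0 ⟨α, hα⟩ else 0
  have hsol : ∀ β ∈ I, ∑ α ∈ I, u α * a β α = t β := by
    intro β hβ
    have := congrFun hu0 ⟨β, hβ⟩
    simp only [Matrix.mulVec, dotProduct] at this
    rw [← this, ← Finset.sum_coe_sort]
    refine Finset.sum_congr rfl fun α _ => ?_
    simp only [u, M]
    rw [dif_pos α.2, mul_comm]
  refine ⟨u, hsol, ?_⟩
  intro α hα
  obtain ⟨α0, hα0, hmax⟩ := Finset.exists_max_image I (fun α => |u α|) ⟨α, hα⟩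
  refine (hmax α hα).trans ?_
  have h1 := hsol α0 hα0
  have h2 : u α0 = t α0 - ∑ α ∈ I, u α * (a α0 α - if α0 = α then 1 else 0) := by
    have : ∑ α ∈ I, u α * (a α0 α - if α0 = α then 1 else 0) = ∑ α ∈ I, u α * a α0 α - u α0 := by
      simp only [mul_sub, Finset.sum_sub_distrib]
      simp [hα0]
    rw [this, h1]; ring
  have h3 : |∑ α ∈ I, u α * (a α0 α - if α0 = α then 1 else 0)| ≤ I.card * (|u α0| * q) := by
    refine (Finset.abs_sum_le_sum_abs _ _).trans ?_
    have : ∀ α ∈ I, |u α * (a α0 α - if α0 = α then 1 else 0)| ≤ |u α0| * q := by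
      intro α hα
      rw [abs_mul]
      exact mul_le_mul (hmax α hα) (h' α0 hα0 α hα) (abs_nonneg _) (abs_nonneg _)
    refine (Finset.sum_le_card_nsmul _ _ _ this).trans ?_
    rw [nsmul_eq_mul]
  have h4 : |u α0| ≤ |t α0| + |∑ α ∈ I, u α * (a α0 α - if α0 = α then 1 else 0)| := by
    conv_lhs => rw [h2]
    exact abs_sub _ _
  have h5 := ht α0 hα0
  have h6 : (I.card : ℝ) * (|u α0| * q) ≤ |u α0| * (1 / 2) := by
    have : (I.card : ℝ) * q ≤ 1 / 2 := by linarith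
    calc (I.card : ℝ) * (|u α0| * q) = |u α0| * (I.card * q) := by ring
      _ ≤ _ := by gcongr
  linarith

/-- transport of a family of directions -/
lemma transp {Γ1 Γ0 : Euc n → ℝ → Set (Pm m n)} {Cw : ℝ} {x y : Euc n} {C : ℝ} (hΓ : SF Γ0 Cw) (hsub : Γ1 x C ⊆ Γ0 x C)
    (htr : ∀ P ∈ Γ1 x C, x ≠ y → ∃ P' ∈ Γ0 y C, nb x ‖x - y‖ (P - P') C) (hC : 0 ≤ C) {ι : Type*} (I : Finset ι) (hI : I.Nonempty)
    (P : Pm m n) (U : ι → Pm m n) (hU : ∀ i ∈ I, P + U i ∈ Γ1 x C ∧ P - U i ∈ Γ1 x C) :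
    ∃ P' ∈ Γ0 y C, nb x ‖x - y‖ (P' - P) C ∧ ∃ U' : ι → Pm m n, ∀ i ∈ I, Dr (Γ0 y C) P' I.card (U' i) ∧ nb x ‖x - y‖ (U' i - U i) C := by
  have htr' : ∀ P ∈ Γ1 x C, ∃ P' ∈ Γ0 y C, nb x ‖x - y‖ (P - P') C := by
    intro P hP
    by_cases hxy : x = y
    · subst hxy
      exact ⟨P, hsub hP, by rw [sub_self P]; exact nb_zero (norm_nonneg _) hC⟩
    · exact htr P hP hxy
  have hp : ∀ i, ∃ A : Pm m n, i ∈ I → A ∈ Γ0 y C ∧ nb x ‖x - y‖ (P + U i - A) C := fun i => by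
    by_cases hi : i ∈ I
    · obtain ⟨A, h1, h2⟩ := htr' _ (hU i hi).1; exact ⟨A, fun _ => ⟨h1, h2⟩⟩
    · exact ⟨0, fun h => absurd h hi⟩
  have hm : ∀ i, ∃ A : Pm m n, i ∈ I → A ∈ Γ0 y C ∧ nb x ‖x - y‖ (P - U i - A) C := fun i => by
    by_cases hi : i ∈ I
    · obtain ⟨A, h1, h2⟩ := htr' _ (hU i hi).2; exact ⟨A, fun _ => ⟨h1, h2⟩⟩
    · exact ⟨0, fun h => absurd h hi⟩
  choose Ap hAp using hp
  choose Am hAm using hm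
  have hconv := hΓ.conv y C
  let B : ι → Pm m n := fun i => (1/2 : ℝ) • Ap i + (1/2 : ℝ) • Am i
  have hB : ∀ i ∈ I, B i ∈ Γ0 y C := fun i hi => hconv (hAp i hi).1 (hAm i hi).1 (by norm_num) (by norm_num) (by norm_num)
  have hcard : (0:ℝ) < I.card := by exact_mod_cast hI.card_pos
  have avg : ∀ X : ι → Pm m n, (∀ i ∈ I, X i ∈ Γ0 y C) → (I.card : ℝ)⁻¹ • ∑ i ∈ I, X i ∈ Γ0 y C := by
    intro X hX
    have := hconv.sum_mem (t := I) (w := fun _ => (I.card : ℝ)⁻¹) (z := X) (fun _ _ => by positivity) (by simp; field_simp) hX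
    rwa [← Finset.smul_sum] at this
  have hupd : ∀ i ∈ I, ∀ Y, (I.card : ℝ)⁻¹ • ∑ j ∈ I, B j + (I.card : ℝ)⁻¹ • (Y - B i) = (I.card : ℝ)⁻¹ • ∑ j ∈ I, Function.update B i Y j := by
    intro i hi Y
    rw [← smul_add, Finset.sum_update_of_mem hi, ← Finset.add_sum_erase I B hi, Finset.sdiff_singleton_eq_erase]
    congr 1; abel
  have hupdm : ∀ i ∈ I, ∀ Y ∈ Γ0 y C, (I.card : ℝ)⁻¹ • ∑ j ∈ I, B j + (I.card : ℝ)⁻¹ • (Y - B i) ∈ Γ0 y C := by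
    intro i hi Y hY
    rw [hupd i hi]
    apply avg
    intro j hj
    by_cases h : j = i
    · subst h; simpa using hY
    · rw [Function.update_of_ne h]; exact hB j hj
  refine ⟨(I.card : ℝ)⁻¹ • ∑ i ∈ I, B i, avg B hB, ?_, fun i => (1/2 : ℝ) • Ap i - (1/2 : ℝ) • Am i, fun i hi => ⟨⟨hcard, ?_, ?_⟩, ?_⟩⟩
  · have h1 : ∀ i ∈ I, nb x ‖x - y‖ (B i - P) C := by
      intro i hi
      have := ((nb_comm (hAp i hi).2).smul (1/2)).add ((nb_comm (hAm i hi).2).smul (1/2))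
      have e : (1/2 : ℝ) • (Ap i - (P + U i)) + (1/2 : ℝ) • (Am i - (P - U i)) = B i - P := by simp only [B]; module
      rw [e] at this
      refine this.mono (norm_nonneg _) (le_of_eq ?_)
      rw [abs_of_pos (by norm_num)]; ring
    have e : (I.card : ℝ)⁻¹ • ∑ i ∈ I, B i - P = (I.card : ℝ)⁻¹ • ∑ i ∈ I, (B i - P) := by
      rw [Finset.sum_sub_distrib, smul_sub]; congr 1
      rw [Finset.sum_const, ← Nat.cast_smul_eq_nsmul ℝ, smul_smul, inv_mul_cancel₀ hcard.ne', one_smul]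
    rw [e]
    intro β hβ
    rw [map_smul, map_sum, smul_eq_mul, abs_mul, abs_of_pos (inv_pos.2 hcard), inv_mul_le_iff₀ hcard]
    refine (Finset.abs_sum_le_sum_abs _ _).trans ?_
    refine (Finset.sum_le_card_nsmul _ _ _ fun i hi => h1 i hi β hβ).trans ?_
    rw [nsmul_eq_mul]
  · have := hupdm i hi (Ap i) (hAp i hi).1
    convert this using 2
    simp only [B]; module
  · have := hupdm i hi (Am i) (hAm i hi).1
    convert this using 1
    simp only [B]; module
  · have := ((nb_comm (hAp i hi).2).smul (1/2)).sub ((nb_comm (hAm i hi).2).smul (1/2))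
    have e : (1/2 : ℝ) • (Ap i - (P + U i)) - (1/2 : ℝ) • (Am i - (P - U i)) = (1/2 : ℝ) • Ap i - (1/2 : ℝ) • Am i - U i := by module
    rw [e] at this
    refine this.mono (norm_nonneg _) (le_of_eq ?_)
    rw [abs_of_pos (by norm_num)]; ring


lemma nc_near {x y : Euc n} {s ε C : ℝ} {U U' : Pm m n} (hs : 0 < s) (hε : 0 ≤ ε) (hε1 : ε ≤ 1) (hC : 1 ≤ C) (hxy : ‖x - y‖ ≤ ε * s)
    (hV : ∀ β ∈ mis m n, |nc x s β (C • U)| ≤ C) (hU : nb x ‖x - y‖ (U' - U) C) :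
    nb x s (C • U') (C + C * C) ∧ ∀ β ∈ mis m n, |nc y s β (C • U') - nc x s β (C • U)| ≤ ε * (Dn m n * (C + C * C)) := by
  have h1 : nb x s (C • U' - C • U) (ε * (C * C)) := by
    have := (hU.smul C).up hε1 hε (norm_nonneg _) hs.le hxy (by positivity)
    rw [smul_sub, abs_of_pos (by linarith)] at this; exact this
  have h2 : nb x s (C • U') (C + C * C) := by
    have := ((nb_iff hs).2 hV).add h1
    rw [add_sub_cancel] at this
    refine this.mono hs.le ?_
    have : ε * (C * C) ≤ C * C := mul_le_of_le_one_left (by positivity) hε1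
    linarith
  refine ⟨h2, fun β hβ => ?_⟩
  have h3 := cf_diff h2 hε hε1 hs.le hxy (by positivity) hβ
  have hp : 0 < s ^ (m - deg β) := by positivity
  have h4 : |nc y s β (C • U') - nc x s β (C • U')| ≤ (Dn m n - 1) * (C + C * C) * ε := by
    rw [nc_def, nc_def, ← mul_sub, abs_mul, abs_of_pos (inv_pos.2 hp), inv_mul_le_iff₀ hp, mul_comm]; exact h3
  have h5 : |nc x s β (C • U') - nc x s β (C • U)| ≤ ε * (C * C) := by
    rw [← map_sub]; exact (nb_iff hs).1 h1 β hβ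
  have := abs_sub_le (nc y s β (C • U')) (nc x s β (C • U')) (nc x s β (C • U))
  have h6 : 0 ≤ ε * C := by positivity
  nlinarith

lemma Tlem (Cw C : ℝ) (hC : 1 ≤ C) : ∃ ε C' : ℝ, 0 < ε ∧ ε ≤ 1 ∧ C ≤ C' ∧ ∀ (E : Set (Euc n)) (Γ : ℕ → Euc n → ℝ → Set (Pm m n)) L l x y P A B s0 s,
    Ch E Γ L Cw → l ≤ L → y ∈ E → A ⊆ mis m n → B ⊆ mis m n → Mono A m → 0 < s → s ≤ s0 → ‖x - y‖ ≤ ε * s →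
    SB (Γ (l + 1)) x P A s0 C → SB (Γ (l + 1)) x P B s C →
    ∃ P', VA A (P' - P) ∧ nb x s0 (P' - P) C' ∧ SB (Γ l) y P' B s C' := by
  have hD := Dn_one (m := m) (n := n)
  set D := Dn m n with hDdef
  set Kt : ℝ := D * (C + C * C) with hKt
  have hKt1 : 1 ≤ Kt := by
    have : 1 ≤ C + C * C := by nlinarith
    exact one_le_mul_of_one_le_of_one_le hD this
  set ε : ℝ := 1 / (2 * D * Kt + 16 * D ^ 3 * C ^ 2) with hεdef
  have hε0 : 0 < ε := by positivity
  have hε1 : ε ≤ 1 := by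
    rw [hεdef, div_le_one (by positivity)]
    have h1 : 1 ≤ D * Kt := one_le_mul_of_one_le_of_one_le hD hKt1
    have : 0 ≤ 16 * D ^ 3 * C ^ 2 := by positivity
    linarith
  have hεa : ε * Kt * (2 * D) ≤ 1 := by
    rw [hεdef, div_mul_eq_mul_div, div_mul_eq_mul_div, div_le_one (by positivity)]
    have : 0 ≤ 16 * D ^ 3 * C ^ 2 := by positivity
    linarith
  have hεb : ε * (16 * D ^ 3 * C ^ 2) ≤ 1 := by
    rw [hεdef, div_mul_eq_mul_div, div_le_one (by positivity)]
    have : 0 ≤ 2 * D * Kt := by positivity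
    linarith
  have hεK : ε * Kt ≤ 1 := by
    have : 0 ≤ ε * Kt := by positivity
    nlinarith
  set C' : ℝ := C + D * (2 * D * C * (C + C * C)) + (D * (2 * (4 * D * C)) + 1) + D * (2 * (C + 1)) with hC'
  have p1 : 0 ≤ D * (2 * D * C * (C + C * C)) := by positivity
  have p2 : 0 ≤ D * (2 * (4 * D * C)) := by positivity
  have p3 : 0 ≤ D * (2 * (C + 1)) := by positivity
  have hCC' : C ≤ C' := by linarith
  refine ⟨ε, C', hε0, hε1, hCC', ?_⟩
  intro E Γ L l x y P A B s0 s hch hl hy hA hB hAm hs hss hxy hSA hSB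
  have hs0 : 0 < s0 := hs.trans_le hss
  have hxy0 : ‖x - y‖ ≤ ε * s0 := hxy.trans (by gcongr)
  have hΓ := hch.sf l hl
  obtain ⟨hP, V, hV⟩ := hSA
  obtain ⟨-, W, hW⟩ := hSB
  have hC0 : (0:ℝ) < C := by linarith
  let U : Bool × (Fin n → ℕ) → Pm m n := fun i => if i.1 then (if i.2 ∈ A then C⁻¹ • V i.2 else 0) else (if i.2 ∈ B then C⁻¹ • W i.2 else 0)
  let I : Finset (Bool × (Fin n → ℕ)) := Finset.univ ×ˢ (insert 0 (mis m n))
  have hI : I.Nonempty := ⟨(true, 0), by simp [I]⟩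
  have hIc : (I.card : ℝ) ≤ 2 * D := by
    have : I.card ≤ 2 * ((mis m n).card + 1) := by
      simp only [I, Finset.card_product, Finset.card_univ, Fintype.card_bool]
      exact Nat.mul_le_mul_left _ (Finset.card_insert_le _ _)
    have : (I.card : ℝ) ≤ 2 * ((mis m n).card + 1) := by exact_mod_cast this
    exact this
  have hUmem : ∀ i ∈ I, P + U i ∈ Γ (l+1) x C ∧ P - U i ∈ Γ (l+1) x C := by
    rintro ⟨b, α⟩ _
    by_cases hb : b = true
    · by_cases hα : α ∈ A
      · simp only [U, if_pos hb, if_pos hα]; exact (hV α hα).1.2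
      · simp only [U, if_pos hb, if_neg hα, add_zero, sub_zero]; exact ⟨hP, hP⟩
    · by_cases hα : α ∈ B
      · simp only [U, if_neg hb, if_pos hα]; exact (hW α hα).1.2
      · simp only [U, if_neg hb, if_neg hα, add_zero, sub_zero]; exact ⟨hP, hP⟩
  obtain ⟨Pb, hPb, hPbP, U', hU'⟩ := transp hΓ (hch.sub l x C) (fun P hP hne => hch.tr l x C P hP y hy hne) hC0.le I hI P U hUmem
  have hconv := hΓ.conv y C
  have hmemI : ∀ b, ∀ α ∈ mis m n, (b, α) ∈ I := fun b α hα => by simp [I, hα]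
  have hDr : ∀ b, ∀ α ∈ mis m n, Dr (Γ l y C) Pb (2 * D * C) (C • U' (b, α)) := by
    intro b α hα
    refine (hU' _ (hmemI b α hα)).1.smul hconv (by positivity) ?_
    rw [abs_of_pos hC0, mul_comm]; gcongr
  have hUA : ∀ α ∈ A, C • U (true, α) = V α := fun α hα => by
    simp only [U, if_true, if_pos hα, smul_smul, mul_inv_cancel₀ hC0.ne', one_smul]
  have hUB : ∀ α ∈ B, C • U (false, α) = W α := fun α hα => by
    simp only [U, Bool.false_eq_true, if_false, if_pos hα, smul_smul, mul_inv_cancel₀ hC0.ne', one_smul]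
  have nearA : ∀ α ∈ A, nb x s0 (C • U' (true, α)) (C + C * C) ∧ ∀ β ∈ mis m n, |nc y s0 β (C • U' (true, α)) - nc x s0 β (V α)| ≤ ε * Kt := by
    intro α hα
    have := nc_near (U := U (true, α)) hs0 hε0.le hε1 hC hxy0 (by rw [hUA α hα]; exact (hV α hα).2.2) (hU' _ (hmemI true α (hA hα))).2
    rw [hUA α hα] at this; exact this
  have nearB : ∀ α ∈ B, nb x s (C • U' (false, α)) (C + C * C) ∧ ∀ β ∈ mis m n, |nc y s β (C • U' (false, α)) - nc x s β (W α)| ≤ ε * Kt := by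
    intro α hα
    have := nc_near (U := U (false, α)) hs hε0.le hε1 hC hxy (by rw [hUB α hα]; exact (hW α hα).2.2) (hU' _ (hmemI false α (hB hα))).2
    rw [hUB α hα] at this; exact this
  have cardD : ∀ A : Finset (Fin n → ℕ), A ⊆ mis m n → (A.card : ℝ) + 1 ≤ D := by
    intro A hA
    have : (A.card : ℝ) ≤ (mis m n).card := by exact_mod_cast Finset.card_le_card hA
    rw [hDdef]; unfold Dn; linarith
  -- first linear system
  have hPbs : nb y s0 (Pb - P) (D * (ε * C)) := (hPbP.up hε1 hε0.le (norm_nonneg _) hs0.le hxy0 hC0.le).shift (hxy0.trans (mul_le_of_le_one_left hs0.le hε1)) (by positivity)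
  obtain ⟨u, hu1, hu2⟩ := lin_sys A (fun β α => nc y s0 β (C • U' (true, α))) (by
      intro β hβ α hα
      have h1 := (nearA α hα).2 β (hA hβ)
      rw [(hV α hα).2.1 β hβ] at h1
      refine le_trans ?_ hεa
      exact mul_le_mul h1 (by linarith [cardD A hA]) (mul_nonneg zero_le_two (add_nonneg (Nat.cast_nonneg _) zero_le_one)) (mul_nonneg hε0.le (zero_le_one.trans hKt1))) (fun β => -nc y s0 β (Pb - P)) (D * (ε * C)) (by
      intro β hβ; rw [abs_neg]; exact (nb_iff hs0).1 hPbs β (hA hβ))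
  set H : Pm m n := ∑ α ∈ A, u α • (C • U' (true, α)) with hH
  have hHD : Dr (Γ l y C) Pb (1 / 2) H := by
    have := Dr.sum hconv hPb A u (fun α => C • U' (true, α)) (2 * D * C) (4 * D ^ 2 * C ^ 2 * ε) (1 / 4) (fun α hα => hDr true α (hA hα))
      (fun α hα => by
        calc |u α| * (2 * D * C) ≤ (2 * (D * (ε * C))) * (2 * D * C) := by gcongr; exact hu2 α hα
          _ = _ := by ring) (by norm_num)
    refine this.mono hconv ?_
    have h1 : (A.card : ℝ) * (4 * D ^ 2 * C ^ 2 * ε) ≤ D * (4 * D ^ 2 * C ^ 2 * ε) := by gcongr; linarith [cardD A hA]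
    nlinarith
  have hQ : Pb + (2:ℝ) • H ∈ Γ l y C := by
    have := hHD.2.1; norm_num at this; exact this
  have hP' : Pb + H = Pb + (1 / 2 : ℝ) • ((Pb + (2:ℝ) • H) - Pb) := by module
  have hmove : ∀ c U, Dr (Γ l y C) Pb c U → Dr (Γ l y C) (Pb + H) (2 * c) U := by
    intro c U h; rw [hP']; exact h.move hconv hQ (by norm_num) le_rfl
  have hPbH : Pb + H ∈ Γ l y C := by
    have := hHD.mono hconv (d := 1) (by norm_num)
    have := this.2.1; simpa using this
  refine ⟨Pb + H, ?_, ?_, hΓ.mono _ _ _ hCC' hPbH, ?_⟩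
  · apply VA_of hAm (x := y)
    intro β hβ
    rw [cf_nc hs0]
    have : nc y s0 β (Pb + H - P) = 0 := by
      have e : Pb + H - P = (Pb - P) + H := by abel
      rw [e, map_add, hH, map_sum]
      have := hu1 β hβ
      simp only [map_smul, smul_eq_mul] at this ⊢
      linarith
    rw [this, mul_zero]
  · have e : Pb + H - P = (Pb - P) + H := by abel
    rw [e]
    have h1 : nb x s0 (Pb - P) C := hPbP.scale (norm_nonneg _) (hxy0.trans (mul_le_of_le_one_left hs0.le hε1)) hC0.le
    have h2 : nb x s0 H (D * (2 * D * C * (C + C * C))) := by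
      rw [nb_iff hs0]
      intro β hβ
      rw [hH, map_sum]
      refine (Finset.abs_sum_le_sum_abs _ _).trans ?_
      have : ∀ α ∈ A, |nc x s0 β (u α • (C • U' (true, α)))| ≤ 2 * D * C * (C + C * C) := by
        intro α hα
        rw [map_smul, smul_eq_mul, abs_mul]
        refine mul_le_mul ((hu2 α hα).trans ?_) ((nb_iff hs0).1 (nearA α hα).1 β hβ) (abs_nonneg _) (by positivity)
        have : D * (ε * C) ≤ D * (1 * C) := by gcongr
        linarith
      refine (Finset.sum_le_card_nsmul _ _ _ this).trans ?_
      rw [nsmul_eq_mul]; gcongr; linarith [cardD A hA]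
    exact (h1.add h2).mono hs0.le (by linarith)
  · have hsol : ∀ α ∈ B, ∃ c : (Fin n → ℕ) → ℝ, (∀ β ∈ B, ∑ γ ∈ B, c γ * nc y s β (C • U' (false, γ)) = if β = α then 1 else 0) ∧ ∀ γ ∈ B, |c γ| ≤ 2 * 1 := by
      intro α hα
      refine lin_sys B (fun β γ => nc y s β (C • U' (false, γ))) ?_ (fun β => if β = α then 1 else 0) 1 ?_
      · intro β hβ γ hγ
        have h1 := (nearB γ hγ).2 β (hB hβ)
        rw [(hW γ hγ).2.1 β hβ] at h1
        refine le_trans ?_ hεa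
        exact mul_le_mul h1 (by linarith [cardD B hB]) (mul_nonneg zero_le_two (add_nonneg (Nat.cast_nonneg _) zero_le_one)) (mul_nonneg hε0.le (zero_le_one.trans hKt1))
      · intro β hβ; split_ifs <;> simp
    have hsol' : ∀ α, ∃ c : (Fin n → ℕ) → ℝ, α ∈ B → (∀ β ∈ B, ∑ γ ∈ B, c γ * nc y s β (C • U' (false, γ)) = if β = α then 1 else 0) ∧ ∀ γ ∈ B, |c γ| ≤ 2 * 1 := by
      intro α
      by_cases hα : α ∈ B
      · obtain ⟨c, hc⟩ := hsol α hα; exact ⟨c, fun _ => hc⟩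
      · exact ⟨0, fun h => absurd h hα⟩
    choose c hc using hsol'
    refine ⟨fun α => ∑ γ ∈ B, c α γ • (C • U' (false, γ)), fun α hα => ⟨?_, ?_, ?_⟩⟩
    · have := Dr.sum hconv hPbH B (c α) (fun γ => C • U' (false, γ)) (2 * (2 * D * C)) (2 * (4 * D * C)) 1 (fun γ hγ => hmove _ _ (hDr false γ (hB hγ)))
        (fun γ hγ => by
          calc |c α γ| * (2 * (2 * D * C)) ≤ (2 * 1) * (2 * (2 * D * C)) := by gcongr; exact (hc α hα).2 γ hγ
            _ = _ := by ring) (by norm_num)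
      refine (this.sub (hΓ.mono _ _ _ hCC')).mono (hΓ.conv _ _) ?_
      have h1 : (B.card : ℝ) * (2 * (4 * D * C)) ≤ D * (2 * (4 * D * C)) := by gcongr; linarith [cardD B hB]
      linarith
    · intro β hβ
      rw [map_sum]
      have := (hc α hα).1 β hβ
      simp only [map_smul, smul_eq_mul] at this ⊢
      exact this
    · intro β hβ
      rw [map_sum]
      refine (Finset.abs_sum_le_sum_abs _ _).trans ?_
      have : ∀ γ ∈ B, |nc y s β (c α γ • (C • U' (false, γ)))| ≤ 2 * (C + 1) := by
        intro γ hγ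
        rw [map_smul, smul_eq_mul, abs_mul]
        refine mul_le_mul (by simpa using (hc α hα).2 γ hγ) ?_ (abs_nonneg _) (by norm_num)
        have h1 := (nearB γ hγ).2 β hβ
        have h2 := (hW γ hγ).2.2 β hβ
        have h3 := abs_sub_abs_le_abs_sub (nc y s β (C • U' (false, γ))) (nc x s β (W γ))
        linarith
      refine (Finset.sum_le_card_nsmul _ _ _ this).trans ?_
      rw [nsmul_eq_mul]
      have : (B.card : ℝ) * (2 * (C + 1)) ≤ D * (2 * (C + 1)) := by gcongr; linarith [cardD B hB]
      linarith

end FP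

namespace FP
open scoped ContDiff Classical Topology
set_option linter.all false
variable {m n : ℕ}

lemma bump (m n : ℕ) (R : ℝ) (hR : 0 < R) : ∃ K : ℝ, 1 ≤ K ∧ ∀ (g : Euc n) (h : ℝ), 0 < h → ∃ ψ : Euc n → ℝ, ContDiff ℝ ∞ ψ ∧
    (∀ x, 0 ≤ ψ x ∧ ψ x ≤ 1 ∧ ∀ k ≤ m, ‖iteratedFDeriv ℝ k ψ x‖ * h ^ k ≤ K) ∧
    (∀ x, ‖x - g‖ ≤ R * h → ψ x = 1) ∧ ∀ x, (R + 1) * h ≤ ‖x - g‖ → ψ x = 0 := by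
  let b : ContDiffBump (0 : Euc n) := ⟨R, R + 1, hR, by linarith⟩
  have hbc : ContDiff ℝ ∞ b := b.contDiff
  have hbd : ∀ k : ℕ, ∃ K, ∀ x, ‖iteratedFDeriv ℝ k b x‖ ≤ K := by
    intro k
    have h1 : Continuous (iteratedFDeriv ℝ k b) := hbc.continuous_iteratedFDeriv (by exact_mod_cast le_top)
    have h2 : HasCompactSupport (iteratedFDeriv ℝ k b) := b.hasCompactSupport.iteratedFDeriv k
    exact h1.bounded_above_of_compact_support h2
  choose K hK using hbd
  refine ⟨1 + ∑ k ∈ Finset.range (m+1), |K k|, by linarith [Finset.sum_nonneg (fun k (_ : k ∈ Finset.range (m+1)) => abs_nonneg (K k))], ?_⟩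
  intro g h hh
  refine ⟨fun x => b (h⁻¹ • (x - g)), ?_, ?_, ?_, ?_⟩
  · exact hbc.comp ((contDiff_id.sub contDiff_const).const_smul (h⁻¹))
  · intro x
    refine ⟨b.nonneg, b.le_one, fun k hk => ?_⟩
    have e1 : iteratedFDeriv ℝ k (fun x => b (h⁻¹ • (x - g))) x = iteratedFDeriv ℝ k (fun x => b (h⁻¹ • x)) (x - g) :=
      iteratedFDeriv_comp_sub (f := fun x => b (h⁻¹ • x)) k g x
    have e2 := iteratedFDeriv_comp_const_smul (i := k) (h⁻¹) (hbc.of_le (by exact_mod_cast le_top) : ContDiff ℝ (k:ℕ∞) b)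
    rw [e1]
    have e3 := congrFun e2 (x - g)
    rw [e3, norm_smul, norm_pow, norm_inv, Real.norm_of_nonneg hh.le]
    have h1 : |K k| ≤ ∑ k ∈ Finset.range (m+1), |K k| := Finset.single_le_sum (f := fun k => |K k|) (fun k _ => abs_nonneg _) (Finset.mem_range.2 (Nat.lt_succ_of_le hk))
    have h2 := (hK k (h⁻¹ • (x - g))).trans (le_abs_self _)
    have h3 : (h⁻¹)^k * ‖iteratedFDeriv ℝ k b (h⁻¹ • (x - g))‖ * h^k = ‖iteratedFDeriv ℝ k b (h⁻¹ • (x - g))‖ := by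
      rw [inv_pow, mul_comm, ← mul_assoc, mul_inv_cancel₀ (pow_pos hh k).ne', one_mul]
    rw [h3]; linarith
  · intro x hx
    apply b.one_of_mem_closedBall
    rw [mem_closedBall_zero_iff, norm_smul, norm_inv, Real.norm_of_nonneg hh.le, inv_mul_le_iff₀ hh, mul_comm]
    exact hx
  · intro x hx
    apply b.zero_of_le_dist
    rw [dist_zero_right, norm_smul, norm_inv, Real.norm_of_nonneg hh.le, le_inv_mul_iff₀ hh, mul_comm]
    exact hx

lemma norm_le_card (v : Euc n) (t : ℝ) (h : ∀ i, |v i| ≤ t) : ‖v‖ ≤ n * t := by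
  by_cases hn : n = 0
  · subst hn
    have : v = 0 := Subsingleton.elim _ _
    simp [this]
  have ht : 0 ≤ t := (abs_nonneg _).trans (h ⟨0, Nat.pos_of_ne_zero hn⟩)
  rw [EuclideanSpace.norm_eq]
  apply Real.sqrt_le_iff.2 ⟨by positivity, ?_⟩
  have : ∑ i, ‖v i‖^2 ≤ ∑ i : Fin n, t^2 := Finset.sum_le_sum (fun i _ => by
    rw [Real.norm_eq_abs]; exact pow_le_pow_left₀ (abs_nonneg _) (h i) 2)
  refine this.trans ?_
  rw [Finset.sum_const, Finset.card_univ, Fintype.card_fin, nsmul_eq_mul, mul_pow]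
  have : (1:ℝ) ≤ n := by exact_mod_cast Nat.one_le_iff_ne_zero.2 hn
  have : (n:ℝ) ≤ n^2 := by nlinarith
  gcongr

/-- lattice point of a cell -/
def gp (c : ℝ) (q : ℤ × (Fin n → ℤ)) : Euc n := WithLp.toLp 2 (fun i => c * 2 ^ q.1 * (q.2 i : ℝ))

/-- cell of a point -/
def cell (c : ℝ) (r : Euc n → ℝ) (z : Euc n) : ℤ × (Fin n → ℤ) :=
  (Int.log 2 (r z), fun i => ⌊z i / (c * 2 ^ (Int.log 2 (r z)))⌋)

/-- partition constant -/
def pc (n : ℕ) : ℝ := 1 / (8 * (2 * n + 3))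

lemma pc_pos : 0 < pc n := by unfold pc; positivity

lemma cell_near (c : ℝ) (hc : 0 < c) (r : Euc n → ℝ) (z : Euc n) : ‖z - gp c (cell c r z)‖ ≤ n * (c * 2 ^ (cell c r z).1) := by
  apply norm_le_card
  intro i
  have h2 : (0:ℝ) < c * 2 ^ (cell c r z).1 := by positivity
  have e : (z - gp c (cell c r z)) i = z i - c * 2 ^ (cell c r z).1 * (⌊z i / (c * 2 ^ (cell c r z).1)⌋ : ℝ) := by
    simp [gp, cell]
  rw [e]
  have h3 := Int.floor_le (z i / (c * 2 ^ (cell c r z).1))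
  have h4 := Int.lt_floor_add_one (z i / (c * 2 ^ (cell c r z).1))
  rw [le_div_iff₀ h2] at h3
  rw [div_lt_iff₀ h2] at h4
  rw [abs_le]; constructor <;> nlinarith

lemma cell_scale (c : ℝ) (r : Euc n → ℝ) (z : Euc n) (hr : 0 < r z) : (2:ℝ) ^ (cell c r z).1 ≤ r z ∧ r z ≤ 2 * 2 ^ (cell c r z).1 := by
  have h1 := Int.zpow_log_le_self (b := 2) (by norm_num) hr
  have h2 := Int.lt_zpow_succ_log_self (b := 2) (by norm_num) (r z)
  push_cast at h1 h2
  rw [zpow_add₀ (by norm_num), zpow_one] at h2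
  exact ⟨h1, by simpa [cell, mul_comm] using h2.le⟩

/-- colour of a cell -/
def col (n : ℕ) (q : ℤ × (Fin n → ℤ)) : ZMod 2 × (Fin n → ZMod (2 * n + 7)) := (q.1, fun i => (q.2 i : ZMod (2*n+7)))

instance : NeZero (2 * n + 7) := ⟨by omega⟩

lemma gp_apply (c : ℝ) (q : ℤ × (Fin n → ℤ)) (i : Fin n) : gp c q i = c * 2 ^ q.1 * (q.2 i : ℝ) := rfl

lemma zeq (N : ℕ) (a b : ℤ) (h : (a : ZMod N) = b) (h' : |a - b| < N) : a = b := by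
  have := (ZMod.intCast_eq_intCast_iff_dvd_sub a b N).1 h
  have h2 := Int.eq_zero_of_abs_lt_dvd this (by rw [abs_sub_comm]; exact h')
  omega

lemma PU (m n : ℕ) : ∃ (N : ℕ) (K c0 : ℝ), 1 ≤ K ∧ 0 < c0 ∧ c0 ≤ 1 / 8 ∧
    ∀ (X : Set (Euc n)) (r : Euc n → ℝ), (∀ z ∈ X, 0 < r z) → (∀ z ∈ X, ∀ w ∈ X, r z ≤ r w + ‖z - w‖) →
    ∃ (Ψ : ℕ → Euc n → ℝ) (ctr : ℕ → Euc n → Euc n), ∀ w ∈ X,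
      (∀ j, ∃ θ : Euc n → ℝ, ContDiff ℝ ∞ θ ∧ (∀ z, 0 ≤ θ z ∧ θ z ≤ 1 ∧ ∀ k ≤ m, ‖iteratedFDeriv ℝ k θ z‖ * (r w) ^ k ≤ K) ∧
        ∀ z, ‖z - w‖ ≤ c0 * r w → Ψ j z = θ z) ∧
      (∀ j, (∀ z, ‖z - w‖ ≤ c0 * r w → Ψ j z = 0) ∨ ∃ q ∈ X, ∀ w' ∈ X, ‖w' - w‖ ≤ c0 * r w → ctr j w' = q ∧ ‖w' - q‖ ≤ r q / 4) ∧
      (∃ i < N, ∀ z, ‖z - w‖ ≤ c0 * r w → Ψ i z = 1) := by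
  obtain ⟨Kb, hKb, hbump⟩ := bump m n (n + 1) (by positivity)
  set c := pc n with hcdef
  have hc : 0 < c := pc_pos
  have hc8 : c * (2 * n + 3) = 1 / 8 := by rw [hcdef, pc]; field_simp
  have hn0 : (0:ℝ) ≤ n := Nat.cast_nonneg n
  have hcle : c ≤ 1 / 24 := by nlinarith
  let ι := ZMod 2 × (Fin n → ZMod (2 * n + 7))
  let e : ι ≃ Fin (Fintype.card ι) := Fintype.equivFin ι
  let cl : ℤ × (Fin n → ℤ) → ℕ := fun q => e (col n q)
  have hcl : ∀ q q', cl q = cl q' → col n q = col n q' := fun q q' h => e.injective (Fin.ext h)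
  have hpos : ∀ q : ℤ × (Fin n → ℤ), 0 < c * 2 ^ q.1 := fun q => by positivity
  choose ψ hψ1 hψ2 hψ3 hψ4 using fun q : ℤ × (Fin n → ℤ) => hbump (gp c q) (c * 2 ^ q.1) (hpos q)
  refine ⟨Fintype.card ι, Kb * (9 / (4 * c)) ^ m, c / 8, ?_, by positivity, by linarith, ?_⟩
  · refine one_le_mul_of_one_le_of_one_le hKb (one_le_pow₀ ?_)
    rw [le_div_iff₀ (by positivity)]; linarith
  intro X r hr hL
  let act : ℤ × (Fin n → ℤ) → Prop := fun q => ∃ z ∈ X, cell c r z = q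
  let near : ℤ × (Fin n → ℤ) → Euc n → Prop := fun q w => ‖w - gp c q‖ ≤ (n + 3) * (c * 2 ^ q.1)
  -- basic geometry
  have geo : ∀ z ∈ X, ∀ w ∈ X, near (cell c r z) w → ‖w - z‖ ≤ r z / 8 ∧ (7/8) * 2 ^ (cell c r z).1 ≤ r w ∧ r w ≤ (9/4) * 2 ^ (cell c r z).1 := by
    intro z hz w hw hnear
    have h1 := cell_near c hc r z
    have h2 := cell_scale c r z (hr z hz)
    have h3 : ‖w - z‖ ≤ ‖w - gp c (cell c r z)‖ + ‖z - gp c (cell c r z)‖ := by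
      have := norm_sub_le (w - gp c (cell c r z)) (z - gp c (cell c r z)); simpa using this
    have h4 : ‖w - gp c (cell c r z)‖ ≤ (n + 3) * (c * 2 ^ (cell c r z).1) := hnear
    have h5 : ‖w - z‖ ≤ (1/8) * 2 ^ (cell c r z).1 := by
      rw [← hc8]; nlinarith
    have h6 := hL z hz w hw
    have h7 := hL w hw z hz
    rw [norm_sub_rev] at h6
    refine ⟨?_, ?_, ?_⟩ <;> linarith [norm_nonneg (w - z)]
  have uniq : ∀ w ∈ X, ∀ q q', act q → act q' → near q w → near q' w → cl q = cl q' → q = q' := by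
    rintro w hw q q' ⟨z, hz, rfl⟩ ⟨z', hz', rfl⟩ h h' hcol
    have hcol := hcl _ _ hcol
    obtain ⟨-, g1, g2⟩ := geo z hz w hw h
    obtain ⟨-, g3, g4⟩ := geo z' hz' w hw h'
    set q := cell c r z
    set q' := cell c r z'
    have key : ∀ a b : ℤ, (7/8 : ℝ) * 2 ^ a ≤ (9/4) * 2 ^ b → a - b < 2 := by
      intro a b hab
      by_contra hcon
      have : b + 2 ≤ a := by omega
      have h1 : (2:ℝ) ^ (b + 2) ≤ 2 ^ a := zpow_le_zpow_right₀ (by norm_num) this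
      rw [zpow_add₀ (by norm_num)] at h1
      have h2 : (0:ℝ) < 2 ^ b := by positivity
      norm_num at h1
      linarith
    have k1 := key q.1 q'.1 (g1.trans g4)
    have k2 := key q'.1 q.1 (g3.trans g2)
    have hk : q.1 = q'.1 := zeq 2 _ _ (congrArg Prod.fst hcol) (by rw [abs_lt]; constructor <;> push_cast <;> omega)
    refine Prod.ext hk (funext fun i => ?_)
    apply zeq (2*n+7) _ _ (congrFun (congrArg Prod.snd hcol) i)
    have h0 : near q' w := h'
    have h1 : near q w := h
    simp only [near] at h0 h1
    have h2 : ‖gp c q - gp c q'‖ ≤ 2 * ((n + 3) * (c * 2 ^ q.1)) := by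
      have := norm_sub_le (w - gp c q') (w - gp c q)
      rw [sub_sub_sub_cancel_left] at this
      rw [← hk] at h0
      linarith
    have h3 := (PiLp.norm_apply_le (gp c q - gp c q') i).trans h2
    rw [PiLp.sub_apply, gp_apply, gp_apply, ← hk, ← mul_sub, norm_mul, Real.norm_of_nonneg (hpos q).le, Real.norm_eq_abs] at h3
    have h4 : |(q.2 i : ℝ) - q'.2 i| ≤ 2 * (n + 3) := by
      have hp := hpos q
      by_contra hcon
      push Not at hcon
      nlinarith
    have h5 : |q.2 i - q'.2 i| ≤ 2 * (n+3) := by exact_mod_cast h4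
    push_cast; omega
  have nearOf : ∀ w ∈ X, ∀ q, act q → ∀ x, ‖x - w‖ ≤ c / 8 * r w → ψ q x ≠ 0 → near q w ∧ ∀ w' ∈ X, ‖w' - w‖ ≤ c / 8 * r w → near q w' := by
    rintro w hw q ⟨z, hz, rfl⟩ x hx hne
    have h1 := cell_near c hc r z
    have h2 := cell_scale c r z (hr z hz)
    have h3 : ‖x - gp c (cell c r z)‖ < (n + 1 + 1) * (c * 2 ^ (cell c r z).1) := by
      by_contra hcon
      exact hne (hψ4 _ x (not_lt.1 hcon))
    have h4 := hL w hw z hz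
    have h5 : ‖w - z‖ ≤ ‖x - w‖ + ‖x - gp c (cell c r z)‖ + ‖z - gp c (cell c r z)‖ := by
      have a1 := norm_sub_le (x - gp c (cell c r z)) (x - w)
      rw [sub_sub_sub_cancel_left] at a1
      have a2 := norm_sub_le (w - gp c (cell c r z)) (z - gp c (cell c r z))
      rw [sub_sub_sub_cancel_right] at a2
      linarith
    set k2 : ℝ := 2 ^ (cell c r z).1 with hk2
    have hk0 : 0 < k2 := by positivity
    have h6 : r w ≤ 2 * k2 + ‖x - w‖ + (1/8) * k2 := by
      have : (n + 1 + 1) * (c * k2) + n * (c * k2) ≤ (1/8) * k2 := by rw [← hc8]; nlinarith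
      linarith
    have hw0 := hr w hw
    have h7 : ‖x - w‖ ≤ (1/8) * r w := hx.trans (by gcongr; linarith)
    have h8 : r w ≤ (9/4 + 1/2) * k2 := by linarith
    have h9 : c / 8 * r w ≤ c * k2 / 2 := by nlinarith
    have nn : ∀ w', ‖x - w'‖ ≤ c * k2 → near (cell c r z) w' := by
      intro w' hw'
      show ‖w' - gp c (cell c r z)‖ ≤ (n + 3) * (c * k2)
      have a1 := norm_sub_le (x - gp c (cell c r z)) (x - w')
      rw [sub_sub_sub_cancel_left] at a1
      linarith
    have hck : 0 < c * k2 := by positivity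
    refine ⟨nn w (by linarith), fun w' _ hw' => nn w' ?_⟩
    have a1 := norm_sub_le (x - w) (w' - w)
    rw [sub_sub_sub_cancel_right] at a1
    linarith
  let rep : ℤ × (Fin n → ℤ) → Euc n := fun q => if h : act q then h.choose else 0
  have hrep : ∀ q, act q → rep q ∈ X ∧ cell c r (rep q) = q := fun q h => by
    simp only [rep, dif_pos h]; exact h.choose_spec
  let Ψ : ℕ → Euc n → ℝ := fun j x => if h : ∃ q, act q ∧ cl q = j ∧ ψ q x ≠ 0 then ψ h.choose x else 0
  let ctr : ℕ → Euc n → Euc n := fun j w => if h : ∃ q, act q ∧ cl q = j ∧ near q w then rep h.choose else w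
  have hΨ : ∀ w ∈ X, ∀ q, act q → near q w → ∀ x, ‖x - w‖ ≤ c / 8 * r w → Ψ (cl q) x = ψ q x := by
    intro w hw q hq hn x hx
    simp only [Ψ]
    split_ifs with h
    · obtain ⟨s1, s2, s3⟩ := h.choose_spec
      rw [uniq w hw _ q s1 hq (nearOf w hw _ s1 x hx s3).1 hn s2]
    · push Not at h
      exact (h q hq rfl).symm
  refine ⟨Ψ, ctr, fun w hw => ⟨fun j => ?_, fun j => ?_, ?_⟩⟩
  · by_cases h : ∃ q, act q ∧ cl q = j ∧ near q w
    · obtain ⟨q, hq, rfl, hn⟩ := h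
      refine ⟨ψ q, hψ1 q, fun z => ⟨(hψ2 q z).1, (hψ2 q z).2.1, fun k hk => ?_⟩, fun z hz => hΨ w hw q hq hn z hz⟩
      have h1 := (hψ2 q z).2.2 k hk
      obtain ⟨z0, hz0, rfl⟩ := hq
      obtain ⟨-, -, g2⟩ := geo z0 hz0 w hw hn
      have hw0 := hr w hw
      have h2 : r w ≤ (9 / (4 * c)) * (c * 2 ^ (cell c r z0).1) := by
        refine g2.trans (le_of_eq ?_); field_simp
      have hB : (1:ℝ) ≤ 9 / (4 * c) := by rw [le_div_iff₀ (by positivity)]; linarith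
      calc ‖iteratedFDeriv ℝ k (ψ (cell c r z0)) z‖ * r w ^ k ≤ ‖iteratedFDeriv ℝ k (ψ (cell c r z0)) z‖ * ((9 / (4 * c)) * (c * 2 ^ (cell c r z0).1)) ^ k := by gcongr
        _ = (‖iteratedFDeriv ℝ k (ψ (cell c r z0)) z‖ * (c * 2 ^ (cell c r z0).1) ^ k) * (9 / (4 * c)) ^ k := by rw [mul_pow]; ring
        _ ≤ Kb * (9 / (4 * c)) ^ m := by
          refine mul_le_mul h1 (pow_le_pow_right₀ hB hk) (by positivity) (by linarith)
    · refine ⟨fun _ => 0, contDiff_const, fun z => ⟨le_rfl, zero_le_one, fun k hk => ?_⟩, fun z hz => ?_⟩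
      · have : iteratedFDeriv ℝ k (fun _ : Euc n => (0:ℝ)) z = 0 := by
          simp
        rw [this, norm_zero, zero_mul]; positivity
      · simp only [Ψ]
        rw [dif_neg]
        rintro ⟨q, hq, hj, hne⟩
        exact h ⟨q, hq, hj, (nearOf w hw q hq z hz hne).1⟩
  · by_cases h : ∃ x, ‖x - w‖ ≤ c / 8 * r w ∧ Ψ j x ≠ 0
    · right
      obtain ⟨x, hx, hne⟩ := h
      have hex : ∃ q, act q ∧ cl q = j ∧ ψ q x ≠ 0 := by
        by_contra hcon
        exact hne (by simp only [Ψ, dif_neg hcon])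
      obtain ⟨q, hq, hj, hne'⟩ := hex
      refine ⟨rep q, (hrep q hq).1, fun w' hw' hd => ?_⟩
      have hn := (nearOf w hw q hq x hx hne').2 w' hw' hd
      have hex2 : ∃ q, act q ∧ cl q = j ∧ near q w' := ⟨q, hq, hj, hn⟩
      have e1 : ctr j w' = rep q := by
        simp only [ctr, dif_pos hex2]
        obtain ⟨s1, s2, s3⟩ := hex2.choose_spec
        rw [uniq w' hw' _ q s1 hq s3 hn (s2.trans hj.symm)]
      refine ⟨e1, ?_⟩
      obtain ⟨t1, t2⟩ := hrep q hq
      have := (geo (rep q) t1 w' hw' (by rw [t2]; exact hn)).1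
      linarith [hr _ t1]
    · left; push Not at h; exact h
  · have hq : act (cell c r w) := ⟨w, hw, rfl⟩
    have hnear : near (cell c r w) w := (cell_near c hc r w).trans (by have := hpos (cell c r w); gcongr; linarith)
    refine ⟨cl (cell c r w), (e _).2, fun z hz => ?_⟩
    rw [hΨ w hw _ hq hnear z hz]
    apply hψ3
    have h2 := (cell_scale c r w (hr w hw)).2
    have h3 := cell_near c hc r w
    have a1 := norm_add_le (z - w) (w - gp c (cell c r w))
    rw [sub_add_sub_cancel] at a1
    have : c / 8 * r w ≤ c * 2 ^ (cell c r w).1 := by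
      have := hpos (cell c r w)
      nlinarith
    nlinarith
end FP

namespace FP
open scoped ContDiff Classical Topology
set_option linter.all false
variable {m n : ℕ}

lemma Adm_of {θ : Euc n → ℝ} {w : Euc n} {r K : ℝ} (hK : 1 ≤ K) (hr : 0 < r) (h1 : ContDiff ℝ ∞ θ)
    (h2 : ∀ z, 0 ≤ θ z ∧ θ z ≤ 1 ∧ ∀ k ≤ m, ‖iteratedFDeriv ℝ k θ z‖ * r ^ k ≤ K) : Adm m θ w (r / K) := by
  have hK0 : 0 < K := by linarith
  refine ⟨h1.of_le (by exact_mod_cast le_top), fun z _ => ⟨(h2 z).1, (h2 z).2.1, fun k hk => ?_⟩⟩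
  by_cases hk0 : k = 0
  · subst hk0
    rw [norm_iteratedFDeriv_zero, pow_zero, mul_one, Real.norm_of_nonneg (h2 z).1]
    exact (h2 z).2.1
  · rw [div_pow, ← mul_div_assoc, div_le_one (by positivity)]
    refine ((h2 z).2.2 k hk).trans ?_
    calc K = K ^ 1 := (pow_one K).symm
      _ ≤ K ^ k := pow_le_pow_right₀ hK (Nat.one_le_iff_ne_zero.2 hk0)

lemma ev_of_ball {f g : Euc n → ℝ} {w w' : Euc n} {a b : ℝ} (h : ∀ z, ‖z - w‖ ≤ b → f z = g z) (hw : ‖w' - w‖ ≤ a) (hab : a < b) :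
    f =ᶠ[𝓝 w'] g := by
  have : Metric.ball w' (b - a) ∈ 𝓝 w' := Metric.ball_mem_nhds _ (by linarith)
  filter_upwards [this] with z hz
  apply h
  rw [Metric.mem_ball, dist_eq_norm] at hz
  have := norm_add_le (z - w') (w' - w)
  rw [sub_add_sub_cancel] at this
  linarith

lemma glue (Cw C : ℝ) (hC : 1 ≤ C) : ∃ C', C ≤ C' ∧ ∀ (X : Set (Euc n)) (Γ : Euc n → ℝ → Set (Pm m n)) (r : Euc n → ℝ) (R : Euc n → Pm m n)
    (loc : Euc n → Euc n → Pm m n), SF Γ Cw → (∀ z ∈ X, 0 < r z ∧ r z ≤ 1) → (∀ z ∈ X, ∀ w ∈ X, r z ≤ r w + ‖z - w‖) →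
    (∀ z ∈ X, R z ∈ Γ z C) →
    (∀ z ∈ X, ∀ w ∈ X, ‖w - z‖ ≤ r z → loc z w ∈ Γ w C ∧ nb w (r z) (loc z w - R z) C) →
    (∀ z ∈ X, ∀ w ∈ X, ∀ w' ∈ X, ‖w - z‖ ≤ r z → ‖w' - z‖ ≤ r z → nb w ‖w - w'‖ (loc z w - loc z w') C) →
    (∀ z ∈ X, ∀ z' ∈ X, nb z (r z + ‖z - z'‖) (R z - R z') C) →
    ∃ p : Euc n → Pm m n, ∀ w ∈ X, p w ∈ Γ w C' ∧ nb w (r w) (p w - R w) C' ∧ ∀ w' ∈ X, nb w ‖w - w'‖ (p w - p w') C' := by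
  obtain ⟨N, K, c0, hK, hc0, hc08, hPU⟩ := PU m n
  have hK0 : 0 < K := by linarith
  have k5 := K5_one (m := m) (n := n)
  have k6 := K6_one (m := m) (n := n)
  have hD := Dn_one (m := m) (n := n)
  set c1 : ℝ := c0 / (4 * K) with hc1
  have hc10 : 0 < c1 := by positivity
  have hc1c0 : c1 < c0 := by
    rw [hc1, div_lt_iff₀ (by positivity)]; nlinarith
  have hc1K : c1 ≤ 1 / K / 4 := by
    rw [hc1, div_div, mul_comm K 4]; gcongr; linarith
  let M1 : ℝ → ℝ := fun G => K ^ m * (2 * (2 ^ m * C) + G)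
  let gs : ℕ → ℝ := fun j => Nat.rec C (fun _ G => G + C + |Cw| * M1 G + K5 m n * M1 G + (2 * K6 m n + 1) * M1 G) j
  have gs0 : gs 0 = C := rfl
  have gsS : ∀ j, gs (j+1) = gs j + C + |Cw| * M1 (gs j) + K5 m n * M1 (gs j) + (2 * K6 m n + 1) * M1 (gs j) := fun j => rfl
  have hKm : 1 ≤ K ^ m := one_le_pow₀ hK
  have h2m : (1:ℝ) ≤ 2 ^ m := one_le_pow₀ (by norm_num)
  have hM1 : ∀ G, C ≤ G → G ≤ M1 G ∧ C ≤ M1 G := by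
    intro G hG
    have h1 : 0 ≤ 2 ^ m * C := by positivity
    have h2 : 2 * (2 ^ m * C) + G ≤ M1 G := le_mul_of_one_le_left (by linarith) hKm
    constructor <;> linarith
  have hgsC : ∀ j, C ≤ gs j := by
    intro j
    induction j with
    | zero => exact le_rfl
    | succ j ih =>
      rw [gsS]
      have := (hM1 _ ih).2
      have h1 : 0 ≤ |Cw| * M1 (gs j) := mul_nonneg (abs_nonneg _) (by linarith)
      have h2 : 0 ≤ K5 m n * M1 (gs j) := mul_nonneg (by linarith) (by linarith)
      have h3 : 0 ≤ (2 * K6 m n + 1) * M1 (gs j) := mul_nonneg (by linarith) (by linarith)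
      linarith
  set κ : ℝ := 1 / c1 + 1 with hκ
  have hκ1 : 1 ≤ κ := by rw [hκ]; have : 0 < 1 / c1 := by positivity
                         linarith
  have hκm : 1 ≤ κ ^ m := one_le_pow₀ hκ1
  set G := gs N with hG
  have hGC : C ≤ G := hgsC N
  refine ⟨κ ^ m * G + κ ^ m * C + Dn m n * (κ ^ m * G) , ?_, ?_⟩
  · have : G ≤ κ ^ m * G := le_mul_of_one_le_left (by linarith) hκm
    have h2 : 0 ≤ κ ^ m * C := by positivity
    have h3 : 0 ≤ Dn m n * (κ ^ m * G) := mul_nonneg (by linarith) (by linarith)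
    linarith
  intro X Γ r R loc hΓ hr hL hR hloc hlc hH
  have hCw : 1 ≤ Cw := hΓ.one
  rw [abs_of_nonneg (by linarith : 0 ≤ Cw)] at gsS
  obtain ⟨Ψ, ctr, hΨ⟩ := hPU X r (fun z hz => (hr z hz).1) hL
  let p : ℕ → Euc n → Pm m n := fun j => Nat.rec R (fun j pj w => bl w (Ψ j) (loc (ctr j w) w) (pj w)) j
  have pS : ∀ j w, p (j+1) w = bl w (Ψ j) (loc (ctr j w) w) (p j w) := fun j w => rfl
  have inv : ∀ j, ∀ w ∈ X, p j w ∈ Γ w (gs j) ∧ nb w (r w) (p j w - R w) (gs j) ∧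
      ∀ w' ∈ X, w ≠ w' → ‖w - w'‖ ≤ c1 * r w → (∃ i < j, ∀ z, ‖z - w‖ ≤ c0 * r w → Ψ i z = 1) → nb w ‖w - w'‖ (p j w - p j w') (gs j) := by
    intro j
    induction j with
    | zero =>
      intro w hw
      refine ⟨hR w hw, ?_, ?_⟩
      · have : p 0 w - R w = 0 := sub_self _
        rw [this]; exact nb_zero (hr w hw).1.le (by rw [gs0]; linarith)
      · rintro w' _ _ _ ⟨i, hi, _⟩; omega
    | succ j ih =>
      intro w hw
      obtain ⟨i1, i2, i3⟩ := ih w hw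
      obtain ⟨hr0, hr1⟩ := hr w hw
      obtain ⟨t1, t2, -⟩ := hΨ w hw
      have hgj := hgsC j
      obtain ⟨hm1, hm2⟩ := hM1 _ hgj
      set G := gs j
      set M := M1 G with hM
      have hM0 : 1 ≤ M := by linarith
      have z1 : 0 ≤ Cw * M := by positivity
      have z2 : 0 ≤ K5 m n * M := mul_nonneg (by linarith) (by linarith)
      have z3 : 0 ≤ (2 * K6 m n + 1) * M := mul_nonneg (by linarith) (by linarith)
      have hcr : c1 * r w < c0 * r w := by gcongr
      have hcr' : (0:ℝ) < c0 * r w := by positivity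
      rcases t2 j with h0 | ⟨q, hq, hqq⟩
      · have hz : ∀ w', ‖w - w'‖ ≤ c1 * r w → p (j+1) w' = p j w' := by
          intro w' hw'
          rw [pS]
          exact bl_zero (ev_of_ball (g := 0) (by simpa using h0) (by rw [norm_sub_rev]; exact hw') hcr) _ _
        have hzw := hz w (by simp; positivity)
        refine ⟨?_, ?_, ?_⟩
        · rw [hzw]; refine hΓ.mono _ _ _ ?_ i1
          rw [gsS]; linarith
        · rw [hzw]; refine i2.mono hr0.le ?_
          rw [gsS]; linarith
        · rintro w' hw' hne hd ⟨i, hi, h1⟩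
          have hij : i < j := by
            rcases Nat.lt_succ_iff_lt_or_eq.1 hi with h | h
            · exact h
            · subst h
              have a := h0 w (by simp; positivity)
              have b := h1 w (by simp; positivity)
              rw [a] at b; exact absurd b zero_ne_one
          rw [hzw, hz w' hd]
          refine (i3 w' hw' hne hd ⟨i, hij, h1⟩).mono (norm_nonneg _) ?_
          rw [gsS]; linarith
      · obtain ⟨e1, e2⟩ := hqq w hw (by simp; positivity)
        obtain ⟨hq0, hq1⟩ := hr q hq
        have hl := hloc q hq w hw (by linarith)
        have g1 := hL q hq w hw
        rw [norm_sub_rev] at g1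
        obtain ⟨θ, θ1, θ2, θ3⟩ := t1 j
        have hAdm : Adm m θ w (r w / K) := Adm_of hK hr0 θ1 θ2
        have a1 : nb w (r w) (loc q w - R q) (2 ^ m * C) := hl.2.down (by norm_num) hq0.le hr0.le (by linarith) (by linarith)
        have a2 : nb w (r w) (R w - R q) (2 ^ m * C) := (hH w hw q hq).down (by norm_num) (by positivity) hr0.le (by linarith) (by linarith)
        have a3 : nb w (r w) (loc q w - p j w) (2 * (2 ^ m * C) + G) := ((a1.tri (nb_comm a2)).tri (nb_comm i2)).mono hr0.le (by linarith)
        have hδ0 : 0 < r w / K := by positivity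
        have hδ1 : r w / K ≤ r w := div_le_self hr0.le hK
        have a4 : nb w (r w / K) (loc q w - p j w) M := a3.down hK hr0.le hδ0.le (by rw [mul_div_cancel₀ _ hK0.ne']) (add_nonneg (by positivity) (by linarith))
        have ebl : ∀ w', ‖w - w'‖ ≤ c1 * r w → ∀ P Q : Pm m n, bl w' (Ψ j) P Q = bl w' θ P Q := fun w' hw' P Q =>
          bl_congr (ev_of_ball θ3 (by rw [norm_sub_rev]; exact hw') hcr) _ _
        have hww : ‖w - w‖ ≤ c1 * r w := by simp; positivity
        have ew : p (j+1) w = bl w θ (loc q w) (p j w) := by rw [pS, ebl w hww, e1]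
        refine ⟨?_, ?_, ?_⟩
        · rw [ew]
          refine hΓ.mono _ _ _ ?_ (hΓ.blend w M (r w / K) θ _ _ hM0 hδ0 (by linarith) (hΓ.mono _ _ _ hm2 hl.1) (hΓ.mono _ _ _ hm1 i1) a4 hAdm)
          rw [gsS]; linarith
        · rw [ew]
          have a5 := (nb_bl hAdm hδ0 (by linarith) a4).scale hδ0.le hδ1 z2
          refine (a5.tri i2).mono hr0.le ?_
          rw [gsS]; linarith
        · rintro w' hw' hne hd ⟨i, hi, h1⟩
          obtain ⟨e1', e2'⟩ := hqq w' hw' (by rw [norm_sub_rev]; linarith)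
          have ew' : p (j+1) w' = bl w' θ (loc q w') (p j w') := by rw [pS, ebl w' hd, e1']
          have hlc' := hlc q hq w hw w' hw' (by linarith) (by linarith)
          rcases Nat.lt_succ_iff_lt_or_eq.1 hi with h | h
          · have a6 := i3 w' hw' hne hd ⟨i, h, h1⟩
            rw [ew, ew']
            have hd' : ‖w - w'‖ ≤ r w / K / 4 := by
              refine hd.trans ?_
              calc c1 * r w ≤ (1 / K / 4) * r w := by gcongr
                _ = r w / K / 4 := by ring
            have := A6bl hAdm hδ0 hne hd' (by linarith) a4 (hlc'.mono (norm_nonneg _) hm2) (a6.mono (norm_nonneg _) hm1)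
            refine this.mono (norm_nonneg _) ?_
            rw [gsS]; linarith
          · subst h
            have f1 : p (i+1) w = loc q w := by
              rw [pS, e1]; exact bl_one (ev_of_ball (g := 1) (by simpa using h1) (by rw [norm_sub_rev]; exact hww) hcr) _ _
            have f2 : p (i+1) w' = loc q w' := by
              rw [pS, e1']; exact bl_one (ev_of_ball (g := 1) (by simpa using h1) (by rw [norm_sub_rev]; exact hd) hcr) _ _
            rw [f1, f2]
            refine hlc'.mono (norm_nonneg _) ?_
            rw [gsS]; linarith
  have y1 : G ≤ κ ^ m * G := le_mul_of_one_le_left (by linarith) hκm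
  have y2 : 0 ≤ κ ^ m * C := by positivity
  have y3 : 0 ≤ Dn m n * (κ ^ m * G) := mul_nonneg (by linarith) (by linarith)
  refine ⟨p N, fun w hw => ?_⟩
  obtain ⟨i1, i2, i3⟩ := inv N w hw
  obtain ⟨hr0, hr1⟩ := hr w hw
  refine ⟨hΓ.mono _ _ _ (by linarith) i1, i2.mono hr0.le (by linarith), fun w' hw' => ?_⟩
  by_cases hne : w = w'
  · subst hne; rw [sub_self (p N w)]; exact nb_zero (norm_nonneg _) (by linarith)
  by_cases hd : ‖w - w'‖ ≤ c1 * r w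
  · exact (i3 w' hw' hne hd (hΨ w hw).2.2).mono (norm_nonneg _) (by linarith)
  · push Not at hd
    obtain ⟨j1, j2, -⟩ := inv N w' hw'
    have hrw : r w ≤ (1 / c1) * ‖w - w'‖ := by
      rw [one_div, le_inv_mul_iff₀ hc10]; exact hd.le
    have hd0 := norm_nonneg (w - w')
    have hκd : κ * ‖w - w'‖ = (1 / c1) * ‖w - w'‖ + ‖w - w'‖ := by rw [hκ]; ring
    have b1 := i2.down hκ1 hr0.le hd0 (by linarith) (by linarith)
    have b2 := (hH w hw w' hw').down hκ1 (by positivity) hd0 (by linarith) (by linarith)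
    have hL' := hL w' hw' w hw
    rw [norm_sub_rev] at hL'
    have b3 := (j2.down hκ1 (hr w' hw').1.le hd0 (by linarith) (by linarith)).shift (y := w) (by rw [norm_sub_rev]) (by linarith)
    exact (b1.tri b2).tri (nb_comm b3)
end FP

namespace FP
open scoped ContDiff Classical Topology
set_option linter.all false
variable {m n : ℕ}

lemma VA.add {A : Finset (Fin n → ℕ)} {P Q : Pm m n} (h : VA A P) (h' : VA A Q) : VA A (P + Q) := fun y α hα => by
  rw [map_add, h y α hα, h' y α hα, add_zero]

lemma VA.smul {A : Finset (Fin n → ℕ)} {P : Pm m n} (h : VA A P) (c : ℝ) : VA A (c • P) := fun y α hα => by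
  rw [map_smul, h y α hα, smul_zero]

lemma VA.neg {A : Finset (Fin n → ℕ)} {P : Pm m n} (h : VA A P) : VA A (-P) := fun y α hα => by
  rw [map_neg, h y α hα, neg_zero]

lemma VA.comm {A : Finset (Fin n → ℕ)} {P Q : Pm m n} (h : VA A (P - Q)) : VA A (Q - P) := by
  rw [← neg_sub]; exact h.neg

lemma VA.tri {A : Finset (Fin n → ℕ)} {P Q R : Pm m n} (h : VA A (P - Q)) (h' : VA A (Q - R)) : VA A (P - R) := by
  have := h.add h'; rwa [sub_add_sub_cancel] at this

lemma mid {Γ : Euc n → ℝ → Set (Pm m n)} {Cw C s : ℝ} {x : Euc n} {T Q : Pm m n} {A : Finset (Fin n → ℕ)} (hΓ : SF Γ Cw) (hC : 1 ≤ C)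
    (hA : A ⊆ mis m n) (hs : 0 < s) (h : WB Γ x T A s C) (hQ : Q ∈ Γ x C) (hV : VA A (Q - T)) :
    nb x s (Q - T) 2 ∨ ∃ t : ℝ, 0 ≤ t ∧ t ≤ 1 / 2 ∧ nb x s (t • (Q - T)) 1 ∧
      ∃ β ∈ mis m n, β ∉ A ∧ WB Γ x (T + t • (Q - T)) (nl A β) s (2 * C + 2 * C * (2 * C)) := by
  by_cases hn : nb x s (Q - T) 2
  · exact Or.inl hn
  right
  rw [nb_iff hs] at hn
  push Not at hn
  obtain ⟨β0, hβ0, hb0⟩ := hn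
  obtain ⟨β, hβ, hmax⟩ := Finset.exists_max_image (mis m n) (fun β => |nc x s β (Q - T)|) ⟨β0, hβ0⟩
  set v := nc x s β (Q - T) with hv
  have hμ : 2 < |v| := hb0.trans_le (hmax β0 hβ0)
  have hμ0 : 0 < |v| := by linarith
  have hv0 : v ≠ 0 := abs_pos.1 hμ0
  set t := |v|⁻¹ with ht
  have ht0 : 0 < t := inv_pos.2 hμ0
  have ht2 : t ≤ 1 / 2 := by rw [ht, one_div]; exact inv_anti₀ (by norm_num) hμ.le
  have hT : T ∈ Γ x C := h.1
  have hconv := hΓ.conv x C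
  have hncA : ∀ α ∈ A, nc x s α (Q - T) = 0 := fun α hα => by rw [nc_def, hV x α hα, mul_zero]
  have hβA : β ∉ A := fun hA => hv0 (hncA β hA)
  have hb1 : ∀ γ ∈ mis m n, |nc x s γ (t • (Q - T))| ≤ 1 := by
    intro γ hγ
    rw [map_smul, smul_eq_mul, abs_mul, abs_of_pos ht0, ht, inv_mul_le_iff₀ hμ0, mul_one]
    exact hmax γ hγ
  refine ⟨t, ht0.le, ht2, (nb_iff hs).2 hb1, β, hβ, hβA, ?_⟩
  have hmv := h.move hΓ (by linarith) hQ ht0.le ht2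
  have seg : ∀ u : ℝ, 0 ≤ u → u ≤ 1 → T + u • (Q - T) ∈ Γ x C := fun u h0 h1 => hconv.add_smul_sub_mem hT hQ ⟨h0, h1⟩
  set P := T + t • (Q - T) with hP
  -- W = sign * t (Q - T)
  set σ : ℝ := v * t with hσ
  have hσ1 : |σ| = 1 := by rw [hσ, abs_mul, abs_of_pos ht0, ht, mul_inv_cancel₀ hμ0.ne']
  have hσ2 : σ * σ = 1 := by
    have := abs_mul_abs_self σ; rw [hσ1] at this; linarith
  have hDr : Dr (Γ x C) P 1 (t • (Q - T)) := by
    refine ⟨one_pos, ?_, ?_⟩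
    · have := seg (2 * t) (by linarith) (by linarith)
      convert this using 1; rw [hP]; module
    · convert hT using 1; rw [hP]; module
  have hDr2 := (hDr.smul hconv (a := σ) (d := 2 * C) (by linarith) (by rw [hσ1]; linarith)).sub (hΓ.mono x C (2 * C) (by linarith))
  have hsum := hmv.al hΓ (by linarith) hA hβ hDr2 ?_ ?_ ?_
  · exact hsum
  · rw [map_smul, map_smul, smul_eq_mul, smul_eq_mul, ← hv, mul_comm t v, ← hσ, hσ2]
  · intro γ hγ
    rw [map_smul, smul_eq_mul, abs_mul, hσ1, one_mul]
    exact (hb1 γ hγ).trans (by linarith)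
  · intro α hα _
    rw [map_smul, map_smul, hncA α hα, smul_zero, smul_zero]

lemma radius (E0 : Finset (Euc n)) (Good : Euc n → ℝ → Prop) (δ : ℝ) (hδ : 0 < δ)
    (hanti : ∀ z ∈ E0, ∀ t t', Good z t → 0 < t' → t' ≤ t → Good z t') (hex : ∀ z ∈ E0, ∃ t > 0, Good z t) :
    ∃ r : Euc n → ℝ, (∀ z ∈ E0, 0 < r z ∧ r z ≤ δ ∧ Good z (r z / 2) ∧ (2 * r z ≤ δ → ∃ w ∈ E0, ‖w - z‖ ≤ r z ∧ ¬ Good w (2 * r z))) ∧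
      ∀ z ∈ E0, ∀ w ∈ E0, r z ≤ r w + ‖z - w‖ := by
  by_cases hne : E0.Nonempty
  swap
  · rw [Finset.not_nonempty_iff_eq_empty] at hne
    subst hne
    exact ⟨fun _ => 1, by simp, by simp⟩
  let S : Euc n → Set ℝ := fun z => {t | 0 < t ∧ t ≤ δ ∧ Good z t}
  let g : Euc n → ℝ := fun z => sSup (S z)
  have hbdd : ∀ z, BddAbove (S z) := fun z => ⟨δ, fun t ht => ht.2.1⟩
  have hSne : ∀ z ∈ E0, (S z).Nonempty := fun z hz => by
    obtain ⟨t, ht, hg⟩ := hex z hz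
    exact ⟨min t δ, lt_min ht hδ, min_le_right _ _, hanti z hz t _ hg (lt_min ht hδ) (min_le_left _ _)⟩
  have hg0 : ∀ z ∈ E0, 0 < g z := fun z hz => by
    obtain ⟨t, ht⟩ := hSne z hz
    exact ht.1.trans_le (le_csSup (hbdd z) ht)
  have hgδ : ∀ z ∈ E0, g z ≤ δ := fun z hz => csSup_le (hSne z hz) (fun t ht => ht.2.1)
  let r : Euc n → ℝ := fun z => E0.inf' hne (fun w => g w + ‖w - z‖)
  have hrle : ∀ z, ∀ w ∈ E0, r z ≤ g w + ‖w - z‖ := fun z w hw => Finset.inf'_le _ hw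
  have hrat : ∀ z, ∃ w ∈ E0, r z = g w + ‖w - z‖ := fun z => Finset.exists_mem_eq_inf' hne _
  have hrg : ∀ z ∈ E0, r z ≤ g z := fun z hz => by simpa using hrle z z hz
  refine ⟨r, fun z hz => ?_, fun z hz w hw => ?_⟩
  · obtain ⟨w, hw, hrw⟩ := hrat z
    have hr0 : 0 < r z := by rw [hrw]; have := hg0 w hw; positivity
    refine ⟨hr0, (hrg z hz).trans (hgδ z hz), ?_, fun h2 => ⟨w, hw, ?_, fun hG => ?_⟩⟩
    · have : r z / 2 < g z := by have := hrg z hz; linarith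
      obtain ⟨t, ht, hlt⟩ := exists_lt_of_lt_csSup (hSne z hz) this
      exact hanti z hz t _ ht.2.2 (by linarith) hlt.le
    · have := hg0 w hw; linarith
    · have : 2 * r z ≤ g w := le_csSup (hbdd w) ⟨by linarith, h2, hG⟩
      have := norm_nonneg (w - z); linarith
  · obtain ⟨u, hu, hru⟩ := hrat w
    have h1 := hrle z u hu
    have h2 := norm_add_le (u - w) (w - z)
    rw [sub_add_sub_cancel, norm_sub_rev w z] at h2
    linarith

lemma Tcmp (Cw CB : ℝ) (hCB : 1 ≤ CB) : ∃ Ac εT C' : ℝ, CB ≤ Ac ∧ 0 < εT ∧ εT ≤ 1 ∧ 1 ≤ C' ∧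
    ∀ (E : Set (Euc n)) (Γ : ℕ → Euc n → ℝ → Set (Pm m n)) Lc L A s0 s z z' w T T',
    Ch E Γ Lc Cw → L + 2 ≤ Lc → w ∈ E → z' ∈ E → A ⊆ mis m n → Mono A m → 0 < s → s ≤ s0 → s ≤ 1 →
    SB (Γ (L+2)) z T A s0 CB → SB (Γ (L+2)) z' T' A s0 CB → VA A (T - T') → ‖z - z'‖ ≤ εT * s → ‖z - w‖ ≤ εT * s → ‖z' - w‖ ≤ εT * s →
    (¬ ∃ A' ⊆ mis m n, wt m A < wt m A' ∧ ∃ R, WB (Γ L) w R A' s Ac ∧ VA A (R - T)) → nb z s (T - T') C' := by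
  have hD := Dn_one (m := m) (n := n)
  obtain ⟨C2, hC2, hRstep⟩ := Rstep (m := m) (n := n) Cw CB hCB
  obtain ⟨C3, hC3, hRit⟩ := Riter (m := m) (n := n) Cw C2 (by linarith)
  have hC4 : 1 ≤ max CB C3 := hCB.trans (le_max_left _ _)
  obtain ⟨ε2, C5, he20, he21, hC5, hT2⟩ := Tlem (m := m) (n := n) Cw (max CB C3) hC4
  obtain ⟨ε3, C6, he30, he31, hC6, hT3⟩ := Tlem (m := m) (n := n) Cw CB hCB
  have hCB5 : CB ≤ C5 := (le_max_left _ _).trans hC5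
  set C7 := 2 * C6 + 2 * C6 * (2 * C6) with hC7
  have hC71 : 2 * C6 ≤ C7 := by nlinarith
  obtain ⟨C9, hC9, hRit2⟩ := Riter (m := m) (n := n) Cw C7 (by linarith)
  obtain ⟨ε4, C11, he40, he41, hC11, hT4⟩ := Tlem (m := m) (n := n) Cw C9 (by linarith)
  refine ⟨max C5 C11, min ε2 (min ε3 ε4), C6 + Dn m n * 2, hCB5.trans (le_max_left _ _), lt_min he20 (lt_min he30 he40), (min_le_left _ _).trans he21, by linarith, ?_⟩
  intro E Γ Lc L A s0 s z z' w T T' hch hL hw hz' hA hAm hs hss hs1 hT hT' hV hzz hzw hz'w hno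
  have q2 : min ε2 (min ε3 ε4) * s ≤ ε2 * s := by gcongr; exact min_le_left _ _
  have q3 : min ε2 (min ε3 ε4) * s ≤ ε3 * s := by gcongr; exact (min_le_right _ _).trans (min_le_left _ _)
  have q4 : min ε2 (min ε3 ε4) * s ≤ ε4 * s := by gcongr; exact (min_le_right _ _).trans (min_le_right _ _)
  have q31 : ε3 * s ≤ s := mul_le_of_le_one_left hs.le he31
  have S2 := hch.sf (L+2) hL
  have S1 := hch.sf (L+1) (by omega)
  have S0 := hch.sf L (by omega)
  -- claim 1
  have hSB : SB (Γ (L+2)) z T A s CB := by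
    rcases hRstep (Γ (L+2)) z T A s S2 hA hs hs1 (hT.wb.scale S2 hA hs hss) with h | ⟨A', hA', hwt, hWB⟩
    · exact h.2
    · exfalso
      obtain ⟨A'', hA'', hwt2, hm2, hSB⟩ := hRit (Γ (L+2)) z T A' s S2 hA' hs hs1 hWB
      obtain ⟨R, hR1, -, hR3⟩ := hT2 E Γ Lc (L+1) z w T A A'' s0 s hch (by omega) hw hA hA'' hAm hs hss (hzw.trans q2)
        (hT.up S2 (le_max_left _ _)) (hSB.up S2 (le_max_right _ _))
      exact hno ⟨A'', hA'', by omega, R, (hR3.wb.sub (hch.sub L)).up S0 (le_max_left _ _), hR1⟩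
  obtain ⟨T2, hV2, hn2, hSB2⟩ := hT3 E Γ Lc (L+1) z z' T A A s s hch (by omega) hz' hA hA hAm hs le_rfl (hzz.trans q3) hSB hSB
  have hV3 : VA A (T2 - T') := hV2.tri hV
  have hT1 : SB (Γ (L+1)) z' T' A s0 C6 := (hT'.sub (hch.sub (L+1))).up S1 hC6
  have hn3 : nb z' s (T2 - T') 2 := by
    rcases mid S1 (by linarith) hA hs (hT1.wb.scale S1 hA hs hss) hSB2.1 hV3 with h | ⟨t, ht0, ht2, -, β, hβ, hβA, hWB⟩
    · exact h
    · exfalso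
      obtain ⟨A'', hA'', hwt2, hm2, hSB⟩ := hRit2 (Γ (L+1)) z' _ _ s S1 (nl_sub hA hβ) hs hs1 hWB
      have hwt := wt_nl (m := m) hA hβA
      have hSBm := (hT1.move S1 (by linarith) hSB2.1 ht0 ht2).up S1 (hC71.trans hC9)
      obtain ⟨R, hR1, -, hR3⟩ := hT4 E Γ Lc L z' w _ A A'' s0 s hch (by omega) hw hA hA'' hAm hs hss (hz'w.trans q4) hSBm hSB
      refine hno ⟨A'', hA'', by omega, R, hR3.wb.up S0 (le_max_right _ _), ?_⟩
      have h1 : VA A ((T' + t • (T2 - T')) - T') := by rw [add_sub_cancel_left]; exact hV3.smul t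
      exact (hR1.tri h1).tri hV.comm
  exact (nb_comm hn2).tri (hn3.shift (by rw [norm_sub_rev]; linarith) (by norm_num))
end FP

namespace FP
open scoped ContDiff Classical Topology
set_option linter.all false
variable {m n : ℕ}

lemma Ch.lower {E : Set (Euc n)} {Γ : ℕ → Euc n → ℝ → Set (Pm m n)} {L L' : ℕ} {Cw : ℝ} (h : Ch E Γ L Cw) (hl : L' ≤ L) :
    Ch E Γ L' Cw := ⟨fun l h' => h.sf l (h'.trans hl), h.sub, h.tr⟩

/-- conclusion of the main lemma -/
def Con (E : Finset (Euc n)) (Γ : Euc n → ℝ → Set (Pm m n)) (x0 : Euc n) (P0 : Pm m n) (δ C : ℝ) : Prop :=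
  ∃ p : Euc n → Pm m n, ∀ z ∈ E, ‖z - x0‖ ≤ δ → p z ∈ Γ z C ∧ nb z δ (p z - P0) C ∧
    ∀ z' ∈ E, ‖z' - x0‖ ≤ δ → nb z ‖z - z'‖ (p z - p z') C

def ML (m n k L : ℕ) : Prop :=
  ∀ Cw C : ℝ, 1 ≤ C → ∃ ε C' : ℝ, 0 < ε ∧ ε ≤ 1 ∧ C ≤ C' ∧
    ∀ A ⊆ mis m n, wt m (mis m n) < wt m A + k →
    ∀ (E : Finset (Euc n)) (Γ : ℕ → Euc n → ℝ → Set (Pm m n)), Ch (↑E) Γ L Cw →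
    ∀ (x0 : Euc n) (P0 : Pm m n) (δ : ℝ), 0 < δ → δ ≤ ε → WB (Γ L) x0 P0 A (δ / ε) C →
      Con E (Γ 0) x0 P0 δ C'

lemma exists_sep (E : Finset (Euc n)) (z : Euc n) : ∃ t > (0:ℝ), ∀ w ∈ E, ‖w - z‖ ≤ t → w = z := by
  by_cases h : (E.erase z).Nonempty
  · obtain ⟨w0, hw0, hmin⟩ := Finset.exists_min_image (E.erase z) (fun w => ‖w - z‖) h
    have h0 : 0 < ‖w0 - z‖ := norm_pos_iff.2 (sub_ne_zero.2 (Finset.ne_of_mem_erase hw0))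
    refine ⟨‖w0 - z‖ / 2, by linarith, fun w hw hle => ?_⟩
    by_contra hne
    have := hmin w (Finset.mem_erase.2 ⟨hne, hw⟩)
    linarith
  · refine ⟨1, one_pos, fun w hw _ => ?_⟩
    by_contra hne
    exact h ⟨w, Finset.mem_erase.2 ⟨hne, hw⟩⟩

/-- local data at a good radius -/
lemma locdata {E : Finset (Euc n)} {Γ : ℕ → Euc n → ℝ → Set (Pm m n)} {L Lc k : ℕ} {Cw CB Ac A2 εb Cb ε1 s0 : ℝ} {A : Finset (Fin n → ℕ)}
    {z : Euc n} {T P0 : Pm m n} (hCh : Ch (↑E) Γ Lc Cw) (hL : L + 2 ≤ Lc) (hCB : 1 ≤ CB) (hAc : CB ≤ Ac)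
    (hA2 : A2 = 2 * Ac + 2 * Ac * (2 * Ac)) (hAb : A2 ≤ Cb)
    (hA : A ⊆ mis m n) (hk : wt m (mis m n) < wt m A + (k + 1)) (hεb : 0 < εb) (hε1 : 0 < ε1) (hε1b : ε1 ≤ εb)
    (IH : ∀ A ⊆ mis m n, wt m (mis m n) < wt m A + k →
      ∀ (E : Finset (Euc n)) (Γ : ℕ → Euc n → ℝ → Set (Pm m n)), Ch (↑E) Γ L Cw →
      ∀ (x0 : Euc n) (P0 : Pm m n) (δ : ℝ), 0 < δ → δ ≤ εb → WB (Γ L) x0 P0 A (δ / εb) A2 →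
        Con E (Γ 0) x0 P0 δ Cb)
    (hT : SB (Γ (L + 2)) z T A s0 CB) (hV : VA A (T - P0)) (E0 : Finset (Euc n)) (hE0 : E0 ⊆ E) {ρ : ℝ} (hρ : 0 < ρ) (hρb : ρ ≤ εb)
    (hρs : ρ / ε1 ≤ s0)
    (hG : (∃ A' ⊆ mis m n, wt m A < wt m A' ∧ ∃ R, WB (Γ L) z R A' (ρ / ε1) Ac ∧ VA A (R - P0)) ∨ ∀ w ∈ E0, ‖w - z‖ ≤ ρ → w = z) :
    ∃ (R : Pm m n) (loc : Euc n → Pm m n), nb z (ρ / ε1) (R - T) 2 ∧ R ∈ Γ 0 z Cb ∧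
      (∀ w ∈ E0, ‖w - z‖ ≤ ρ → loc w ∈ Γ 0 w Cb ∧ nb w ρ (loc w - R) Cb) ∧
      ∀ w ∈ E0, ∀ w' ∈ E0, ‖w - z‖ ≤ ρ → ‖w' - z‖ ≤ ρ → nb w ‖w - w'‖ (loc w - loc w') Cb := by
  have hs : 0 < ρ / ε1 := div_pos hρ hε1
  have hAc1 : 1 ≤ Ac := hCB.trans hAc
  have hAcA2 : Ac ≤ A2 := by rw [hA2]; nlinarith
  have sfL := hCh.sf L (by omega)
  have hcon : ∀ (R : Pm m n) (A' : Finset (Fin n → ℕ)), A' ⊆ mis m n → wt m A < wt m A' → WB (Γ L) z R A' (ρ / ε1) A2 → nb z (ρ / ε1) (R - T) 2 →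
      ∃ (R : Pm m n) (loc : Euc n → Pm m n), nb z (ρ / ε1) (R - T) 2 ∧ R ∈ Γ 0 z Cb ∧
      (∀ w ∈ E0, ‖w - z‖ ≤ ρ → loc w ∈ Γ 0 w Cb ∧ nb w ρ (loc w - R) Cb) ∧
      ∀ w ∈ E0, ∀ w' ∈ E0, ‖w - z‖ ≤ ρ → ‖w' - z‖ ≤ ρ → nb w ‖w - w'‖ (loc w - loc w') Cb := by
    intro R A' hA' hwt hWB hnb
    obtain ⟨p, hp⟩ := IH A' hA' (by omega) E Γ (hCh.lower (by omega)) z R ρ hρ hρb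
      (hWB.scale sfL hA' (div_pos hρ hεb) (div_le_div_of_nonneg_left hρ.le hε1 hε1b))
    refine ⟨R, p, hnb, ?_, fun w hw hd => ⟨(hp w (hE0 hw) hd).1, (hp w (hE0 hw) hd).2.1⟩, fun w hw w' hw' hd hd' => (hp w (hE0 hw) hd).2.2 w' (hE0 hw') hd'⟩
    exact (hCh.sf 0 (by omega)).mono _ _ _ hAb (hCh.sub_le (Nat.zero_le L) _ _ hWB.1)
  rcases hG with ⟨A', hA', hwt, R, hR, hVR⟩ | hG
  · have hTW : WB (Γ L) z T A (ρ / ε1) Ac :=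
      (((hT.wb.sub (hCh.sub_le (by omega))).up sfL hAc).scale sfL hA hs hρs)
    rcases mid sfL hAc1 hA hs hTW hR.1 (hVR.tri hV.comm) with h | ⟨t, ht0, ht2, hnb, β, hβ, hβA, hW⟩
    · exact hcon R A' hA' hwt (hR.up sfL hAcA2) h
    · refine hcon (T + t • (R - T)) (nl A β) (nl_sub hA hβ) (wt_nl hA hβA) (by rw [hA2]; exact hW) ?_
      rw [add_sub_cancel_left]
      exact hnb.mono hs.le (by norm_num)
  · have hT0 : T ∈ Γ 0 z Cb := (hCh.sf 0 (by omega)).mono _ _ _ (hAc.trans (hAcA2.trans hAb)) (hCh.sub_le (Nat.zero_le (L+2)) _ _ hT.1)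
    have hCb : 0 ≤ Cb := by linarith
    refine ⟨T, fun _ => T, ?_, hT0, fun w hw hd => ?_, fun w hw w' hw' hd hd' => ?_⟩
    · rw [sub_self]; exact nb_zero hs.le (by norm_num)
    · rw [sub_self]; refine ⟨?_, nb_zero hρ.le hCb⟩
      rw [hG w hw hd]; exact hT0
    · rw [sub_self]; exact nb_zero (norm_nonneg _) hCb

set_option maxHeartbeats 2000000 in
lemma ML_step {k L : ℕ} (IH : ML m n k L) : ML m n (k + 1) (L + 3) := by
  intro Cw C hC
  obtain ⟨C1, hCC1, hR⟩ := Rstep (m := m) (n := n) Cw C hC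
  obtain ⟨εa, Ca, hεa, hεa1, hCa, IHa⟩ := IH Cw C1 (hC.trans hCC1)
  obtain ⟨εt, CB, hεt, hεt1, hCB, hT⟩ := Tlem (m := m) (n := n) Cw C hC
  have hCB1 : 1 ≤ CB := hC.trans hCB
  obtain ⟨Ac, εT, C13, hAc, hεT, hεT1, hC13, hTc⟩ := Tcmp (m := m) (n := n) Cw CB hCB1
  have hAc1 : 1 ≤ Ac := hCB1.trans hAc
  obtain ⟨A2, hA2⟩ : ∃ A2, A2 = 2 * Ac + 2 * Ac * (2 * Ac) := ⟨_, rfl⟩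
  have hA21 : 1 ≤ A2 := by rw [hA2]; nlinarith
  obtain ⟨εb, Cb, hεb, hεb1, hCb, IHb⟩ := IH Cw A2 hA21
  obtain ⟨ε1, hε1, hε1b, hε1T⟩ : ∃ ε1 : ℝ, 0 < ε1 ∧ ε1 ≤ εb ∧ ε1 ≤ εT := ⟨min εb εT, lt_min hεb hεT, min_le_left _ _, min_le_right _ _⟩
  obtain ⟨ε, hε, hεεa, hεεt, hεε1⟩ : ∃ ε : ℝ, 0 < ε ∧ ε ≤ εa ∧ ε ≤ εt ∧ ε ≤ ε1 :=
    ⟨min εa (min εt ε1), lt_min hεa (lt_min hεt hε1), min_le_left _ _, (min_le_right _ _).trans (min_le_left _ _), (min_le_right _ _).trans (min_le_right _ _)⟩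
  have hε11 : ε1 ≤ 1 := hε1b.trans hεb1
  have hε_1 : ε ≤ 1 := hεεa.trans hεa1
  have hD := Dn_one (m := m) (n := n)
  obtain ⟨a1, ha1⟩ : ∃ a1, a1 = (1 / ε1) ^ m * 2 := ⟨_, rfl⟩
  obtain ⟨a2, ha2⟩ : ∃ a2, a2 = (4 / ε) ^ m * (Dn m n * (CB + CB)) := ⟨_, rfl⟩
  obtain ⟨a3, ha3⟩ : ∃ a3, a3 = (4 / ε1) ^ m * C13 := ⟨_, rfl⟩
  obtain ⟨a4, ha4⟩ : ∃ a4, a4 = (1 / ε) ^ m * (Dn m n * CB) := ⟨_, rfl⟩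
  have ha1p : 0 ≤ a1 := by rw [ha1]; positivity
  have hDCB : 0 ≤ Dn m n * (CB + CB) := mul_nonneg (by linarith) (by linarith)
  have ha2p : 0 ≤ a2 := by rw [ha2]; exact mul_nonneg (by positivity) hDCB
  have ha3p : 0 ≤ a3 := by rw [ha3]; exact mul_nonneg (by positivity) (by linarith)
  have hDCB' : 0 ≤ Dn m n * CB := mul_nonneg (by linarith) (by linarith)
  have ha4p : 0 ≤ a4 := by rw [ha4]; exact mul_nonneg (by positivity) hDCB'
  have hDa1 : 0 ≤ Dn m n * a1 := mul_nonneg (by linarith) ha1p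
  obtain ⟨Cg, hCg⟩ : ∃ Cg, Cg = a1 + (a2 + a3) + Dn m n * a1 + Cb := ⟨_, rfl⟩
  have hCgb : Cb ≤ Cg := by linarith
  have hCg1 : 1 ≤ Cg := by linarith
  obtain ⟨Cf, hCf, hglue⟩ := glue (m := m) (n := n) Cw Cg hCg1
  refine ⟨ε, Ca + (Cf + a1 + a4), hε, hε_1, by linarith, ?_⟩
  intro A hA hk E Γ hCh x0 P0 δ hδ hδε hWB
  have hs0 : 0 < δ / ε := div_pos hδ hε
  have hs01 : δ / ε ≤ 1 := (div_le_one hε).2 hδε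
  have sf0 := hCh.sf 0 (by omega)
  have wk : ∀ {C C'}, C ≤ C' → Con E (Γ 0) x0 P0 δ C → Con E (Γ 0) x0 P0 δ C' := by
    rintro C C' hCC ⟨p, hp⟩
    refine ⟨p, fun z hz hd => ?_⟩
    obtain ⟨h1, h2, h3⟩ := hp z hz hd
    exact ⟨sf0.mono _ _ _ hCC h1, h2.mono hδ.le hCC, fun z' hz' hd' => (h3 z' hz' hd').mono (norm_nonneg _) hCC⟩
  rcases hR (Γ (L + 3)) x0 P0 A (δ / ε) (hCh.sf _ le_rfl) hA hs0 hs01 hWB with ⟨hM, hSB⟩ | ⟨A', hA', hwt, hWB'⟩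
  swap
  · refine wk (by linarith) (IHa A' hA' (by omega) E Γ (hCh.lower (by omega)) x0 P0 δ hδ (hδε.trans hεεa) ?_)
    exact ((hWB'.sub (hCh.sub_le (by omega))).scale (hCh.sf L (by omega)) hA' (div_pos hδ hεa) (div_le_div_of_nonneg_left hδ.le hε hεεa))
  refine wk (C := Cf + a1 + a4) (by linarith) ?_
  set E0 := E.filter (fun z => ‖z - x0‖ ≤ δ) with hE0
  have hE0E : E0 ⊆ E := Finset.filter_subset _ _
  have hE0d : ∀ z ∈ E0, ‖x0 - z‖ ≤ δ := fun z hz => by rw [norm_sub_rev]; exact (Finset.mem_filter.1 hz).2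
  have hδs0 : δ ≤ δ / ε := (le_div_iff₀ hε).2 (by nlinarith)
  have hTz : ∀ z : Euc n, ∃ T, z ∈ E0 → VA A (T - P0) ∧ nb x0 (δ / ε) (T - P0) CB ∧ SB (Γ (L + 2)) z T A (δ / ε) CB := by
    intro z
    by_cases hz : z ∈ E0
    · obtain ⟨T, h⟩ := hT (↑E) Γ (L + 3) (L + 2) x0 z P0 A A (δ / ε) (δ / ε) hCh (by omega) (Finset.mem_coe.2 (hE0E hz)) hA hA hM hs0 le_rfl
        ((hE0d z hz).trans (by rw [mul_div_assoc', le_div_iff₀ hε, mul_comm εt]; exact mul_le_mul_of_nonneg_left hεεt hδ.le)) hSB hSB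
      exact ⟨T, fun _ => h⟩
    · exact ⟨0, fun h => absurd h hz⟩
  choose T hT' using hTz
  set OK : Euc n → ℝ → Prop := fun z t => ∃ A' ⊆ mis m n, wt m A < wt m A' ∧ ∃ R, WB (Γ L) z R A' (t / ε1) Ac ∧ VA A (R - P0) with hOK
  have OKanti : ∀ z t t', OK z t → 0 < t' → t' ≤ t → OK z t' := by
    rintro z t t' ⟨A', hA', hwt, R, hR, hV⟩ h0 hle
    exact ⟨A', hA', hwt, R, hR.scale (hCh.sf L (by omega)) hA' (div_pos h0 hε1) (div_le_div_of_nonneg_right hle hε1.le), hV⟩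
  obtain ⟨r, hr, hLip⟩ := radius E0 (fun z t => OK z t ∨ ∀ w ∈ E0, ‖w - z‖ ≤ t → w = z) δ hδ
    (by
      rintro z hz t t' (h | h) h0 hle
      · exact Or.inl (OKanti z t t' h h0 hle)
      · exact Or.inr fun w hw hd => h w hw (hd.trans hle))
    (fun z hz => by
      obtain ⟨t, ht, h⟩ := exists_sep E0 z
      exact ⟨t, ht, Or.inr h⟩)
  have hloc : ∀ z : Euc n, ∃ (R : Pm m n) (loc : Euc n → Pm m n), z ∈ E0 → (nb z (r z / 2 / ε1) (R - T z) 2 ∧ R ∈ Γ 0 z Cb ∧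
      (∀ w ∈ E0, ‖w - z‖ ≤ r z / 2 → loc w ∈ Γ 0 w Cb ∧ nb w (r z / 2) (loc w - R) Cb) ∧
      ∀ w ∈ E0, ∀ w' ∈ E0, ‖w - z‖ ≤ r z / 2 → ‖w' - z‖ ≤ r z / 2 → nb w ‖w - w'‖ (loc w - loc w') Cb) := by
    intro z
    by_cases hz : z ∈ E0
    · obtain ⟨h0, h1, h2, h3⟩ := hr z hz
      obtain ⟨hV, hn, hS⟩ := hT' z hz
      obtain ⟨R, loc, h⟩ := locdata hCh (by omega) hCB1 hAc hA2 hCb hA hk hεb hε1 hε1b IHb hS hV E0 hE0E (ρ := r z / 2) (by linarith) (by linarith)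
        (div_le_div₀ hδ.le (by linarith) hε hεε1) h2
      exact ⟨R, loc, fun _ => h⟩
    · exact ⟨0, fun _ => 0, fun h => absurd h hz⟩
  choose R loc hRl using hloc
  have hRT : ∀ z ∈ E0, nb z (r z / 2) (R z - T z) a1 := by
    intro z hz
    have h0 := (hr z hz).1
    rw [ha1]
    exact (hRl z hz).1.down ((one_le_div hε1).2 hε11) (div_nonneg (by linarith) hε1.le) (by linarith) (by rw [one_div, inv_mul_eq_div]) (by norm_num)
  have hTT : ∀ z ∈ E0, ∀ z' ∈ E0, nb z (r z / 2 + ‖z - z'‖) (T z - T z') (a2 + a3) := by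
    intro z hz z' hz'
    obtain ⟨h0, h1, h2, h3⟩ := hr z hz
    have hnn := norm_nonneg (z - z')
    obtain ⟨hV, hn, hS⟩ := hT' z hz
    obtain ⟨hV', hn', hS'⟩ := hT' z' hz'
    set ρ := r z + ‖z - z'‖ with hρ
    have hρ0 : 0 ≤ r z / 2 + ‖z - z'‖ := by linarith
    by_cases hc : 2 * ρ ≤ δ
    · obtain ⟨w, hw, hwz, hwG⟩ := h3 (by linarith)
      have hnOK : ¬ OK w (2 * ρ) := fun h => hwG (Or.inl (OKanti w _ _ h (by linarith) (by linarith)))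
      have hs : 0 < 2 * ρ / ε1 := div_pos (by linarith) hε1
      have hss : 2 * ρ / ε1 ≤ δ / ε := div_le_div₀ hδ.le hc hε hεε1
      have he : 2 * ρ ≤ εT * (2 * ρ / ε1) := by
        rw [mul_div_assoc', le_div_iff₀ hε1, mul_comm εT]; exact mul_le_mul_of_nonneg_left hε1T (by linarith)
      have hzw : ‖z - w‖ ≤ r z := by rw [norm_sub_rev]; exact hwz
      have hz'w : ‖z' - w‖ ≤ ρ := by
        have := norm_sub_le_norm_sub_add_norm_sub z' z w
        rw [norm_sub_rev z' z] at this
        linarith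
      have := hTc (↑E) Γ (L + 3) L A (δ / ε) (2 * ρ / ε1) z z' w (T z) (T z') hCh (by omega) (Finset.mem_coe.2 (hE0E hw)) (Finset.mem_coe.2 (hE0E hz')) hA hM hs hss (hss.trans hs01)
        hS hS' (hV.tri hV'.comm) (by linarith) (by linarith) (by linarith)
        (by
          rintro ⟨A', hA', hwt, Q, hQ, hVQ⟩
          exact hnOK ⟨A', hA', hwt, Q, hQ, hVQ.tri hV⟩)
      refine (this.down (K := 4 / ε1) (s' := r z / 2 + ‖z - z'‖) ?_ hs.le hρ0 ?_ (by linarith)).mono hρ0 (by linarith)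
      · rw [one_le_div hε1]; linarith
      · rw [div_mul_eq_mul_div]; exact div_le_div_of_nonneg_right (by linarith) hε1.le
    · push Not at hc
      have h1 := (hn.tri (nb_comm hn')).shift ((hE0d z hz).trans hδs0) (by linarith)
      refine (h1.down (K := 4 / ε) (s' := r z / 2 + ‖z - z'‖) ?_ hs0.le hρ0 ?_ hDCB).mono hρ0 (by linarith)
      · rw [one_le_div hε]; linarith
      · rw [div_mul_eq_mul_div]; exact div_le_div_of_nonneg_right (by linarith) hε.le
  obtain ⟨p, hp⟩ := hglue (↑E0) (Γ 0) (fun z => r z / 2) R loc sf0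
    (fun z hz => by have := hr z hz; constructor <;> linarith)
    (fun z hz w hw => by have := hLip z hz w hw; have := norm_nonneg (z - w); linarith)
    (fun z hz => sf0.mono _ _ _ hCgb (hRl z hz).2.1)
    (fun z hz w hw hd => by
      obtain ⟨h1, h2⟩ := (hRl z hz).2.2.1 w hw hd
      have := hr z hz
      exact ⟨sf0.mono _ _ _ hCgb h1, h2.mono (by linarith) hCgb⟩)
    (fun z hz w hw w' hw' hd hd' => ((hRl z hz).2.2.2 w hw w' hw' hd hd').mono (norm_nonneg _) hCgb)
    (fun z hz z' hz' => by
      have hnn := norm_nonneg (z - z')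
      have h0 := (hr z hz).1
      have h0' := (hr z' hz').1
      have hl := hLip z' hz' z hz
      rw [norm_sub_rev] at hl
      have hρ0 : 0 ≤ r z / 2 + ‖z - z'‖ := by linarith
      have e1 := (hRT z hz).scale (s' := r z / 2 + ‖z - z'‖) (by linarith) (by linarith) ha1p
      have e3 := ((hRT z' hz').scale (s' := r z / 2 + ‖z - z'‖) (by linarith) (by linarith) ha1p).shift (y := z) (by rw [norm_sub_rev]; linarith) ha1p
      exact ((e1.tri (hTT z hz z' hz')).tri (nb_comm e3)).mono hρ0 (by linarith))
  refine ⟨p, fun z hz hd => ?_⟩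
  have hzE0 : z ∈ E0 := Finset.mem_filter.2 ⟨hz, hd⟩
  obtain ⟨h1, h2, h3⟩ := hp z (Finset.mem_coe.2 hzE0)
  have hrz := hr z hzE0
  have hCfp : 0 ≤ Cf := by linarith
  have hle : Cf ≤ Cf + a1 + a4 := by linarith
  refine ⟨sf0.mono _ _ _ hle h1, ?_, fun z' hz' hd' => (h3 z' (Finset.mem_coe.2 (Finset.mem_filter.2 ⟨hz', hd'⟩))).mono (norm_nonneg _) hle⟩
  have e1 := h2.scale (s' := δ) (by linarith) (by linarith) hCfp
  have e2 := (hRT z hzE0).scale (s' := δ) (by linarith) (by linarith) ha1p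
  have e3 := ((hT' z hzE0).2.1.shift ((hE0d z hzE0).trans hδs0) (by linarith)).down (K := 1 / ε) (s' := δ) ((one_le_div hε).2 hε_1) hs0.le hδ.le
    (by rw [one_div, inv_mul_eq_div]) hDCB'
  rw [← ha4] at e3
  exact (e1.tri e2).tri e3

lemma ML_all (k : ℕ) : ∃ L, ML m n k L := by
  induction k with
  | zero =>
    refine ⟨0, fun Cw C hC => ⟨1, C, one_pos, le_rfl, le_rfl, fun A hA hk => ?_⟩⟩
    have := wt_le hA
    omega
  | succ k ih =>
    obtain ⟨L, h⟩ := ih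
    exact ⟨L + 3, ML_step h⟩

/-- global selection -/
lemma select (m n : ℕ) : ∃ L, ∀ Cw : ℝ, 1 ≤ Cw → ∃ C' : ℝ, 1 ≤ C' ∧ ∀ (E : Finset (Euc n)) (Γ : ℕ → Euc n → ℝ → Set (Pm m n)), Ch (↑E) Γ L Cw →
    (∀ x ∈ E, (Γ L x 1).Nonempty) →
    ∃ p : Euc n → Pm m n, ∀ w ∈ E, p w ∈ Γ 0 w C' ∧ ∀ w' ∈ E, nb w ‖w - w'‖ (p w - p w') C' := by
  obtain ⟨L, hL⟩ := ML_all (m := m) (n := n) (wt m (mis m n) + 1)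
  refine ⟨L, fun Cw hCw => ?_⟩
  obtain ⟨ε, C1, hε, hε1, hC1, h⟩ := hL Cw 1 le_rfl
  have hD := Dn_one (m := m) (n := n)
  obtain ⟨Cg, hCg⟩ : ∃ Cg, Cg = C1 + (1 / ε) ^ m * (Cw + Dn m n * Cw) := ⟨_, rfl⟩
  have hDC : 0 ≤ Dn m n * Cw := mul_nonneg (by linarith) (by linarith)
  have hx : 0 ≤ (1 / ε) ^ m * (Cw + Dn m n * Cw) := mul_nonneg (by positivity) (by linarith)
  obtain ⟨Cf, hCf, hglue⟩ := glue (m := m) (n := n) Cw Cg (by linarith)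
  refine ⟨Cf, by linarith, fun E Γ hCh hne => ?_⟩
  have sf0 := hCh.sf 0 (by omega)
  have hne' : ∀ x : Euc n, ∃ P, x ∈ E → P ∈ Γ L x 1 := by
    intro x
    by_cases hx : x ∈ E
    · obtain ⟨P, hP⟩ := hne x hx
      exact ⟨P, fun _ => hP⟩
    · exact ⟨0, fun h => absurd h hx⟩
  choose R hR using hne'
  have hloc : ∀ z : Euc n, ∃ p : Euc n → Pm m n, z ∈ E → ∀ w ∈ E, ‖w - z‖ ≤ ε → p w ∈ Γ 0 w C1 ∧ nb w ε (p w - R z) C1 ∧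
    ∀ z' ∈ E, ‖z' - z‖ ≤ ε → nb w ‖w - z'‖ (p w - p z') C1 := by
    intro z
    by_cases hz : z ∈ E
    · obtain ⟨p, hp⟩ := h ∅ (by simp) (by omega) E Γ hCh z (R z) ε hε le_rfl ⟨hR z hz, fun _ => 0, by simp⟩
      exact ⟨p, fun _ => hp⟩
    · exact ⟨fun _ => 0, fun h => absurd h hz⟩
  choose loc hloc using hloc
  have hR0 : ∀ z ∈ E, R z ∈ Γ 0 z 1 := fun z hz => hCh.sub_le (Nat.zero_le L) _ _ (hR z hz)
  obtain ⟨p, hp⟩ := hglue (↑E) (Γ 0) (fun _ => ε) R loc sf0 (fun z hz => ⟨hε, hε1⟩) (fun z hz w hw => by have := norm_nonneg (z - w); linarith)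
    (fun z hz => sf0.mono _ _ _ (by linarith) (hR0 z hz))
    (fun z hz w hw hd => by
      obtain ⟨h1, h2, h3⟩ := hloc z hz w hw hd
      exact ⟨sf0.mono _ _ _ (by linarith) h1, h2.mono hε.le (by linarith)⟩)
    (fun z hz w hw w' hw' hd hd' => ((hloc z hz w hw hd).2.2 w' hw' hd').mono (norm_nonneg _) (by linarith))
    (fun z hz z' hz' => by
      have hnn := norm_nonneg (z - z')
      have b1 := sf0.bound z 1 le_rfl _ (hR0 z hz)
      have b2 := sf0.bound z' 1 le_rfl _ (hR0 z' hz')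
      rw [mul_one] at b1 b2
      have e1 := b1.scale (s' := 1 + ‖z - z'‖) zero_le_one (by linarith) (by linarith)
      have e2 := (b2.scale (s' := 1 + ‖z - z'‖) zero_le_one (by linarith) (by linarith)).shift (y := z) (by rw [norm_sub_rev]; linarith) (by linarith)
      refine ((e1.sub e2).down (K := 1 / ε) (s' := ε + ‖z - z'‖) ((one_le_div hε).2 hε1) (by linarith) (by linarith) ?_ (by linarith)).mono (by linarith) (by linarith)
      rw [one_div, inv_mul_eq_div, le_div_iff₀ hε]
      nlinarith)
  exact ⟨p, fun w hw => ⟨(hp w hw).1, (hp w hw).2.2⟩⟩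

end FP

namespace FP
open scoped ContDiff Classical Topology
set_option linter.all false
variable {m n : ℕ}

lemma cmp2 {F1 F2 : Euc n → ℝ} (h1 : ContDiff ℝ m F1) (h2 : ContDiff ℝ m F2) {M C s : ℝ} (hM : 0 ≤ M) (hC : 0 ≤ C) (hs : 0 < s)
    (b1 : ∀ y, ‖iteratedFDeriv ℝ m F1 y‖ ≤ M) (b2 : ∀ y, ‖iteratedFDeriv ℝ m F2 y‖ ≤ M) {e1 e2 y : Euc n}
    (hnb : nb e1 s (J e1 F1 - J e2 F2 : Pm m n) C) (d1 : ‖y - e1‖ ≤ s) (d2 : ‖y - e2‖ ≤ s) {k : ℕ} (hk : k ≤ m) :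
    ‖iteratedFDeriv ℝ k (F1 - F2) y‖ * s ^ k ≤ cn m n * (2 * M + Dn m n * C) * s ^ m := by
  have hD := Dn_one (m := m) (n := n)
  have hc := cn_one (m := m) (n := n)
  have hDC : 0 ≤ Dn m n * C := mul_nonneg (by linarith) hC
  rcases hk.lt_or_eq with hk' | rfl
  · have a1 := (J_two h1 (x := y) (y := e1) hM (fun z _ => b1 z)).scale (norm_nonneg _) d1 hM
    have a2 := (J_two h2 (x := y) (y := e2) hM (fun z _ => b2 z)).scale (norm_nonneg _) d2 hM
    have a3 := hnb.shift (y := y) (by rw [norm_sub_rev]; exact d1) hC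
    have a4 : nb y s (J y (F1 - F2) : Pm m n) (2 * M + Dn m n * C) := by
      have e : (J y (F1 - F2) : Pm m n) = (J y F1 - J e1 F1) + (J e1 F1 - J e2 F2) - (J y F2 - J e2 F2) := by
        rw [J_sub y h1 h2]; abel
      rw [e]
      exact ((a1.add a3).sub a2).mono hs.le (by linarith)
    have a5 := a4.norm hs.le (by linarith) hk
    rwa [iter_J y (cd_sub h1 h2) hk'] at a5
  · rw [iter_sub_apply h1 h2 le_rfl]
    have : ‖iteratedFDeriv ℝ k F1 y - iteratedFDeriv ℝ k F2 y‖ ≤ 2 * M :=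
      (norm_sub_le _ _).trans (by linarith [b1 y, b2 y])
    refine mul_le_mul_of_nonneg_right ?_ (by positivity)
    nlinarith

lemma J_mul_congr {θ H1 H2 : Euc n → ℝ} {x : Euc n} (hθ : ContDiff ℝ m θ) (h1 : ContDiff ℝ m H1) (h2 : ContDiff ℝ m H2)
    (h : (J x H1 : Pm m n) = J x H2) : (J x (θ * H1) : Pm m n) = J x (θ * H2) := by
  rw [← sub_eq_zero, ← J_sub x (cd_mul hθ h1) (cd_mul hθ h2), ← mul_sub]
  refine Pm_ext x fun β hβ => ?_
  rw [cf_J _ _ hβ, map_zero]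
  have hb := mem_mis.1 hβ
  have hz : ∀ i < m, iteratedFDeriv ℝ i (H1 - H2) x = 0 := fun i hi => by
    rw [iter_sub_apply h1 h2 hi.le, ← iter_J x h1 hi, ← iter_J x h2 hi, h, sub_self]
  have hH := cd_sub h1 h2
  have a1 := abs_mD_le (cd_mul hθ hH) β hb.le x
  have a2 := norm_iteratedFDeriv_mul_le hθ hH x (n := deg β) (by exact_mod_cast hb.le)
  have a3 : (∑ i ∈ Finset.range (deg β + 1), ((deg β).choose i : ℝ) * ‖iteratedFDeriv ℝ i θ x‖ * ‖iteratedFDeriv ℝ (deg β - i) (H1 - H2) x‖) = 0 := by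
    refine Finset.sum_eq_zero fun i hi => ?_
    rw [hz _ (by omega), norm_zero, mul_zero]
  rw [a3] at a2
  exact abs_nonpos_iff.1 (a1.trans a2)

/-- The sets for interpolation. -/
def GF (f : Euc n → ℝ) (x : Euc n) (M : ℝ) : Set (Pm m n) :=
  {P | ∃ F : Euc n → ℝ, ContDiff ℝ m F ∧ (∀ y, ∀ k ≤ m, ‖iteratedFDeriv ℝ k F y‖ ≤ cn m n * M) ∧ (∀ y, 0 ≤ F y) ∧ J x F = P ∧ F x = f x}

lemma iter_add_apply {F G : Euc n → ℝ} {N : ℕ} (hF : ContDiff ℝ N F) (hG : ContDiff ℝ N G) {k : ℕ} (hk : k ≤ N) (x : Euc n) :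
    iteratedFDeriv ℝ k (F + G) x = iteratedFDeriv ℝ k F x + iteratedFDeriv ℝ k G x :=
  iteratedFDeriv_add_apply (hF.contDiffAt.of_le (by exact_mod_cast hk)) (hG.contDiffAt.of_le (by exact_mod_cast hk))

lemma iter_smul_apply {F : Euc n → ℝ} {N : ℕ} (hF : ContDiff ℝ N F) (c : ℝ) {k : ℕ} (hk : k ≤ N) (x : Euc n) :
    iteratedFDeriv ℝ k (c • F) x = c • iteratedFDeriv ℝ k F x :=
  iteratedFDeriv_const_smul_apply (hF.contDiffAt.of_le (by exact_mod_cast hk))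

lemma GF_conv (f : Euc n → ℝ) (x : Euc n) (M : ℝ) : Convex ℝ (GF f x M : Set (Pm m n)) := by
  rintro P ⟨F, hF, bF, pF, rfl, vF⟩ Q ⟨G, hG, bG, pG, rfl, vG⟩ a b ha hb hab
  refine ⟨a • F + b • G, cd_add (cd_smul hF a) (cd_smul hG b), fun y k hk => ?_, fun y => ?_, ?_, ?_⟩
  · rw [iter_add_apply (cd_smul hF a) (cd_smul hG b) hk, iter_smul_apply hF a hk, iter_smul_apply hG b hk]
    refine (norm_add_le _ _).trans ?_
    rw [norm_smul, norm_smul, Real.norm_of_nonneg ha, Real.norm_of_nonneg hb]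
    have e1 := mul_le_mul_of_nonneg_left (bF y k hk) ha
    have e2 := mul_le_mul_of_nonneg_left (bG y k hk) hb
    have : a * (cn m n * M) + b * (cn m n * M) = cn m n * M := by rw [← add_mul, hab, one_mul]
    linarith
  · exact add_nonneg (mul_nonneg ha (pF y)) (mul_nonneg hb (pG y))
  · rw [J_add x (cd_smul hF a) (cd_smul hG b), J_smul x hF, J_smul x hG]
  · show a * F x + b * G x = f x
    rw [vF, vG, ← add_mul, hab, one_mul]

lemma GF_SF (m n : ℕ) : ∃ Cw : ℝ, ∀ f : Euc n → ℝ, SF (GF f : Euc n → ℝ → Set (Pm m n)) Cw := by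
  obtain ⟨K, hK, hbump⟩ := bump m n 1 one_pos
  have hD := Dn_one (m := m) (n := n)
  have hc := cn_one (m := m) (n := n)
  obtain ⟨B, hB⟩ : ∃ B, B = 2 ^ m * (2 ^ m * (4 ^ m * K * 1) * (cn m n * (2 * cn m n + Dn m n))) := ⟨_, rfl⟩
  have hB0 : 0 ≤ B := by
    rw [hB]
    refine mul_nonneg (by positivity) (mul_nonneg (mul_nonneg (by positivity) ?_) (mul_nonneg (by linarith) (by linarith)))
    exact mul_nonneg (mul_nonneg (by positivity) (by linarith)) zero_le_one
  refine ⟨cn m n + 1 + B, fun f => ⟨by linarith, GF_conv f, ?_, ?_, ?_⟩⟩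
  · rintro x M M' hM P ⟨F, hF, bF, pF, rfl, vF⟩
    exact ⟨F, hF, fun y k hk => (bF y k hk).trans (mul_le_mul_of_nonneg_left hM (by linarith)), pF, rfl, vF⟩
  · rintro x M hM P ⟨F, hF, bF, pF, rfl, vF⟩ β hβ
    have hb := mem_mis.1 hβ
    rw [cf_J _ _ hβ, one_pow, mul_one]
    refine (abs_mD_le hF β hb.le x).trans ((bF x _ hb.le).trans (mul_le_mul_of_nonneg_right (by linarith) (by linarith)))
  · rintro x M δ θ P Q hM hδ hδ1 ⟨F, hF, bF, pF, rfl, vF⟩ ⟨G, hG, bG, pG, rfl, vG⟩ hnb hθ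
    obtain ⟨χ, hχ, bχ, χ1, χ0⟩ := hbump x (δ / 4) (by linarith)
    have hχm : ContDiff ℝ m χ := hχ.of_le (by exact_mod_cast le_top)
    have hχθ := cd_mul hχm hθ.1
    have hFG := cd_sub hF hG
    have hall := cd_mul hχθ hFG
    have hout : ∀ y, ‖y - x‖ < δ ∨ χ =ᶠ[𝓝 y] 0 := by
      intro y
      by_cases h : ‖y - x‖ < δ
      · exact Or.inl h
      right
      push Not at h
      have : ∀ᶠ z in 𝓝 y, δ / 2 < ‖z - x‖ := by
        have : Continuous fun z : Euc n => ‖z - x‖ := by fun_prop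
        exact this.continuousAt.eventually (lt_mem_nhds (by linarith))
      filter_upwards [this] with z hz
      exact χ0 z (by linarith)
    have h01 : ∀ y, 0 ≤ χ y * θ y ∧ χ y * θ y ≤ 1 := by
      intro y
      rcases hout y with h | h
      · have h2 := hθ.2 y (by rwa [Metric.mem_ball, dist_eq_norm])
        have h3 := bχ y
        exact ⟨mul_nonneg h3.1 h2.1, mul_le_one₀ h3.2.1 h2.1 h2.2.1⟩
      · have : χ y = 0 := h.eq_of_nhds
        rw [this]; simp
    refine ⟨G + (χ * θ) * (F - G), cd_add hG hall, fun y k hk => ?_, fun y => ?_, ?_, ?_⟩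
    · have hbd : ‖iteratedFDeriv ℝ k ((χ * θ) * (F - G)) y‖ ≤ B * M := by
        rcases hout y with h | h
        · have b1 : ∀ k ≤ m, ‖iteratedFDeriv ℝ k χ y‖ * δ ^ k ≤ 4 ^ m * K := by
            intro k hk
            have e := (bχ y).2.2 k hk
            have e2 : δ ^ k = 4 ^ k * (δ / 4) ^ k := by rw [← mul_pow]; congr 1; ring
            have e3 : (4:ℝ) ^ k ≤ 4 ^ m := pow_le_pow_right₀ (by norm_num) hk
            rw [e2]
            calc _ = 4 ^ k * (‖iteratedFDeriv ℝ k χ y‖ * (δ / 4) ^ k) := by ring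
              _ ≤ _ := mul_le_mul e3 e (by positivity) (by positivity)
          have b2 := fun (k : ℕ) (hk : k ≤ m) => prod_bound hχm hθ.1 (x := y) (s := δ) hδ.le b1
            (hθ.2 y (by rwa [Metric.mem_ball, dist_eq_norm])).2.2 hk
          have b3 := prod_bound hχθ hFG (x := y) (s := δ) hδ.le b2 (fun k hk => cmp2 hF hG (M := cn m n * M) (C := M) (s := δ) (e1 := x) (e2 := x)
            (mul_nonneg (by linarith) (by linarith)) (by linarith) hδ (fun y => bF y m le_rfl) (fun y => bG y m le_rfl) hnb h.le h.le hk) hk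
          have e4 : (2:ℝ) ^ m * (2 ^ m * (4 ^ m * K * 1) * (cn m n * (2 * (cn m n * M) + Dn m n * M) * δ ^ m)) = B * M * δ ^ m := by rw [hB]; ring
          rw [e4] at b3
          have e5 : B * M * δ ^ m ≤ B * M * δ ^ k := mul_le_mul_of_nonneg_left (pow_le_pow_of_le_one hδ.le hδ1 hk) (mul_nonneg hB0 (by linarith))
          exact le_of_mul_le_mul_right (b3.trans e5) (by positivity)
        · have : ((χ * θ) * (F - G)) =ᶠ[𝓝 y] 0 := by
            filter_upwards [h] with z hz
            simp [hz]
          rw [(this.iteratedFDeriv ℝ k).eq_of_nhds]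
          rw [show iteratedFDeriv ℝ k (0 : Euc n → ℝ) y = 0 from congrFun iteratedFDeriv_fun_zero y, norm_zero]
          exact mul_nonneg hB0 (by linarith)
      rw [iter_add_apply hG hall hk]
      refine (norm_add_le _ _).trans ?_
      have e6 : B * M ≤ cn m n * (B * M) := le_mul_of_one_le_left (mul_nonneg hB0 (by linarith)) hc
      have e7 : cn m n * ((cn m n + 1 + B) * M) = cn m n * (cn m n * M) + cn m n * M + cn m n * (B * M) := by ring
      have e8 : 0 ≤ cn m n * (cn m n * M) := mul_nonneg (by linarith) (mul_nonneg (by linarith) (by linarith))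
      have := bG y k hk
      linarith
    · show 0 ≤ G y + χ y * θ y * (F y - G y)
      have := h01 y
      nlinarith [mul_nonneg this.1 (pF y), mul_nonneg (sub_nonneg.2 this.2) (pG y)]
    · rw [J_add x hG hall, bl]
      congr 1
      have e1 : (χ * θ) * (F - G) =ᶠ[𝓝 x] θ * (F - G) := by
        filter_upwards [Metric.ball_mem_nhds x (show (0:ℝ) < δ / 4 by linarith)] with z hz
        rw [Metric.mem_ball, dist_eq_norm] at hz
        simp [χ1 z (by linarith)]
      rw [J_congr e1]
      refine J_mul_congr hθ.1 hFG (Pm_cd _) ?_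
      rw [J_Pm, J_sub x hF hG]
    · show G x + χ x * θ x * (F x - G x) = f x
      rw [vF, vG]; ring

end FP

namespace FP
open scoped ContDiff Classical Topology
set_option linter.all false
variable {m n : ℕ}

/-- constants for the blending recursion -/
def Bj (m : ℕ) (K Cd : ℝ) : ℕ → ℝ
  | 0 => 0
  | j + 1 => Bj m K Cd j + 2 ^ m * (K * (Cd + Bj m K Cd j))

/-- successive blending -/
def vj (Ψ : ℕ → Euc n → ℝ) (Fe : ℕ → Euc n → Euc n → ℝ) (v0 : Euc n → ℝ) : ℕ → Euc n → ℝ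
  | 0 => v0
  | j + 1 => fun x => vj Ψ Fe v0 j x + Ψ j x * (Fe j x x - vj Ψ Fe v0 j x)

lemma Bj_nonneg {K Cd : ℝ} (hK : 0 ≤ K) (hC : 0 ≤ Cd) (j : ℕ) : 0 ≤ Bj m K Cd j := by
  induction j with
  | zero => exact le_rfl
  | succ j ih => unfold Bj; positivity

/-- local smooth representation -/
lemma vj_local {Ψ : ℕ → Euc n → ℝ} {Fe : ℕ → Euc n → Euc n → ℝ} {v0 F0 : Euc n → ℝ} {w : Euc n} {ρ r K Cd : ℝ} {i : ℕ} (hK : 0 ≤ K) (hCd : 0 ≤ Cd)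
    (hr : 0 < r) (hρ : 0 < ρ) (hF0 : ContDiff ℝ m F0)
    (hΨ : ∀ j, ∃ θ : Euc n → ℝ, ContDiff ℝ m θ ∧ (∀ k ≤ m, ‖iteratedFDeriv ℝ k θ w‖ * r ^ k ≤ K) ∧ ∀ z, ‖z - w‖ ≤ ρ → Ψ j z = θ z)
    (hc : ∀ j, (∀ z, ‖z - w‖ ≤ ρ → Ψ j z = 0) ∨ ∃ G : Euc n → ℝ, ContDiff ℝ m G ∧ (∀ z, ‖z - w‖ ≤ ρ → Fe j z z = G z) ∧
      ∀ k ≤ m, ‖iteratedFDeriv ℝ k (G - F0) w‖ * r ^ k ≤ Cd * r ^ m)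
    (hi : ∀ z, ‖z - w‖ ≤ ρ → Ψ i z = 1) (j : ℕ) :
    ∃ G : Euc n → ℝ, ContDiff ℝ m G ∧ (∀ k ≤ m, ‖iteratedFDeriv ℝ k (G - F0) w‖ * r ^ k ≤ Bj m K Cd j * r ^ m) ∧
      (i < j → ∀ z, ‖z - w‖ ≤ ρ → vj Ψ Fe v0 j z = G z) := by
  induction j with
  | zero =>
    refine ⟨F0, hF0, fun k hk => ?_, fun h => absurd h (by omega)⟩
    rw [iter_sub_apply hF0 hF0 hk, sub_self, norm_zero, Bj]; simp
  | succ j ih =>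
    obtain ⟨G, hG, bG, hv⟩ := ih
    have hB := Bj_nonneg (m := m) hK hCd j
    rcases hc j with h0 | ⟨H, hH, eH, bH⟩
    · refine ⟨G, hG, fun k hk => (bG k hk).trans ?_, fun hij z hz => ?_⟩
      · refine mul_le_mul_of_nonneg_right ?_ (by positivity)
        rw [Bj]; have : 0 ≤ 2 ^ m * (K * (Cd + Bj m K Cd j)) := by positivity
        linarith
      · have hne : i ≠ j := by
          rintro rfl
          have h1 := hi w (by simpa using hρ.le)
          rw [h0 w (by simpa using hρ.le)] at h1
          norm_num at h1
        show vj Ψ Fe v0 j z + Ψ j z * (Fe j z z - vj Ψ Fe v0 j z) = G z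
        rw [h0 z hz, zero_mul, add_zero]
        exact hv (by omega) z hz
    · obtain ⟨θ, hθ, bθ, eθ⟩ := hΨ j
      have hHG := cd_sub hH hG
      have hth := cd_mul hθ hHG
      refine ⟨G + θ * (H - G), cd_add hG hth, fun k hk => ?_, fun hij z hz => ?_⟩
      · have e1 : G + θ * (H - G) - F0 = (G - F0) + θ * (H - G) := by ring
        have b1 : ∀ k ≤ m, ‖iteratedFDeriv ℝ k (H - G) w‖ * r ^ k ≤ (Cd + Bj m K Cd j) * r ^ m := by
          intro k hk
          have e2 : H - G = (H - F0) - (G - F0) := by ring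
          rw [e2, iter_sub_apply (cd_sub hH hF0) (cd_sub hG hF0) hk, add_mul]
          have := norm_sub_le (iteratedFDeriv ℝ k (H - F0) w) (iteratedFDeriv ℝ k (G - F0) w)
          have := mul_le_mul_of_nonneg_right this (show 0 ≤ r ^ k by positivity)
          rw [add_mul] at this
          linarith [bH k hk, bG k hk]
        have b2 := prod_bound hθ hHG hr.le bθ b1 hk
        rw [e1, iter_add_apply (cd_sub hG hF0) hth hk]
        have := mul_le_mul_of_nonneg_right (norm_add_le (iteratedFDeriv ℝ k (G - F0) w) (iteratedFDeriv ℝ k (θ * (H - G)) w)) (show 0 ≤ r ^ k by positivity)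
        rw [add_mul] at this
        have e3 : Bj m K Cd (j + 1) * r ^ m = Bj m K Cd j * r ^ m + 2 ^ m * (K * ((Cd + Bj m K Cd j) * r ^ m)) := by rw [Bj]; ring
        rw [e3]
        linarith [bG k hk]
      · show vj Ψ Fe v0 j z + Ψ j z * (Fe j z z - vj Ψ Fe v0 j z) = G z + θ z * (H z - G z)
        rw [eH z hz]
        by_cases hij' : i = j
        · subst hij'
          rw [← eθ z hz, hi z hz]; ring
        · rw [hv (by omega) z hz, eθ z hz]

lemma vj_nonneg {Ψ : ℕ → Euc n → ℝ} {Fe : ℕ → Euc n → Euc n → ℝ} {v0 : Euc n → ℝ} {x : Euc n} (hΨ : ∀ j, 0 ≤ Ψ j x ∧ Ψ j x ≤ 1)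
    (hF : ∀ j, 0 ≤ Fe j x x) (h0 : 0 ≤ v0 x) (j : ℕ) : 0 ≤ vj Ψ Fe v0 j x := by
  induction j with
  | zero => exact h0
  | succ j ih =>
    show 0 ≤ vj Ψ Fe v0 j x + Ψ j x * (Fe j x x - vj Ψ Fe v0 j x)
    nlinarith [mul_nonneg (hΨ j).1 (hF j), mul_nonneg (sub_nonneg.2 (hΨ j).2) ih]

lemma vj_val {Ψ : ℕ → Euc n → ℝ} {Fe : ℕ → Euc n → Euc n → ℝ} {v0 : Euc n → ℝ} {x : Euc n} {c : ℝ}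
    (hF : ∀ j, Ψ j x = 0 ∨ Fe j x x = c) (h0 : v0 x = c) (j : ℕ) : vj Ψ Fe v0 j x = c := by
  induction j with
  | zero => exact h0
  | succ j ih =>
    show vj Ψ Fe v0 j x + Ψ j x * (Fe j x x - vj Ψ Fe v0 j x) = c
    rw [ih]
    rcases hF j with h | h <;> rw [h] <;> ring

lemma sep_all (E : Finset (Euc n)) : ∃ t > (0:ℝ), t ≤ 1 ∧ ∀ z ∈ E, ∀ w ∈ E, ‖w - z‖ ≤ t → w = z := by
  choose t ht h using exists_sep E
  by_cases hE : E.Nonempty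
  · obtain ⟨z0, hz0, hmin⟩ := Finset.exists_min_image E t hE
    exact ⟨min 1 (t z0), lt_min one_pos (ht z0), min_le_left _ _, fun z hz w hw hd => h z w hw (hd.trans ((min_le_right _ _).trans (hmin z hz)))⟩
  · exact ⟨1, one_pos, le_rfl, fun z hz => absurd ⟨z, hz⟩ hE⟩

set_option maxHeartbeats 1000000 in
lemma extend (m n : ℕ) (C : ℝ) (hC : 1 ≤ C) : ∃ C' : ℝ, 1 ≤ C' ∧ ∀ (E : Finset (Euc n)) (f : Euc n → ℝ) (p : Euc n → Pm m n),
    (∀ w ∈ E, p w ∈ GF f w C ∧ ∀ w' ∈ E, nb w ‖w - w'‖ (p w - p w') C) →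
    ∃ F : Euc n → ℝ, ContDiff ℝ m F ∧ (∀ y, ∀ k ≤ m, ‖iteratedFDeriv ℝ k F y‖ ≤ C') ∧ (∀ y, 0 ≤ F y) ∧ ∀ x ∈ E, F x = f x := by
  obtain ⟨N, K, c0, hK, hc0, hc08, hPU⟩ := PU m n
  have hD := Dn_one (m := m) (n := n)
  have hc := cn_one (m := m) (n := n)
  obtain ⟨M, hM⟩ : ∃ M, M = cn m n * C := ⟨_, rfl⟩
  have hM1 : 1 ≤ M := by rw [hM]; nlinarith
  have hDC : 0 ≤ Dn m n * C := mul_nonneg (by linarith) (by linarith)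
  obtain ⟨c1, hc1⟩ : ∃ c1, c1 = cn m n * (2 * M + Dn m n * C) := ⟨_, rfl⟩
  have hc1M : 2 * M ≤ c1 := by rw [hc1]; nlinarith
  obtain ⟨Cd, hCd⟩ : ∃ Cd, Cd = c1 * 3 ^ m := ⟨_, rfl⟩
  have h3m : (1:ℝ) ≤ 3 ^ m := one_le_pow₀ (by norm_num)
  have hCd1 : c1 ≤ Cd := by rw [hCd]; exact le_mul_of_one_le_right (by linarith) h3m
  have hCd0 : 0 ≤ Cd := by linarith
  have hBN := Bj_nonneg (m := m) (show 0 ≤ K by linarith) hCd0 N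
  refine ⟨M + Bj m K Cd N, by linarith, fun E f p hp => ?_⟩
  by_cases hE : E.Nonempty
  swap
  · refine ⟨0, contDiff_const, fun y k hk => ?_, fun y => le_rfl, fun x hx => absurd ⟨x, hx⟩ hE⟩
    rw [show iteratedFDeriv ℝ k (0 : Euc n → ℝ) y = 0 from congrFun iteratedFDeriv_fun_zero y, norm_zero]
    linarith
  have hwit : ∀ w : Euc n, ∃ F : Euc n → ℝ, w ∈ E → ContDiff ℝ m F ∧ (∀ y, ∀ k ≤ m, ‖iteratedFDeriv ℝ k F y‖ ≤ M) ∧ (∀ y, 0 ≤ F y) ∧ J w F = p w ∧ F w = f w := by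
    intro w
    by_cases hw : w ∈ E
    · obtain ⟨F, h⟩ := (hp w hw).1
      rw [← hM] at h
      exact ⟨F, fun _ => h⟩
    · exact ⟨0, fun h => absurd h hw⟩
  choose Fw hFw using hwit
  obtain ⟨τ, hτ, hτ1, hsep⟩ := sep_all E
  have hnear : ∀ z : Euc n, ∃ e ∈ E, ∀ e' ∈ E, ‖z - e‖ ≤ ‖z - e'‖ := fun z => Finset.exists_min_image E (fun e => ‖z - e‖) hE
  choose e heE hmin using hnear
  set r : Euc n → ℝ := fun z => min 1 (max ‖z - e z‖ τ) with hr
  have hr0 : ∀ z, 0 < r z := fun z => lt_min one_pos (lt_max_of_lt_right hτ)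
  have hdl : ∀ z w, ‖z - e z‖ ≤ ‖w - e w‖ + ‖z - w‖ := fun z w => by
    have := norm_sub_le_norm_sub_add_norm_sub z w (e w)
    linarith [hmin z (e w) (heE w)]
  have hrl : ∀ z w, r z ≤ r w + ‖z - w‖ := fun z w => by
    have hn := norm_nonneg (z - w)
    have h1 : r z ≤ 1 := min_le_left _ _
    have h2 : r z ≤ max ‖z - e z‖ τ := min_le_right _ _
    have h3 := hdl z w
    have h4 : max ‖z - e z‖ τ ≤ max ‖w - e w‖ τ + ‖z - w‖ := max_le (by linarith [le_max_left ‖w - e w‖ τ]) (by linarith [le_max_right ‖w - e w‖ τ])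
    have : r w = 1 ∨ r w = max ‖w - e w‖ τ := by
      simp only [hr]; exact min_choice _ _
    rcases this with h | h <;> rw [h] <;> linarith
  obtain ⟨Ψ, ctr, hΨ⟩ := hPU Set.univ r (fun z _ => hr0 z) (fun z _ w _ => hrl z w)
  have hΨ' := fun w => hΨ w (Set.mem_univ w)
  set v := vj Ψ (fun j z => Fw (e (ctr j z))) (fun z => Fw (e z) z) with hv
  -- geometry
  have hgeo : ∀ w q : Euc n, ‖w - q‖ ≤ r q / 4 → ‖w - e q‖ ≤ ‖w - e w‖ + r w := by
    intro w q hq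
    have h1 := hrl q w
    rw [norm_sub_rev q w] at h1
    have h0 := hr0 w
    have h2 := norm_sub_le_norm_sub_add_norm_sub w q (e q)
    have h3 := hdl q w
    rw [norm_sub_rev q w] at h3
    linarith
  have hr1 : ∀ w, r w ≤ 1 := fun w => min_le_left _ _
  have hdiff : ∀ w q : Euc n, ‖w - q‖ ≤ r q / 4 → ∀ k ≤ m, ‖iteratedFDeriv ℝ k (Fw (e q) - Fw (e w)) w‖ * r w ^ k ≤ Cd * r w ^ m := by
    intro w q hq k hk
    obtain ⟨a1, a2, a3, a4, a5⟩ := hFw (e q) (heE q)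
    obtain ⟨b1, b2, b3, b4, b5⟩ := hFw (e w) (heE w)
    have hrw := hr0 w
    by_cases hd : ‖w - e w‖ ≤ 1
    · have hdr : ‖w - e w‖ ≤ r w := le_min hd (le_max_left _ _)
      have h1 := hgeo w q hq
      have h2 : ‖e q - e w‖ ≤ 3 * r w := by
        have := norm_sub_le_norm_sub_add_norm_sub (e q) w (e w)
        rw [norm_sub_rev (e q) w] at this
        linarith
      have h3 : nb (e q) (3 * r w) (J (e q) (Fw (e q)) - J (e w) (Fw (e w)) : Pm m n) C := by
        rw [a4, b4]
        exact ((hp _ (heE q)).2 _ (heE w)).scale (norm_nonneg _) h2 (by linarith)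
      have h4 := cmp2 a1 b1 (M := M) (C := C) (s := 3 * r w) (y := w) (by linarith) (by linarith) (by linarith) (fun y => a2 y m le_rfl) (fun y => b2 y m le_rfl) h3
        (by linarith) (by linarith) hk
      rw [← hc1, mul_pow, mul_pow] at h4
      have h5 : (1:ℝ) ≤ 3 ^ k := one_le_pow₀ (by norm_num)
      have h6 : ‖iteratedFDeriv ℝ k (Fw (e q) - Fw (e w)) w‖ * r w ^ k ≤ ‖iteratedFDeriv ℝ k (Fw (e q) - Fw (e w)) w‖ * (3 ^ k * r w ^ k) :=
        mul_le_mul_of_nonneg_left (le_mul_of_one_le_left (by positivity) h5) (norm_nonneg _)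
      refine h6.trans (h4.trans (le_of_eq ?_))
      rw [hCd]; ring
    · push Not at hd
      have : r w = 1 := min_eq_left (hd.le.trans (le_max_left _ _))
      rw [this, one_pow, one_pow, mul_one, mul_one, iter_sub_apply a1 b1 hk]
      have h1 := norm_sub_le (iteratedFDeriv ℝ k (Fw (e q)) w) (iteratedFDeriv ℝ k (Fw (e w)) w)
      linarith [a2 w k hk, b2 w k hk]
  have hloc : ∀ w, ∃ G : Euc n → ℝ, ContDiff ℝ m G ∧ (∀ k ≤ m, ‖iteratedFDeriv ℝ k (G - Fw (e w)) w‖ * r w ^ k ≤ Bj m K Cd N * r w ^ m) ∧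
      ∀ z, ‖z - w‖ ≤ c0 * r w → v N z = G z := by
    intro w
    obtain ⟨h1, h2, i, hi, h3⟩ := hΨ' w
    have hρ : 0 < c0 * r w := mul_pos hc0 (hr0 w)
    obtain ⟨G, g1, g2, g3⟩ := vj_local (Ψ := Ψ) (Fe := fun j z => Fw (e (ctr j z))) (v0 := fun z => Fw (e z) z) (F0 := Fw (e w)) (w := w) (K := K) (Cd := Cd) (i := i) (by linarith) hCd0 (hr0 w) hρ
      (hFw _ (heE w)).1
      (fun j => by
        obtain ⟨θ, t1, t2, t3⟩ := h1 j
        exact ⟨θ, t1.of_le (by exact_mod_cast le_top), (t2 w).2.2, t3⟩)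
      (fun j => by
        rcases h2 j with h | ⟨q, _, h⟩
        · exact Or.inl h
        · refine Or.inr ⟨Fw (e q), (hFw _ (heE q)).1, fun z hz => by rw [(h z (Set.mem_univ _) hz).1], hdiff w q ?_⟩
          exact (h w (Set.mem_univ _) (by simpa using hρ.le)).2)
      h3 N
    exact ⟨G, g1, g2, g3 hi⟩
  refine ⟨v N, ?_, fun w k hk => ?_, fun y => ?_, fun x hx => ?_⟩
  · rw [contDiff_iff_contDiffAt]
    intro w
    obtain ⟨G, g1, g2, g3⟩ := hloc w
    exact g1.contDiffAt.congr_of_eventuallyEq (ev_of_ball g3 (a := 0) (by simp) (mul_pos hc0 (hr0 w)))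
  · obtain ⟨G, g1, g2, g3⟩ := hloc w
    have hev := ev_of_ball g3 (w' := w) (a := 0) (by simp) (mul_pos hc0 (hr0 w))
    rw [(hev.iteratedFDeriv ℝ k).eq_of_nhds]
    obtain ⟨b1, b2, b3, b4, b5⟩ := hFw (e w) (heE w)
    have h1 := g2 k hk
    have h2 : Bj m K Cd N * r w ^ m ≤ Bj m K Cd N * r w ^ k := mul_le_mul_of_nonneg_left (pow_le_pow_of_le_one (hr0 w).le (hr1 w) hk) hBN
    have h3 := le_of_mul_le_mul_right (h1.trans h2) (pow_pos (hr0 w) k)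
    rw [iter_sub_apply g1 b1 hk] at h3
    have h4 := norm_sub_norm_le (iteratedFDeriv ℝ k G w) (iteratedFDeriv ℝ k (Fw (e w)) w)
    linarith [b2 w k hk]
  · refine vj_nonneg (Ψ := Ψ) (Fe := fun j z => Fw (e (ctr j z))) (v0 := fun z => Fw (e z) z) (x := y) (fun j => ?_) (fun j => (hFw _ (heE _)).2.2.1 _) ((hFw _ (heE _)).2.2.1 _) N
    obtain ⟨θ, t1, t2, t3⟩ := (hΨ' y).1 j
    rw [t3 y (by simpa using (mul_pos hc0 (hr0 y)).le)]
    exact ⟨(t2 y).1, (t2 y).2.1⟩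
  · have hex : e x = x := by
      have := hmin x x hx
      rw [sub_self, norm_zero] at this
      have := norm_le_zero_iff.1 this
      exact (sub_eq_zero.1 this).symm
    have hrx : r x ≤ τ := by
      have : ‖x - e x‖ = 0 := by rw [hex, sub_self, norm_zero]
      simp only [hr]; rw [this]; exact (min_le_right _ _).trans (max_le hτ.le le_rfl)
    refine vj_val (Ψ := Ψ) (Fe := fun j z => Fw (e (ctr j z))) (v0 := fun z => Fw (e z) z) (x := x) (fun j => ?_) (by simp only [hex]; exact (hFw x hx).2.2.2.2) N
    have hself : ‖x - x‖ ≤ c0 * r x := by simpa using (mul_pos hc0 (hr0 x)).le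
    rcases (hΨ' x).2.1 j with h | ⟨q, _, h⟩
    · exact Or.inl (h x hself)
    · right
      obtain ⟨h1, h2⟩ := h x (Set.mem_univ _) hself
      have h3 := hgeo x q h2
      rw [hex, sub_self, norm_zero, zero_add] at h3
      have h4 : e q = x := hsep x hx (e q) (heE q) (by rw [norm_sub_rev]; linarith)
      simp only [h1, h4]
      exact (hFw x hx).2.2.2.2

end FP

namespace FP
open scoped ContDiff Classical Topology
set_option linter.all false
variable {m n : ℕ}

lemma peval_mem (hm : 0 < m) (P : MPoly n) (hP : P.totalDegree ≤ m - 1) : peval P ∈ Pm m n := by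
  have h1 : peval P = ∑ s ∈ P.support, (P.coeff s * ∏ i, ((s i).factorial : ℝ)) • Em (fun i => s i) 0 := by
    funext z
    rw [peval, MvPolynomial.eval_eq', Finset.sum_apply]
    refine Finset.sum_congr rfl fun s _ => ?_
    simp only [Pi.smul_apply, smul_eq_mul, Em]
    rw [mul_assoc, ← Finset.prod_mul_distrib]
    congr 1
    refine Finset.prod_congr rfl fun i _ => ?_
    have : ((s i).factorial : ℝ) ≠ 0 := by exact_mod_cast (s i).factorial_ne_zero
    simp only [PiLp.zero_apply, sub_zero]
    field_simp
  rw [h1]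
  refine Submodule.sum_mem _ fun s hs => Submodule.smul_mem _ _ ?_
  have hd : deg (fun i => s i) < m := by
    have h2 := MvPolynomial.le_totalDegree hs
    rw [Finsupp.sum_fintype _ _ (fun _ => rfl)] at h2
    show ∑ i, s i < m
    omega
  rw [← eb_coe hd]
  exact (eb _ _).2

lemma mD_zero' (F : Euc n → ℝ) : mD (0 : Fin n → ℕ) F = F := by
  have : ml (0 : Fin n → ℕ) = [] := by
    rw [← List.length_eq_zero_iff, ml_length]; simp [deg]
  rw [mD_def, this]; rfl

/-- rescaled polynomial as an element of `Pm` -/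
def pp (c : ℝ) (Q : MPoly n) : Pm m n := if h : peval Q ∈ Pm m n then c • ⟨peval Q, h⟩ else 0

lemma cf_pp (c : ℝ) {Q : MPoly n} (h : peval Q ∈ Pm m n) (x : Euc n) (β : Fin n → ℕ) :
    cf x β (pp c Q : Pm m n) = c * mD β (peval Q) x := by
  rw [pp, dif_pos h, map_smul, smul_eq_mul]; rfl

lemma pp_mem (hm : 0 < m) {M : ℝ} (hM : 0 < M) {f : Euc n → ℝ} {x : Euc n} {Q : MPoly n} (h : Q ∈ GammaF m n f x M) :
    peval Q ∈ Pm m n ∧ (pp M⁻¹ Q : Pm m n) ∈ GF (fun z => M⁻¹ * f z) x 1 := by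
  obtain ⟨⟨F, ⟨hF, hb⟩, hn, hd, hj⟩, hv⟩ := h
  have hF' : ContDiff ℝ m F := by exact_mod_cast hF
  have hQ := peval_mem hm Q hd
  refine ⟨hQ, M⁻¹ • F, cd_smul hF' _, fun y k hk => ?_, fun y => ?_, ?_, ?_⟩
  · refine (norm_iter_le (cd_smul hF' M⁻¹) hk y zero_le_one (fun β hβ => ?_)).trans ?_
    · rw [mD_smul hF' _ (by omega), abs_mul, abs_of_pos (inv_pos.2 hM), inv_mul_le_iff₀ hM, mul_one]
      exact hb β (by omega) y
    · rw [mul_one, mul_one, cn]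
      calc (n:ℝ) ^ k ≤ ((n:ℝ) + 1) ^ k := by gcongr; linarith
        _ ≤ ((n:ℝ) + 1) ^ m := pow_le_pow_right₀ (by linarith [(Nat.cast_nonneg n : (0:ℝ) ≤ n)]) hk
  · exact mul_nonneg (inv_pos.2 hM).le (hn y)
  · refine Pm_ext x fun β hβ => ?_
    have hb' := mem_mis.1 hβ
    rw [cf_J x _ hβ, cf_pp _ hQ, mD_smul hF' _ hb'.le, hj β (by omega)]
  · have := hj 0 (by simp [deg])
    rw [mD_zero', mD_zero'] at this
    show M⁻¹ * F x = M⁻¹ * f x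
    rw [← this, hv]

theorem main (m n : ℕ) (hm : 0 < m) :
    ∃ (kSharp : ℕ) (C : ℝ), 0 < C ∧
      ∀ (E : Set (Euc n)), E.Finite → ∀ f : Euc n → ℝ, (∀ x ∈ E, 0 ≤ f x) →
        ∀ M₀ : ℝ, 0 < M₀ →
        (∀ S : Set (Euc n), S ⊆ E → S.ncard ≤ kSharp →
          ∃ P : Euc n → MPoly n,
            (∀ x ∈ S, P x ∈ GammaF m n f x M₀) ∧
            (∀ x ∈ S, ∀ y ∈ S, ∀ β : Fin n → ℕ, deg β ≤ m - 1 →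
              |mD β (peval (P x - P y)) x| ≤ M₀ * ‖x - y‖ ^ (m - deg β))) →
        ∃ F : Euc n → ℝ, CmNormLe m n F (C * M₀) ∧ (∀ y, 0 ≤ F y) ∧
          ∀ x ∈ E, F x = f x := by
  obtain ⟨L, hL⟩ := select m n
  obtain ⟨Cw, hCw⟩ := GF_SF m n
  obtain ⟨Cw', hCw'⟩ := exists_chain (m := m) (n := n) L Cw
  have h1 : 1 ≤ Cw' := ((hCw' ∅ _ (hCw 0)).sf 0 (Nat.zero_le _)).one
  obtain ⟨C', hC', hsel⟩ := hL Cw' h1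
  obtain ⟨C'', hC'', hext⟩ := extend m n C' hC'
  refine ⟨kk (Module.finrank ℝ (Pm m n)) (L + 1), C'', by linarith, ?_⟩
  intro E hE f hf M₀ hM hyp
  obtain ⟨E, rfl⟩ := hE.exists_finset_coe
  obtain ⟨p, hp⟩ := hsel E (RefN ↑E (GF (fun z => M₀⁻¹ * f z))) (hCw' _ _ (hCw _)) (RefN_nonempty _ (fun x => GF_conv _ x 1) E L (by
    intro S hS hk
    obtain ⟨P, hP, hc⟩ := hyp S (by exact_mod_cast hS) (by rw [Set.ncard_coe_finset]; exact hk)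
    refine ⟨fun x => pp M₀⁻¹ (P x), fun x hx => (pp_mem hm hM (hP x hx)).2, fun x hx y hy hxy β hβ => ?_⟩
    have hx1 := (pp_mem hm hM (hP x hx)).1
    have hy1 := (pp_mem hm hM (hP y hy)).1
    have hb' := mem_mis.1 hβ
    have h2 := hc x hx y hy β (by omega)
    have e1 : peval (P x - P y) = peval (P x) - peval (P y) := by
      funext z; simp [peval]
    rw [e1, mD_sub (N := m) (Pm_cd ⟨_, hx1⟩) (Pm_cd ⟨_, hy1⟩) hb'.le] at h2
    rw [map_sub, cf_pp _ hx1, cf_pp _ hy1, ← mul_sub, abs_mul, abs_of_pos (inv_pos.2 hM), inv_mul_le_iff₀ hM, one_mul]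
    exact h2))
  obtain ⟨F, hF, hb, hn, hv⟩ := hext E _ p hp
  refine ⟨M₀ • F, ⟨by exact_mod_cast cd_smul hF M₀, fun α hα x => ?_⟩, fun y => mul_nonneg hM.le (hn y), fun x hx => ?_⟩
  · rw [mD_smul hF _ hα, abs_mul, abs_of_pos hM, mul_comm]
    exact mul_le_mul_of_nonneg_right ((abs_mD_le hF α hα x).trans (hb x _ hα)) hM.le
  · show M₀ * F x = f x
    rw [hv x (by exact_mod_cast hx), mul_inv_cancel_left₀ hM.ne']

end FP

/-- **Finiteness principle for nonnegative `C^m` interpolation** (jet form). -/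
theorem fp_nonneg_Cm_jets (m n : ℕ) (hm : 0 < m) (hn : 0 < n) :
    ∃ (kSharp : ℕ) (C : ℝ), 0 < C ∧
      ∀ (E : Set (Euc n)), E.Finite → ∀ f : Euc n → ℝ, (∀ x ∈ E, 0 ≤ f x) →
        ∀ M₀ : ℝ, 0 < M₀ →
        (∀ S : Set (Euc n), S ⊆ E → S.ncard ≤ kSharp →
          ∃ P : Euc n → MPoly n,
            (∀ x ∈ S, P x ∈ GammaF m n f x M₀) ∧
            (∀ x ∈ S, ∀ y ∈ S, ∀ β : Fin n → ℕ, deg β ≤ m - 1 →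
              |mD β (peval (P x - P y)) x| ≤ M₀ * ‖x - y‖ ^ (m - deg β))) →
        ∃ F : Euc n → ℝ, CmNormLe m n F (C * M₀) ∧ (∀ y, 0 ≤ F y) ∧
          ∀ x ∈ E, F x = f x := by
  exact FP.main m n hm

end
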